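/- arXiv:2605.05243 — 4 statements merged into one kernel-verified Lean document; each statement's English description precedes it below -/
import Mathlib

section
/- Let d ≥ 3 and 0 < p ≤ 1. Then the minimum of ‖x‖_p / ‖x‖_2 over all nonzero vectors x ∈ ℝ^d with x_1 + ⋯ + x_d = 0 equals 2^{1/p − 1/2}; that is, every such x satisfies ‖x‖_p ≥ 2^{1/p − 1/2} ‖x‖_2, and there is a nonzero zero-sum vector attaining equality (e.g. (1, −1, 0, …, 0)). -/
/-- Subadditivity of `t ↦ |t| ^ p` for `0 < p ≤ 1`, over finite sums. -/
theorem abs_sum_rpow_le_sum_abs_rpow {ι : Type*} (s : Finset ι) (x : ι → ℝ) {p : ℝ}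
    (hp0 : 0 < p) (hp1 : p ≤ 1) : |∑ i ∈ s, x i| ^ p ≤ ∑ i ∈ s, |x i| ^ p := by
  refine Finset.le_sum_of_subadditive (fun t : ℝ => |t| ^ p) ?_ (fun a b => ?_) s x
  · simp [Real.zero_rpow hp0.ne']
  · exact (Real.rpow_le_rpow (abs_nonneg _) (abs_add_le a b) hp0.le).trans
      (Real.rpow_add_le_add_rpow (abs_nonneg a) (abs_nonneg b) hp0.le hp1)

/-- In a zero-sum family, each `|x i| ^ p` is at most half of the total. -/
theorem abs_rpow_le_half_sum_of_sum_eq_zero {ι : Type*} [Fintype ι] (x : ι → ℝ) {p : ℝ}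
    (hp0 : 0 < p) (hp1 : p ≤ 1) (hx : ∑ i, x i = 0) (i : ι) :
    |x i| ^ p ≤ (∑ j, |x j| ^ p) / 2 := by
  classical
  have h := abs_sum_rpow_le_sum_abs_rpow (Finset.univ.erase i) x hp0 hp1
  have h1 := Finset.add_sum_erase Finset.univ x (Finset.mem_univ i)
  have h2 := Finset.add_sum_erase Finset.univ (fun j => |x j| ^ p) (Finset.mem_univ i)
  have h3 : ∑ j ∈ Finset.univ.erase i, x j = -x i := by linarith
  rw [h3, abs_neg] at h
  linarith

/-- The `ℓ_2` norm of a zero-sum family is bounded by its `ℓ_p` quasi-norm. -/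
theorem sum_sq_le_of_sum_eq_zero {ι : Type*} [Fintype ι] (x : ι → ℝ) {p : ℝ}
    (hp0 : 0 < p) (hp1 : p ≤ 1) (hx : ∑ i, x i = 0) :
    ∑ i, x i ^ 2 ≤ 2 * (((∑ j, |x j| ^ p) / 2) ^ (1 / p)) ^ 2 := by
  set U := (∑ j, |x j| ^ p) / 2 with hU
  have hU0 : 0 ≤ U := by positivity
  have hs : 0 ≤ 2 / p - 1 := by
    rw [sub_nonneg, le_div_iff₀ hp0]; linarith
  have hs0 : 1 + (2 / p - 1) ≠ 0 := by
    have : 0 < 2 / p := by positivity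
    linarith
  have key : ∀ i, x i ^ 2 ≤ |x i| ^ p * U ^ (2 / p - 1) := fun i => by
    have h0 : 0 ≤ |x i| ^ p := by positivity
    have e : x i ^ 2 = |x i| ^ p * (|x i| ^ p) ^ (2 / p - 1) := by
      rw [← Real.rpow_one_add' h0 hs0, ← Real.rpow_mul (abs_nonneg _), ← sq_abs, ← Real.rpow_natCast]
      congr 1
      push_cast
      field_simp
      ring
    rw [e]
    exact mul_le_mul_of_nonneg_left (Real.rpow_le_rpow h0
      (abs_rpow_le_half_sum_of_sum_eq_zero x hp0 hp1 hx i) hs) h0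
  calc ∑ i, x i ^ 2 ≤ ∑ i, |x i| ^ p * U ^ (2 / p - 1) := Finset.sum_le_sum fun i _ => key i
    _ = 2 * (U ^ (1 : ℝ) * U ^ (2 / p - 1)) := by
      rw [← Finset.sum_mul, Real.rpow_one, ← mul_assoc]
      congr 1
      rw [hU]; ring
    _ = 2 * (U ^ (1 / p)) ^ 2 := by
      rw [← Real.rpow_add' hU0 hs0, ← Real.rpow_natCast, ← Real.rpow_mul hU0]
      congr 2
      push_cast
      ring

/-- For `d ≥ 3` and `0 < p ≤ 1`, the minimum of `‖x‖_p / ‖x‖_2` over nonzero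
zero-sum vectors `x ∈ ℝ^d` equals `2^(1/p - 1/2)`. -/
theorem holevo_utkin_p_le_one (d : ℕ) (hd : 3 ≤ d) (p : ℝ) (hp0 : 0 < p) (hp1 : p ≤ 1) :
    IsLeast { r : ℝ | ∃ x : Fin d → ℝ, x ≠ 0 ∧ (∑ i, x i) = 0 ∧
        r = (∑ i, |x i| ^ p) ^ (1 / p) / Real.sqrt (∑ i, (x i) ^ 2) }
      ((2 : ℝ) ^ (1 / p - 1 / 2 : ℝ)) := by
  have h2 : (2 : ℝ) ^ (1 / p - 1 / 2 : ℝ) = 2 ^ (1 / p) / √2 := by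
    rw [Real.rpow_sub two_pos, Real.sqrt_eq_rpow]
  rw [h2]
  constructor
  · obtain ⟨n, rfl⟩ : ∃ n, d = n + 2 := ⟨d - 2, by omega⟩
    refine ⟨Fin.cons 1 (Fin.cons (-1) 0), fun h => ?_, ?_, ?_⟩
    · simpa using congrFun h 0
    · simp [Fin.sum_univ_succ]
    · simp [Fin.sum_univ_succ, Real.zero_rpow hp0.ne', one_add_one_eq_two]
  · rintro r ⟨x, hx0, hx, rfl⟩
    obtain ⟨i, hi⟩ := Function.ne_iff.mp hx0
    have hQ : 0 < ∑ i, x i ^ 2 :=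
      Finset.sum_pos' (fun j _ => sq_nonneg _) ⟨i, Finset.mem_univ i, sq_pos_of_ne_zero hi⟩
    have hT : 0 ≤ ∑ j, |x j| ^ p := by positivity
    have hle := Real.sqrt_le_sqrt (sum_sq_le_of_sum_eq_zero x hp0 hp1 hx)
    rw [Real.sqrt_mul two_pos.le, Real.sqrt_sq (by positivity),
      Real.div_rpow hT two_pos.le] at hle
    rw [div_le_div_iff₀ (by positivity) (Real.sqrt_pos.mpr hQ)]
    have hc : (0 : ℝ) < 2 ^ (1 / p) := by positivity
    calc _ ≤ 2 ^ (1 / p) * (√2 * ((∑ j, |x j| ^ p) ^ (1 / p) / 2 ^ (1 / p))) :=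
          mul_le_mul_of_nonneg_left hle hc.le
      _ = _ := by field_simp
end

section
/- Let d ≥ 3 and 1 < p < 2. Then the minimum of ‖x‖_p / ‖x‖_2 over all nonzero vectors x ∈ ℝ^d with x_1 + ⋯ + x_d = 0 equals min{ 2^{1/p − 1/2}, ( ((d−1)^{p/2} + (d−1)^{1−p/2}) / d^{p/2} )^{1/p} }. -/
/-- Up to a negative factor, the derivative in `t` of `‖x‖_p ^ p / ‖x‖_2 ^ p` at
`x = (-(1 + m t), 1, t, …, t)`, where `q = p - 1`. -/
noncomputable def slopeGap (m q t : ℝ) : ℝ :=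
  1 + (m + 1) * t - (2 + m * t) * t ^ q - (1 - t) * (1 + m * t) ^ q

/-- The second derivative of `slopeGap`. -/
noncomputable def slopeGapDeriv2 (m q t : ℝ) : ℝ :=
  q * (t ^ (q - 2) * ((1 - q) * 2 - (1 + q) * (m * t)) +
    m * (1 + m * t) ^ (q - 2) * (2 + (1 - q) * m + (1 + q) * (m * t)))

/-- The derivative of `slopeGap`. -/
noncomputable def slopeGapDeriv (m q t : ℝ) : ℝ :=
  (m + 1) - m * t ^ q - (2 + m * t) * (q * t ^ (q - 1)) + (1 + m * t) ^ q
    - (1 - t) * (q * m * (1 + m * t) ^ (q - 1))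

lemma hasDerivAt_slopeGap {m q t : ℝ} (hm : 0 < m) (ht : 0 < t) :
    HasDerivAt (slopeGap m q) (slopeGapDeriv m q t) t := by
  have hw : 0 < 1 + m * t := by positivity
  have h1 : HasDerivAt (fun t : ℝ => 1 + m * t) m t := by
    simpa using ((hasDerivAt_id t).const_mul m).const_add 1
  have h2 := (hasDerivAt_id t).rpow_const (p := q) (Or.inl ht.ne')
  have h3 := h1.rpow_const (p := q) (Or.inl hw.ne')
  have h4 : HasDerivAt (fun t : ℝ => 2 + m * t) m t := by
    simpa using ((hasDerivAt_id t).const_mul m).const_add 2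
  have h5 : HasDerivAt (fun t : ℝ => 1 + (m + 1) * t) (m + 1) t := by
    simpa using ((hasDerivAt_id t).const_mul (m + 1)).const_add 1
  have h6 : HasDerivAt (fun t : ℝ => 1 - t) (-1) t := by
    simpa using (hasDerivAt_id t).const_sub 1
  refine (((h5.sub (h4.mul h2)).sub (h6.mul h3))).congr_deriv ?_
  simp only [slopeGapDeriv, id]
  ring

lemma hasDerivAt_slopeGapDeriv {m q t : ℝ} (hm : 0 < m) (ht : 0 < t) :
    HasDerivAt (slopeGapDeriv m q) (slopeGapDeriv2 m q t) t := by
  have hw : 0 < 1 + m * t := by positivity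
  have h1 : HasDerivAt (fun t : ℝ => 1 + m * t) m t := by
    simpa using ((hasDerivAt_id t).const_mul m).const_add 1
  have h2 := (hasDerivAt_id t).rpow_const (p := q) (Or.inl ht.ne')
  have h2' := (hasDerivAt_id t).rpow_const (p := q - 1) (Or.inl ht.ne')
  have h3 := h1.rpow_const (p := q) (Or.inl hw.ne')
  have h3' := h1.rpow_const (p := q - 1) (Or.inl hw.ne')
  have h4 : HasDerivAt (fun t : ℝ => 2 + m * t) m t := by
    simpa using ((hasDerivAt_id t).const_mul m).const_add 2
  have h6 : HasDerivAt (fun t : ℝ => 1 - t) (-1) t := by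
    simpa using (hasDerivAt_id t).const_sub 1
  refine (((((h2.const_mul m).const_sub (m + 1)).sub (h4.mul (h2'.const_mul q))).add h3).sub
    (h6.mul (h3'.const_mul (q * m)))).congr_deriv ?_
  have e1 : t ^ (q - 1) = t ^ (q - 2) * t := by
    rw [← Real.rpow_add_one ht.ne']; ring_nf
  have e2 : (1 + m * t) ^ (q - 1) = (1 + m * t) ^ (q - 2) * (1 + m * t) := by
    rw [← Real.rpow_add_one hw.ne']; ring_nf
  have e3 : q - 1 - 1 = q - 2 := by ring
  simp only [slopeGapDeriv2, id, e3, e1, e2]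
  ring

lemma continuousOn_slopeGap {m q : ℝ} (hq : 0 < q) :
    ContinuousOn (slopeGap m q) (Set.Icc 0 1) := by
  have h1 : ContinuousOn (fun t : ℝ => t ^ q) (Set.Icc 0 1) :=
    (Real.continuous_rpow_const hq.le).continuousOn
  have h2 : ContinuousOn (fun t : ℝ => (1 + m * t) ^ q) (Set.Icc 0 1) :=
    ((Real.continuous_rpow_const hq.le).comp
      (continuous_const.add (continuous_const.mul continuous_id))).continuousOn
  unfold slopeGap
  fun_prop

lemma slopeGapDeriv2_nonpos_of_le {m q s t : ℝ} (hm : 0 < m) (hq0 : 0 < q) (hq1 : q < 1)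
    (hs : 0 < s) (hst : s ≤ t) (h : slopeGapDeriv2 m q s ≤ 0) : slopeGapDeriv2 m q t ≤ 0 := by
  set N : ℝ → ℝ := fun t => (1 + q) * (m * t) - (1 - q) * 2 with hN
  set D : ℝ → ℝ := fun t => m * (2 + (1 - q) * m + (1 + q) * (m * t)) with hD
  set J : ℝ → ℝ := fun t =>
    (q - 2) * (Real.log t - Real.log (1 + m * t)) + (Real.log (N t) - Real.log (D t)) with hJ
  have hq1' : 0 < 1 - q := by linarith
  have hDpos : ∀ u, 0 < u → 0 < D u := fun u hu => by simp only [hD]; positivity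
  have hwpos : ∀ u, 0 < u → 0 < 1 + m * u := fun u hu => by positivity
  have key : ∀ u, 0 < u → (slopeGapDeriv2 m q u ≤ 0 ↔ 0 < N u ∧ 0 ≤ J u) := by
    intro u hu
    have a1 : 0 < u ^ (q - 2) := Real.rpow_pos_of_pos hu _
    have a2 : 0 < (1 + m * u) ^ (q - 2) := Real.rpow_pos_of_pos (hwpos u hu) _
    have e : slopeGapDeriv2 m q u = q * ((1 + m * u) ^ (q - 2) * D u - u ^ (q - 2) * N u) := by
      simp only [slopeGapDeriv2, hN, hD]; ring
    have e1 : slopeGapDeriv2 m q u ≤ 0 ↔ (1 + m * u) ^ (q - 2) * D u ≤ u ^ (q - 2) * N u := by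
      rw [e]
      constructor
      · intro h; by_contra! hc; nlinarith
      · intro h; nlinarith
    rw [e1]
    have a3 := mul_pos a2 (hDpos u hu)
    by_cases hNu : 0 < N u
    · rw [← Real.log_le_log_iff a3 (mul_pos a1 hNu), Real.log_mul a2.ne' (hDpos u hu).ne',
        Real.log_mul a1.ne' hNu.ne', Real.log_rpow hu, Real.log_rpow (hwpos u hu)]
      simp only [hNu, true_and, hJ]
      constructor <;> intro h <;> linarith
    · simp only [hNu, false_and, iff_false, not_le]
      nlinarith
  rw [key s hs] at h
  rw [key t (hs.trans_le hst)]
  have hNmono : ∀ u, s ≤ u → 0 < N u := fun u hu => by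
    have := mul_le_mul_of_nonneg_left hu hm.le
    have h1 := h.1
    simp only [hN] at h1 ⊢
    nlinarith
  refine ⟨hNmono t hst, h.2.trans ?_⟩
  have hder : ∀ u, s ≤ u → HasDerivAt J ((q - 2) * (1 / u - m / (1 + m * u)) +
      ((1 + q) * m / N u - m * ((1 + q) * m) / D u)) u := by
    intro u hu
    have hu0 := hs.trans_le hu
    have h1 : HasDerivAt (fun t : ℝ => 1 + m * t) m u := by
      simpa using ((hasDerivAt_id u).const_mul m).const_add 1
    have h2 : HasDerivAt N ((1 + q) * m) u := by
      exact ((((hasDerivAt_id u).const_mul m).const_mul (1 + q)).sub_const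
        ((1 - q) * 2)).congr_deriv (by ring)
    have h3 : HasDerivAt D (m * ((1 + q) * m)) u := by
      simpa using ((((hasDerivAt_id u).const_mul m).const_mul (1 + q)).const_add
        (2 + (1 - q) * m)).const_mul m
    exact ((((hasDerivAt_id u).log hu0.ne').sub (h1.log (hwpos u hu0).ne')).const_mul (q - 2)).add
      ((h2.log (hNmono u hu).ne').sub (h3.log (hDpos u hu0).ne'))
  have hmono : MonotoneOn J (Set.Ici s) := by
    refine monotoneOn_of_deriv_nonneg (convex_Ici s)
      (fun u hu => (hder u hu).continuousAt.continuousWithinAt) ?_ ?_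
    · intro u hu
      exact (hder u (interior_subset hu)).differentiableAt.differentiableWithinAt
    · intro u hu
      have hu := interior_subset hu
      rw [(hder u hu).deriv]
      have hu0 := hs.trans_le hu
      have hNu := hNmono u hu
      have hDu := hDpos u hu0
      have hwu := hwpos u hu0
      have : (q - 2) * (1 / u - m / (1 + m * u)) +
          ((1 + q) * m / N u - m * ((1 + q) * m) / D u) =
          ((1 + q) * m * (D u - m * N u) * (u * (1 + m * u)) - (2 - q) * (N u * D u)) /
            (u * (1 + m * u) * (N u * D u)) := by
        field_simp
        ring
      rw [this]
      refine div_nonneg ?_ (by positivity)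
      set y := m * u with hy
      have hy0 : 0 < y := mul_pos hm hu0
      have e : (1 + q) * m * (D u - m * N u) * (u * (1 + m * u)) - (2 - q) * (N u * D u) =
          m * (1 - q) * ((1 + q) * (2 - q) * (y ^ 2 + 2 * y) + 4 * (2 - q) +
            m * ((1 + q) * (y - (1 - q) / 2) ^ 2 +
              (1 - q) * (2 * (2 - q) - (1 + q) * (1 - q) / 4))) := by
        simp only [hN, hD, hy]; ring
      rw [e]
      have : 0 < 2 - q := by linarith
      have : 0 ≤ 2 * (2 - q) - (1 + q) * (1 - q) / 4 := by nlinarith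
      positivity
  exact hmono Set.self_mem_Ici hst hst

/-- Once positive on `[0, 1]`, `slopeGap` stays nonnegative. -/
lemma slopeGap_nonneg_of_pos {m q s t : ℝ} (hm : 0 < m) (hq0 : 0 < q) (hq1 : q < 1)
    (hs : 0 ≤ s) (hst : s ≤ t) (ht : t ≤ 1) (h : 0 < slopeGap m q s) : 0 ≤ slopeGap m q t := by
  have f0 : slopeGap m q 0 = 0 := by simp [slopeGap, Real.zero_rpow hq0.ne']
  have f1 : slopeGap m q 1 = 0 := by simp [slopeGap]; ring
  set U : Set ℝ := {u | u ∈ Set.Ioo (0 : ℝ) 1 ∧ slopeGapDeriv2 m q u ≤ 0} ∪ {1} with hU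
  have hbdd : BddBelow U := ⟨0, by rintro u (⟨hu, -⟩ | rfl); exacts [hu.1.le, zero_le_one]⟩
  have hne : U.Nonempty := ⟨1, Or.inr rfl⟩
  set τ := sInf U with hτ
  have hτ0 : 0 ≤ τ := le_csInf hne (by rintro u (⟨hu, -⟩ | rfl); exacts [hu.1.le, zero_le_one])
  have hτ1 : τ ≤ 1 := csInf_le hbdd (Or.inr rfl)
  have hconv : ConvexOn ℝ (Set.Icc 0 τ) (slopeGap m q) := by
    refine convexOn_of_hasDerivWithinAt2_nonneg (f' := slopeGapDeriv m q)
      (f'' := slopeGapDeriv2 m q) (convex_Icc 0 τ)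
      ((continuousOn_slopeGap hq0).mono (Set.Icc_subset_Icc_right hτ1)) ?_ ?_ ?_ <;>
    rw [interior_Icc] <;> intro u hu
    · exact (hasDerivAt_slopeGap hm hu.1).hasDerivWithinAt
    · exact (hasDerivAt_slopeGapDeriv hm hu.1).hasDerivWithinAt
    · by_contra! hc
      exact absurd (csInf_le hbdd (Or.inl ⟨⟨hu.1, hu.2.trans_le hτ1⟩, hc.le⟩)) (not_le.2 hu.2)
  have hconc : ConcaveOn ℝ (Set.Icc τ 1) (slopeGap m q) := by
    refine concaveOn_of_hasDerivWithinAt2_nonpos (f' := slopeGapDeriv m q)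
      (f'' := slopeGapDeriv2 m q) (convex_Icc τ 1)
      ((continuousOn_slopeGap hq0).mono (Set.Icc_subset_Icc_left hτ0)) ?_ ?_ ?_ <;>
    rw [interior_Icc] <;> intro u hu
    · exact (hasDerivAt_slopeGap hm (hτ0.trans_lt hu.1)).hasDerivWithinAt
    · exact (hasDerivAt_slopeGapDeriv hm (hτ0.trans_lt hu.1)).hasDerivWithinAt
    · obtain ⟨v, hv | hv, hvu⟩ := exists_lt_of_csInf_lt hne hu.1
      · exact slopeGapDeriv2_nonpos_of_le hm hq0 hq1 hv.1.1 hvu.le hv.2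
      · rw [Set.mem_singleton_iff] at hv
        exact absurd hu.2 (by linarith)
  have right : ∀ a b, τ ≤ a → a ≤ b → b ≤ 1 → 0 ≤ slopeGap m q a → 0 ≤ slopeGap m q b := by
    intro a b ha hab hb hfa
    have hmin := hconc.min_le_of_mem_Icc (x := a) (y := 1) (z := b) ⟨ha, hab.trans hb⟩
      ⟨hτ1, le_rfl⟩ ⟨hab, hb⟩
    rw [f1, min_eq_right hfa] at hmin
    exact hmin
  have left : ∀ b, s ≤ b → b ≤ τ → 0 < slopeGap m q b := by
    intro b hsb hb
    have hmax := hconv.le_max_of_mem_Icc (x := 0) (y := b) (z := s) ⟨le_rfl, hτ0⟩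
      ⟨hs.trans hsb, hb⟩ ⟨hs, hsb⟩
    rw [f0] at hmax
    exact (lt_max_iff.1 (h.trans_le hmax)).resolve_left (lt_irrefl 0)
  rcases le_total τ s with hτs | hτs
  · exact right s t hτs hst ht h.le
  rcases le_total t τ with htτ | htτ
  · exact (left t hst htτ).le
  · exact right τ t le_rfl htτ ht (left τ hτs le_rfl).le

/-- `‖x‖_p ^ p / ‖x‖_2 ^ p` for `x = (-(1 + m t), 1, t, …, t)`, with `m` copies of `t`. -/
noncomputable def ratioPow (m p t : ℝ) : ℝ :=
  ((1 + m * t) ^ p + 1 + m * t ^ p) * ((1 + m * t) ^ 2 + 1 + m * t ^ 2) ^ (-(p / 2))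

lemma hasDerivAt_ratioPow {m p t : ℝ} (hm : 0 < m) (ht : 0 < t) :
    HasDerivAt (ratioPow m p) (-(p * m * ((1 + m * t) ^ 2 + 1 + m * t ^ 2) ^ (-(p / 2) - 1)) *
      slopeGap m (p - 1) t) t := by
  have hw : 0 < 1 + m * t := by positivity
  have hG : 0 < (1 + m * t) ^ 2 + 1 + m * t ^ 2 := by positivity
  have h1 : HasDerivAt (fun t : ℝ => 1 + m * t) m t := by
    simpa using ((hasDerivAt_id t).const_mul m).const_add 1
  have h2 := (hasDerivAt_id t).rpow_const (p := p) (Or.inl ht.ne')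
  have h3 := h1.rpow_const (p := p) (Or.inl hw.ne')
  have hF := (h3.add_const 1).add (h2.const_mul m)
  have hG' : HasDerivAt (fun t : ℝ => (1 + m * t) ^ 2 + 1 + m * t ^ 2)
      (2 * m * (1 + m * t + t)) t :=
    (((h1.pow 2).add_const 1).add (((hasDerivAt_id t).pow 2).const_mul m)).congr_deriv
      (by simp; ring)
  refine (hF.mul (hG'.rpow_const (p := -(p / 2)) (Or.inl hG.ne'))).congr_deriv ?_
  have e1 : t ^ p = t ^ (p - 1) * t := by
    rw [← Real.rpow_add_one ht.ne']; ring_nf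
  have e2 : (1 + m * t) ^ p = (1 + m * t) ^ (p - 1) * (1 + m * t) := by
    rw [← Real.rpow_add_one hw.ne']; ring_nf
  have e3 : ((1 + m * t) ^ 2 + 1 + m * t ^ 2) ^ (-(p / 2)) =
      ((1 + m * t) ^ 2 + 1 + m * t ^ 2) ^ (-(p / 2) - 1) * ((1 + m * t) ^ 2 + 1 + m * t ^ 2) := by
    rw [← Real.rpow_add_one hG.ne']; ring_nf
  simp only [slopeGap, id, Pi.add_apply, e1, e2, e3]
  ring

lemma continuousOn_ratioPow {m p : ℝ} (hm : 0 < m) (hp : 0 < p) :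
    ContinuousOn (ratioPow m p) (Set.Icc 0 1) := by
  have h1 : Continuous (fun t : ℝ => t ^ p) := Real.continuous_rpow_const hp.le
  have h2 : Continuous (fun t : ℝ => (1 + m * t) ^ p) :=
    (Real.continuous_rpow_const hp.le).comp (by fun_prop)
  have h3 : Continuous (fun t : ℝ => ((1 + m * t) ^ 2 + 1 + m * t ^ 2) ^ (-(p / 2))) :=
    Continuous.rpow_const (by fun_prop) fun t => Or.inl (by positivity)
  unfold ratioPow
  exact (((h2.add continuous_const).add (continuous_const.mul h1)).mul h3).continuousOn

lemma min_le_ratioPow {m p t : ℝ} (hm : 0 < m) (hp1 : 1 < p) (hp2 : p < 2)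
    (ht0 : 0 ≤ t) (ht1 : t ≤ 1) : min (ratioPow m p 0) (ratioPow m p 1) ≤ ratioPow m p t := by
  have hp0 : 0 < p := by linarith
  have hfac : ∀ u, 0 ≤ p * m * ((1 + m * u) ^ 2 + 1 + m * u ^ 2) ^ (-(p / 2) - 1) :=
    fun u => by positivity
  by_cases h : ∃ s, 0 ≤ s ∧ s ≤ t ∧ 0 < slopeGap m (p - 1) s
  · obtain ⟨s, hs0, hst, hs⟩ := h
    have : AntitoneOn (ratioPow m p) (Set.Icc t 1) := by
      refine antitoneOn_of_hasDerivWithinAt_nonpos (f' := fun u => -(p * m *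
        ((1 + m * u) ^ 2 + 1 + m * u ^ 2) ^ (-(p / 2) - 1)) * slopeGap m (p - 1) u) (convex_Icc t 1)
        ((continuousOn_ratioPow hm hp0).mono (Set.Icc_subset_Icc_left ht0)) (fun u hu => ?_)
        (fun u hu => ?_)
      · rw [interior_Icc] at hu ⊢
        exact (hasDerivAt_ratioPow hm (ht0.trans_lt hu.1)).hasDerivWithinAt
      · rw [interior_Icc] at hu
        exact mul_nonpos_of_nonpos_of_nonneg (neg_nonpos.2 (hfac u))
          (slopeGap_nonneg_of_pos hm (by linarith) (by linarith) hs0 (hst.trans hu.1.le) hu.2.le hs)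
    exact (min_le_right _ _).trans (this ⟨le_rfl, ht1⟩ ⟨ht1, le_rfl⟩ ht1)
  · push Not at h
    have : MonotoneOn (ratioPow m p) (Set.Icc 0 t) := by
      refine monotoneOn_of_hasDerivWithinAt_nonneg (f' := fun u => -(p * m *
        ((1 + m * u) ^ 2 + 1 + m * u ^ 2) ^ (-(p / 2) - 1)) * slopeGap m (p - 1) u) (convex_Icc 0 t)
        ((continuousOn_ratioPow hm hp0).mono (Set.Icc_subset_Icc_right ht1)) (fun u hu => ?_)
        (fun u hu => ?_)
      · rw [interior_Icc] at hu ⊢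
        exact (hasDerivAt_ratioPow hm hu.1).hasDerivWithinAt
      · rw [interior_Icc] at hu
        exact mul_nonneg_of_nonpos_of_nonpos (neg_nonpos.2 (hfac u)) (h u hu.1.le hu.2.le)
    exact (min_le_left _ _).trans (this ⟨le_rfl, ht0⟩ ⟨ht0, le_rfl⟩ ht0)

/-- The minimum of `‖x‖_p ^ p / ‖x‖_2 ^ p` in dimension `m + 2`. -/
noncomputable def minRatioPow (m p : ℝ) : ℝ :=
  min ((2 : ℝ) ^ (1 - p / 2))
    (((m + 1) ^ (p / 2) + (m + 1) ^ (1 - p / 2)) / (m + 2) ^ (p / 2))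

lemma ratioPow_zero {m p : ℝ} (hp : 0 < p) : ratioPow m p 0 = 2 ^ (1 - p / 2) := by
  rw [ratioPow, sub_eq_add_neg, Real.rpow_add two_pos]
  norm_num [Real.zero_rpow hp.ne']

lemma ratioPow_one {m p : ℝ} (hm : 0 < m) : ratioPow m p 1 =
    ((m + 1) ^ (p / 2) + (m + 1) ^ (1 - p / 2)) / (m + 2) ^ (p / 2) := by
  have h1 : 0 < m + 1 := by linarith
  have h2 : 0 < m + 2 := by linarith
  have e : (1 + m * 1) ^ 2 + 1 + m * 1 ^ 2 = (m + 1) * (m + 2) := by ring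
  have e1 : (m + 1) ^ p = (m + 1) ^ (p / 2) * (m + 1) ^ (p / 2) := by
    rw [← Real.rpow_add h1]; ring_nf
  have e2 : (m + 1) ^ (1 - p / 2) = (m + 1) * ((m + 1) ^ (p / 2))⁻¹ := by
    rw [sub_eq_add_neg, Real.rpow_add h1, Real.rpow_one, Real.rpow_neg h1.le]
  have := Real.rpow_pos_of_pos h1 (p / 2)
  have := Real.rpow_pos_of_pos h2 (p / 2)
  rw [ratioPow, e, Real.rpow_neg (by positivity), Real.mul_rpow h1.le h2.le, e2, Real.one_rpow,
    mul_one, add_comm 1 m, e1]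
  field_simp
  ring

lemma minRatioPow_le_ratioPow {m p t : ℝ} (hm : 0 < m) (hp1 : 1 < p) (hp2 : p < 2)
    (ht0 : 0 ≤ t) (ht1 : t ≤ 1) : minRatioPow m p ≤ ratioPow m p t := by
  rw [minRatioPow, ← ratioPow_zero (m := m) (by linarith), ← ratioPow_one hm]
  exact min_le_ratioPow hm hp1 hp2 ht0 ht1

lemma minRatioPow_le_of_sq_eq_one {m p a b : ℝ} (hm : 0 < m) (hp1 : 1 < p) (hp2 : p < 2)
    (ha : 0 ≤ a) (hb : 0 < b) (hab : a ≤ b)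
    (h : (b + m * a) ^ 2 + b ^ 2 + m * a ^ 2 = 1) :
    minRatioPow m p ≤ (b + m * a) ^ p + b ^ p + m * a ^ p := by
  have hm0 := hm.le
  refine (minRatioPow_le_ratioPow hm hp1 hp2 (div_nonneg ha hb.le)
    ((div_le_one hb).2 hab)).trans_eq ?_
  have hF : (b + m * a) ^ p + b ^ p + m * a ^ p =
      b ^ p * ((1 + m * (a / b)) ^ p + 1 + m * (a / b) ^ p) := by
    have e : b + m * a = b * (1 + m * (a / b)) := by field_simp
    have e2 : a ^ p = b ^ p * (a / b) ^ p := by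
      rw [← Real.mul_rpow hb.le (by positivity)]; congr 1; field_simp
    rw [e, Real.mul_rpow hb.le (by positivity), e2]; ring
  have hG : (1 + m * (a / b)) ^ 2 + 1 + m * (a / b) ^ 2 = (b ^ 2)⁻¹ := by
    refine eq_inv_of_mul_eq_one_left (Eq.trans ?_ h)
    field_simp
  rw [hF, ratioPow, hG, Real.inv_rpow (by positivity), Real.rpow_neg (by positivity), inv_inv,
    ← Real.rpow_natCast, ← Real.rpow_mul hb.le, mul_comm]
  congr 2
  push_cast; ring

/-- The second-order necessary condition at a local minimum. -/
lemma IsLocalMin.second_deriv_nonneg {f g : ℝ → ℝ} {c a : ℝ} (h : IsLocalMin f a)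
    (hf : ∀ᶠ x in nhds a, HasDerivAt f (g x) x) (hg : HasDerivAt g c a) : 0 ≤ c := by
  by_contra! hneg
  have hd : deriv f =ᶠ[nhds a] g := hf.mono fun x hx => hx.deriv
  have hdd : deriv (deriv f) a = c := by rw [hd.deriv_eq, hg.deriv]
  have hmax : IsLocalMax f a := isLocalMax_of_deriv_deriv_neg (hdd ▸ hneg)
    h.deriv_eq_zero hf.self_of_nhds.continuousAt
  have hconst : f =ᶠ[nhds a] fun _ => f a := by
    filter_upwards [h, hmax] with x h1 h2 using le_antisymm h2 h1
  have : deriv (deriv f) a = 0 := by rw [hconst.deriv.deriv_eq]; simp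
  linarith

section Minimizer

variable {ι : Type*} [Fintype ι]

/-- `x` is a unit vector minimizing `‖·‖_p ^ p / ‖·‖_2 ^ p` over zero-sum vectors, with value `C`. -/
structure IsUnitMinimizer (p C : ℝ) (x : ι → ℝ) : Prop where
  sum_eq : ∑ i, x i = 0
  sq_eq : ∑ i, x i ^ 2 = 1
  pow_eq : ∑ i, |x i| ^ p = C
  le : ∀ y : ι → ℝ, ∑ i, y i = 0 → C * (∑ i, y i ^ 2) ^ (p / 2) ≤ ∑ i, |y i| ^ p

namespace IsUnitMinimizer

variable {p C : ℝ} {x : ι → ℝ}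

lemma neg (h : IsUnitMinimizer p C x) : IsUnitMinimizer p C (-x) :=
  ⟨by simp [h.sum_eq], by simp [h.sq_eq], by simp [h.pow_eq], h.le⟩

lemma pos (h : IsUnitMinimizer p C x) : 0 < C := by
  rw [← h.pow_eq]
  have hne : ∃ i, x i ≠ 0 := by
    by_contra! h0
    simpa [h0] using h.sq_eq
  obtain ⟨i, hi⟩ := hne
  exact Finset.sum_pos' (fun j _ => by positivity)
    ⟨i, Finset.mem_univ i, Real.rpow_pos_of_pos (abs_pos.2 hi) p⟩

lemma le_pair (h : IsUnitMinimizer p C x) {i j : ι} (hij : i ≠ j) (ε : ℝ) :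
    C * (1 + (2 * ε * (x i - x j) + 2 * ε ^ 2)) ^ (p / 2) ≤
      C + (|x i + ε| ^ p - |x i| ^ p) + (|x j - ε| ^ p - |x j| ^ p) := by
  classical
  set y : ι → ℝ := fun k => x k + (if k = i then ε else if k = j then -ε else 0) with hy
  have hsum : ∀ g : ℝ → ℝ, ∑ k, g (y k) =
      ∑ k, g (x k) + (g (x i + ε) - g (x i)) + (g (x j - ε) - g (x j)) := by
    intro g
    have : ∑ k, (g (y k) - g (x k)) = (g (y i) - g (x i)) + (g (y j) - g (x j)) :=
      Fintype.sum_eq_add i j hij fun k hk => by simp [hy, hk.1, hk.2]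
    rw [Finset.sum_sub_distrib] at this
    have e1 : y i = x i + ε := by simp [hy]
    have e2 : y j = x j - ε := by simp [hy, hij.symm]; ring
    rw [e1, e2] at this
    linarith
  have h0 := hsum id
  have h2 := hsum (· ^ 2)
  have hp := hsum (|·| ^ p)
  simp only [id, h.sum_eq] at h0
  simp only [h.sq_eq] at h2
  simp only [h.pow_eq] at hp
  have := h.le y (by rw [h0]; ring)
  rw [h2, hp] at this
  convert this using 3
  ring

lemma stationary (h : IsUnitMinimizer p C x) (hp : 1 < p) (i j : ι) :
    |x i| ^ (p - 2) * x i - C * x i = |x j| ^ (p - 2) * x j - C * x j := by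
  rcases eq_or_ne i j with rfl | hij
  · rfl
  set f : ℝ → ℝ := fun ε => C + (|x i + ε| ^ p - |x i| ^ p) + (|x j - ε| ^ p - |x j| ^ p) -
    C * (1 + (2 * ε * (x i - x j) + 2 * ε ^ 2)) ^ (p / 2) with hf
  have hmin : IsLocalMin f 0 := Filter.Eventually.of_forall fun ε => by
    have := h.le_pair hij ε
    simp only [hf]
    simp
    linarith
  have h1 : HasDerivAt (fun ε : ℝ => x i + ε) 1 0 := (hasDerivAt_id 0).const_add _
  have h2 : HasDerivAt (fun ε : ℝ => x j - ε) (-1) 0 := (hasDerivAt_id 0).const_sub _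
  have h3 : HasDerivAt (fun ε : ℝ => |x i + ε| ^ p) (p * |x i| ^ (p - 2) * x i * 1) 0 := by
    refine HasDerivAt.comp (h₂ := fun u : ℝ => |u| ^ p) 0 ?_ h1
    simpa using hasDerivAt_abs_rpow (x i) hp
  have h4 : HasDerivAt (fun ε : ℝ => |x j - ε| ^ p) (p * |x j| ^ (p - 2) * x j * (-1)) 0 := by
    refine HasDerivAt.comp (h₂ := fun u : ℝ => |u| ^ p) 0 ?_ h2
    simpa using hasDerivAt_abs_rpow (x j) hp
  have h5 : HasDerivAt (fun ε : ℝ => 1 + (2 * ε * (x i - x j) + 2 * ε ^ 2))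
      (2 * (x i - x j)) 0 := by
    refine (((((hasDerivAt_id (0 : ℝ)).const_mul 2).mul_const (x i - x j)).add
      (((hasDerivAt_id (0 : ℝ)).pow 2).const_mul 2)).const_add 1).congr_deriv ?_
    simp
  have h6 := (h5.rpow_const (p := p / 2) (Or.inl (by norm_num))).const_mul C
  have h7 := ((((h3.sub_const (|x i| ^ p)).const_add C).add
    (h4.sub_const (|x j| ^ p))).sub h6)
  have := hmin.hasDerivAt_eq_zero h7
  norm_num at this
  have hp0 : p ≠ 0 := by linarith
  apply mul_left_cancel₀ hp0
  linarith

lemma le_of_eq (h : IsUnitMinimizer p C x) {i j : ι} (hij : i ≠ j) (he : x i = x j)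
    (h0 : x i ≠ 0) (hp : 1 < p) : C ≤ (p - 1) * |x i| ^ (p - 2) := by
  set b := |x i| with hb
  have hb0 : 0 < b := abs_pos.2 h0
  set f : ℝ → ℝ := fun ε => C + ((b + ε) ^ p - b ^ p) + ((b - ε) ^ p - b ^ p) -
    C * (1 + 2 * ε ^ 2) ^ (p / 2) with hf
  have hball : ∀ᶠ ε : ℝ in nhds 0, |ε| < b := by
    have := Metric.ball_mem_nhds (0 : ℝ) hb0
    filter_upwards [this] with ε hε
    simpa using hε
  have hmin : IsLocalMin f 0 := by
    filter_upwards [hball] with ε hε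
    rw [abs_lt] at hε
    have key := h.le_pair hij
    rw [← he, ← hb] at key
    have : C * (1 + 2 * ε ^ 2) ^ (p / 2) ≤
        C + ((b + ε) ^ p - b ^ p) + ((b - ε) ^ p - b ^ p) := by
      rcases abs_cases (x i) with ⟨h1, -⟩ | ⟨h1, -⟩
      · have k := key ε
        rw [← h1, ← hb, abs_of_pos (by linarith), abs_of_pos (by linarith)] at k
        simpa using k
      · have k := key (-ε)
        have hx : x i = -b := by rw [hb, h1, neg_neg]
        have e1 : -b + -ε = -(b + ε) := by ring
        have e2 : -b - -ε = -(b - ε) := by ring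
        rw [hx, e1, e2, abs_neg, abs_neg, abs_of_pos (by linarith), abs_of_pos (by linarith)] at k
        simpa using k
    simp only [hf]
    simp
    linarith
  set f' : ℝ → ℝ := fun ε => p * (b + ε) ^ (p - 1) - p * (b - ε) ^ (p - 1) -
    2 * p * C * (ε * (1 + 2 * ε ^ 2) ^ (p / 2 - 1)) with hf'
  have d1 : ∀ ε : ℝ, HasDerivAt (fun ε : ℝ => b + ε) 1 ε := fun ε => (hasDerivAt_id ε).const_add _
  have d2 : ∀ ε : ℝ, HasDerivAt (fun ε : ℝ => b - ε) (-1) ε :=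
    fun ε => (hasDerivAt_id ε).const_sub _
  have d3 : ∀ ε : ℝ, HasDerivAt (fun ε : ℝ => 1 + 2 * ε ^ 2) (4 * ε) ε := fun ε =>
    ((((hasDerivAt_id ε).pow 2).const_mul 2).const_add 1).congr_deriv (by simp; ring)
  have hder : ∀ᶠ ε in nhds 0, HasDerivAt f (f' ε) ε := by
    filter_upwards [hball] with ε hε
    rw [abs_lt] at hε
    have e1 := (d1 ε).rpow_const (p := p) (Or.inl (by linarith))
    have e2 := (d2 ε).rpow_const (p := p) (Or.inl (by linarith))
    have e3 := ((d3 ε).rpow_const (p := p / 2) (Or.inl (by positivity))).const_mul C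
    refine ((((e1.sub_const (b ^ p)).const_add C).add (e2.sub_const (b ^ p))).sub e3).congr_deriv ?_
    simp only [hf']
    ring
  have hder2 : HasDerivAt f' (2 * p * ((p - 1) * b ^ (p - 2)) - 2 * p * C) 0 := by
    have e1 := ((d1 0).rpow_const (p := p - 1) (Or.inl (by linarith))).const_mul p
    have e2 := ((d2 0).rpow_const (p := p - 1) (Or.inl (by linarith))).const_mul p
    have e3 := (((hasDerivAt_id (0 : ℝ)).mul
      ((d3 0).rpow_const (p := p / 2 - 1) (Or.inl (by positivity))))).const_mul (2 * p * C)
    refine ((e1.sub e2).sub e3).congr_deriv ?_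
    have : p - 1 - 1 = p - 2 := by ring
    simp [this]
    ring
  have := hmin.second_deriv_nonneg hder hder2
  have hp0 : 0 < p := by linarith
  nlinarith

lemma exists_neg (h : IsUnitMinimizer p C x) : ∃ i, x i < 0 := by
  by_contra! hx
  have := (Finset.sum_eq_zero_iff_of_nonneg fun i _ => hx i).1 h.sum_eq
  have h1 := h.sq_eq
  rw [Finset.sum_eq_zero fun i hi => by rw [this i hi]; norm_num] at h1
  exact zero_ne_one h1

lemma exists_pos (h : IsUnitMinimizer p C x) : ∃ i, 0 < x i := by
  obtain ⟨i, hi⟩ := h.neg.exists_neg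
  exact ⟨i, by simpa using hi⟩

lemma two_rpow_le (h : IsUnitMinimizer p C x) (hp2 : p < 2)
    (hs : ∀ i, |x i| ^ (p - 2) * x i - C * x i = 0) : (2 : ℝ) ^ (1 - p / 2) ≤ C := by
  obtain ⟨i, hi⟩ := h.exists_neg
  obtain ⟨j, hj⟩ := h.exists_pos
  have hij : i ≠ j := by rintro rfl; linarith
  have hsq : x i ^ 2 + x j ^ 2 ≤ 1 := by
    classical
    rw [← h.sq_eq, ← Finset.sum_pair (f := fun k => x k ^ 2) hij]
    exact Finset.sum_le_sum_of_subset_of_nonneg (Finset.subset_univ _) fun k _ _ => sq_nonneg _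
  have aux : ∀ k, x k ≠ 0 → 2 * x k ^ 2 ≤ 1 → (2 : ℝ) ^ (1 - p / 2) ≤ C := by
    intro k hk hk2
    have hC : |x k| ^ (p - 2) = C := by
      have := hs k
      rw [← sub_mul] at this
      linarith [(mul_eq_zero.1 this).resolve_right hk]
    have hsqk : 0 < x k ^ 2 := by positivity
    have e : |x k| ^ (p - 2) = (x k ^ 2)⁻¹ ^ (1 - p / 2) := by
      rw [Real.inv_rpow hsqk.le, ← Real.rpow_neg hsqk.le, ← sq_abs, ← Real.rpow_natCast,
        ← Real.rpow_mul (abs_nonneg _)]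
      congr 1
      push_cast; ring
    rw [← hC, e]
    refine Real.rpow_le_rpow two_pos.le ?_ (by linarith)
    rw [le_inv_comm₀ two_pos hsqk]
    linarith
  by_cases hle : 2 * x i ^ 2 ≤ 1
  · exact aux i hi.ne hle
  · exact aux j hj.ne' (by linarith)

lemma exists_mem_Ioo_slope_eq {μ a b : ℝ} (ha : 0 < a) (hab : a < b)
    (h1 : a ^ (p - 1) - C * a = μ) (h2 : b ^ (p - 1) - C * b = μ) :
    ∃ ξ ∈ Set.Ioo a b, (p - 1) * ξ ^ (p - 2) = C := by
  have hd : ∀ u, 0 < u → HasDerivAt (fun u : ℝ => u ^ (p - 1) - C * u)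
      ((p - 1) * u ^ (p - 2) - C) u := by
    intro u hu
    refine (((hasDerivAt_id u).rpow_const (p := p - 1) (Or.inl hu.ne')).sub
      ((hasDerivAt_id u).const_mul C)).congr_deriv ?_
    have : p - 1 - 1 = p - 2 := by ring
    simp [this]
  obtain ⟨ξ, hξ, h⟩ := exists_hasDerivAt_eq_zero hab
    (fun u hu => (hd u (ha.trans_le hu.1)).continuousAt.continuousWithinAt)
    (h1.trans h2.symm) (fun u hu => hd u (ha.trans hu.1))
  exact ⟨ξ, hξ, by linarith⟩

lemma minRatioPow_le_of_stationary (h : IsUnitMinimizer p C x) (hp1 : 1 < p) (hp2 : p < 2)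
    (hd : 3 ≤ Fintype.card ι) {μ : ℝ} (hμ : 0 < μ)
    (hs : ∀ i, |x i| ^ (p - 2) * x i - C * x i = μ) :
    minRatioPow (Fintype.card ι - 2 : ℝ) p ≤ C := by
  classical
  have hne : ∀ i, x i ≠ 0 := fun i hi => by
    have := hs i
    simp only [hi, mul_zero, sub_zero] at this
    exact hμ.ne this
  have hsneg : ∀ i, x i < 0 → -x i * (C - (-x i) ^ (p - 2)) = μ := fun i hi => by
    rw [← hs i, abs_of_neg hi]; ring
  have hspos : ∀ i, 0 < x i → x i ^ (p - 1) - C * x i = μ := fun i hi => by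
    have e : x i ^ (p - 1) = x i ^ (p - 2) * x i := by
      rw [← Real.rpow_add_one hi.ne']; ring_nf
    rw [← hs i, abs_of_pos hi, e]
  have hneglt : ∀ i, x i < 0 → (-x i) ^ (p - 2) < C := fun i hi => by
    have := hsneg i hi
    have := (mul_pos_iff_of_pos_left (neg_pos.2 hi)).1 (hμ.trans_eq this.symm)
    linarith
  obtain ⟨i₀, hi₀⟩ := h.exists_neg
  have hmono : ∀ i j, x i < 0 → x j < 0 → ¬ x i < x j := by
    intro i j hi hj hij
    have h1 : (-x i) ^ (p - 2) < (-x j) ^ (p - 2) :=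
      Real.rpow_lt_rpow_of_neg (by linarith) (by linarith) (by linarith)
    have h2 := hsneg i hi
    have h3 := hsneg j hj
    have h4 := hneglt j hj
    nlinarith
  have hpos : ∀ i, i ≠ i₀ → 0 < x i := by
    intro i hi
    by_contra! hle
    have hlt := lt_of_le_of_ne hle (hne i)
    have heq : x i = x i₀ :=
      le_antisymm (not_lt.1 (hmono i₀ i hi₀ hlt)) (not_lt.1 (hmono i i₀ hlt hi₀))
    have h1 := h.le_of_eq hi heq (hne i) hp1
    rw [abs_of_neg hlt] at h1
    have h2 := hneglt i hlt
    have h3 : 0 < (-x i) ^ (p - 2) := Real.rpow_pos_of_pos (by linarith) _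
    nlinarith
  obtain ⟨j₀, -, hj₀⟩ := Finset.exists_max_image Finset.univ x ⟨i₀, Finset.mem_univ _⟩
  have hj₀pos : 0 < x j₀ := by
    obtain ⟨j, hj⟩ := h.exists_pos
    exact hj.trans_le (hj₀ j (Finset.mem_univ _))
  have hij : i₀ ≠ j₀ := by rintro rfl; linarith
  set R : Finset ι := Finset.univ \ {i₀, j₀} with hR
  have hcard : (R.card : ℝ) = Fintype.card ι - 2 := by
    rw [hR, Finset.cast_card_sdiff (Finset.subset_univ _), Finset.card_pair hij]
    simp
  have hdR : (3 : ℝ) ≤ Fintype.card ι := by exact_mod_cast hd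
  have hmemR : ∀ k, k ∈ R ↔ k ≠ i₀ ∧ k ≠ j₀ := by simp [hR]
  obtain ⟨k₀, hk₀⟩ : R.Nonempty := by
    rw [← Finset.card_pos, ← Nat.cast_pos (α := ℝ), hcard]; linarith
  have hRnot : ∀ k ∈ R, ∀ l ∈ R, ¬ x k < x l := by
    intro k hk l hl hkl
    rw [hmemR] at hk hl
    have hkp := hpos k hk.1
    have hlp := hpos l hl.1
    obtain ⟨ξ, hξ, hξC⟩ := exists_mem_Ioo_slope_eq hkp hkl (hspos k hkp) (hspos l hlp)
    have hanti : ∀ u, ξ < u → (p - 1) * u ^ (p - 2) < C := fun u hu => by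
      rw [← hξC]
      exact mul_lt_mul_of_pos_left
        (Real.rpow_lt_rpow_of_neg (hkp.trans hξ.1) hu (by linarith)) (by linarith)
    rcases (hj₀ l (Finset.mem_univ _)).eq_or_lt with heq | hlt
    · have h1 := h.le_of_eq hl.2 heq (hne l) hp1
      rw [abs_of_pos hlp] at h1
      exact absurd (hanti _ hξ.2) (not_lt.2 h1)
    · obtain ⟨η, hη, hηC⟩ := exists_mem_Ioo_slope_eq hlp hlt (hspos l hlp) (hspos j₀ hj₀pos)
      exact absurd (hanti η (hξ.2.trans hη.1)) (not_lt.2 hηC.ge)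
  have hRconst : ∀ k ∈ R, x k = x k₀ := fun k hk =>
    le_antisymm (not_lt.1 (hRnot k₀ hk₀ k hk)) (not_lt.1 (hRnot k hk k₀ hk₀))
  have hsplit : ∀ g : ℝ → ℝ, ∑ i, g (x i) =
      g (x i₀) + g (x j₀) + (Fintype.card ι - 2 : ℝ) * g (x k₀) := by
    intro g
    rw [← Finset.sum_sdiff (Finset.subset_univ {i₀, j₀}), Finset.sum_pair hij,
      Finset.sum_congr rfl fun k hk => by rw [hRconst k hk], Finset.sum_const, nsmul_eq_mul,
      hcard, add_comm]
  have hk₀pos := hpos k₀ ((hmemR k₀).1 hk₀).1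
  have e1 := hsplit id
  have e2 := hsplit (· ^ 2)
  have e3 := hsplit (|·| ^ p)
  simp only [id, h.sum_eq] at e1
  have e4 : x i₀ = -(x j₀ + (Fintype.card ι - 2 : ℝ) * x k₀) := by linarith
  simp only [h.sq_eq, e4, neg_sq] at e2
  simp only [h.pow_eq, abs_of_neg hi₀, abs_of_pos hj₀pos, abs_of_pos hk₀pos] at e3
  rw [e4, neg_neg] at e3
  rw [e3]
  exact minRatioPow_le_of_sq_eq_one (by linarith) hp1 hp2 hk₀pos.le hj₀pos
    (hj₀ k₀ (Finset.mem_univ _)) e2.symm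

lemma minRatioPow_le (h : IsUnitMinimizer p C x) (hp1 : 1 < p) (hp2 : p < 2)
    (hd : 3 ≤ Fintype.card ι) : minRatioPow (Fintype.card ι - 2 : ℝ) p ≤ C := by
  obtain ⟨i, -⟩ := h.exists_neg
  have hs := fun k => h.stationary hp1 k i
  rcases lt_trichotomy (|x i| ^ (p - 2) * x i - C * x i) 0 with hlt | heq | hgt
  · refine h.neg.minRatioPow_le_of_stationary hp1 hp2 hd (neg_pos.2 hlt) fun k => ?_
    rw [← hs k, Pi.neg_apply, abs_neg]; ring
  · exact (min_le_left _ _).trans (h.two_rpow_le hp2 fun k => (hs k).trans heq)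
  · exact h.minRatioPow_le_of_stationary hp1 hp2 hd hgt hs

end IsUnitMinimizer

lemma rescale_rpow_le {p C : ℝ}
    (hC : ∀ x : ι → ℝ, ∑ i, x i = 0 → ∑ i, x i ^ 2 = 1 → C ≤ ∑ i, |x i| ^ p)
    (hp : 0 < p) (y : ι → ℝ) (hy : ∑ i, y i = 0) :
    C * (∑ i, y i ^ 2) ^ (p / 2) ≤ ∑ i, |y i| ^ p := by
  set S := ∑ i, y i ^ 2 with hS
  have hS0 : 0 ≤ S := Finset.sum_nonneg fun i _ => sq_nonneg _
  rcases hS0.eq_or_lt with h0 | hpos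
  · rw [← h0, Real.zero_rpow (by positivity), mul_zero]
    positivity
  have hr : 0 < √S := Real.sqrt_pos.2 hpos
  have h1 := hC (fun i => y i / √S) (by rw [← Finset.sum_div, hy, zero_div])
    (by simp_rw [div_pow, ← Finset.sum_div, Real.sq_sqrt hS0, ← hS, div_self hpos.ne'])
  have e : √S ^ p = S ^ (p / 2) := by
    rw [Real.sqrt_eq_rpow, ← Real.rpow_mul hS0]; ring_nf
  simp_rw [abs_div, abs_of_pos hr, Real.div_rpow (abs_nonneg _) hr.le, ← Finset.sum_div, e] at h1
  rwa [le_div_iff₀ (by positivity)] at h1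

lemma exists_isUnitMinimizer [Nontrivial ι] {p : ℝ} (hp : 0 < p) :
    ∃ (C : ℝ) (x : ι → ℝ), IsUnitMinimizer p C x := by
  classical
  set K : Set (ι → ℝ) := {x | ∑ i, x i = 0 ∧ ∑ i, x i ^ 2 = 1} with hK
  have hcompact : IsCompact K := by
    refine (isCompact_univ_pi fun _ : ι => isCompact_Icc (a := (-1 : ℝ)) (b := 1)).of_isClosed_subset
      ((isClosed_eq (by fun_prop) (by fun_prop)).inter (isClosed_eq (by fun_prop) (by fun_prop))) ?_
    rintro x ⟨-, hx⟩ i -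
    rw [Set.mem_Icc, ← abs_le, ← sq_le_one_iff_abs_le_one, ← hx]
    exact Finset.single_le_sum (f := fun k => x k ^ 2) (fun k _ => sq_nonneg _) (Finset.mem_univ i)
  obtain ⟨i, j, hij⟩ := exists_pair_ne ι
  have hne : K.Nonempty := by
    have aux : ∀ g : ℝ → ℝ, g 0 = 0 →
        ∑ k, g (if k = i then √2⁻¹ else if k = j then -√2⁻¹ else 0) = g √2⁻¹ + g (-√2⁻¹) := by
      intro g hg
      rw [Fintype.sum_eq_add i j hij fun k hk => by simp [hk.1, hk.2, hg]]
      simp [hij.symm]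
    refine ⟨fun k => if k = i then √2⁻¹ else if k = j then -√2⁻¹ else 0, ?_, ?_⟩
    · simpa using aux id rfl
    · rw [aux (· ^ 2) (by simp), neg_sq, Real.sq_sqrt (by norm_num)]
      norm_num
  have hcont : Continuous fun x : ι → ℝ => ∑ k, |x k| ^ p :=
    continuous_finsetSum _ fun k _ =>
      (continuous_abs.comp (continuous_apply k)).rpow_const fun _ => Or.inr hp.le
  obtain ⟨x, hx, hmin⟩ := hcompact.exists_isMinOn hne hcont.continuousOn
  exact ⟨_, x, hx.1, hx.2, rfl, rescale_rpow_le (fun y h1 h2 => hmin ⟨h1, h2⟩) hp⟩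

end Minimizer

/-- For `d ≥ 3` and `1 < p < 2`, the minimum of `‖x‖_p / ‖x‖_2` over nonzero
zero-sum vectors `x ∈ ℝ^d` equals
`min { 2^(1/p - 1/2), (((d-1)^(p/2) + (d-1)^(1-p/2)) / d^(p/2))^(1/p) }`. -/
theorem holevo_utkin_one_lt_p_lt_two (d : ℕ) (hd : 3 ≤ d) (p : ℝ) (hp1 : 1 < p) (hp2 : p < 2) :
    IsLeast { r : ℝ | ∃ x : Fin d → ℝ, x ≠ 0 ∧ (∑ i, x i) = 0 ∧
        r = (∑ i, |x i| ^ p) ^ (1 / p) / Real.sqrt (∑ i, (x i) ^ 2) }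
      (min ((2 : ℝ) ^ (1 / p - 1 / 2 : ℝ))
        ((((d - 1 : ℝ) ^ (p / 2) + (d - 1 : ℝ) ^ (1 - p / 2)) / (d : ℝ) ^ (p / 2)) ^ (1 / p))) := by
  have hp0 : 0 < p := by linarith
  have hdR : (3 : ℝ) ≤ d := by exact_mod_cast hd
  have : Nontrivial (Fin d) := Fin.nontrivial_iff_two_le.2 (by omega)
  have hratio : ∀ S F : ℝ, 0 < S → 0 ≤ F →
      F ^ (1 / p) / √S = (F / S ^ (p / 2)) ^ (1 / p) := by
    intro S F hS hF
    rw [Real.div_rpow hF (by positivity), ← Real.rpow_mul hS.le, Real.sqrt_eq_rpow]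
    congr 2
    field_simp
  have e2 : (2 : ℝ) ^ (1 / p - 1 / 2 : ℝ) = ((2 : ℝ) ^ (1 - p / 2)) ^ (1 / p) := by
    rw [← Real.rpow_mul two_pos.le]
    congr 1
    field_simp
  set B := ((d - 1 : ℝ) ^ (p / 2) + (d - 1 : ℝ) ^ (1 - p / 2)) / (d : ℝ) ^ (p / 2) with hB
  have hd1 : (0 : ℝ) < d - 1 := by linarith
  have hB0 : 0 ≤ B := by positivity
  have hA0 : (0 : ℝ) ≤ (2 : ℝ) ^ (1 - p / 2) := by positivity
  rw [e2]
  constructor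
  · rcases min_choice (((2 : ℝ) ^ (1 - p / 2)) ^ (1 / p)) (B ^ (1 / p)) with hc | hc
    · rw [hc]
      obtain ⟨i, j, hij⟩ := exists_pair_ne (Fin d)
      have aux : ∀ g : ℝ → ℝ, g 0 = 0 →
          ∑ k, g (if k = i then 1 else if k = j then -1 else 0) = g 1 + g (-1) := by
        intro g hg
        rw [Fintype.sum_eq_add i j hij fun k hk => by simp [hk.1, hk.2, hg]]
        simp [hij.symm]
      refine ⟨fun k => if k = i then 1 else if k = j then -1 else 0, ?_, ?_, ?_⟩
      · intro h0
        simpa using congrFun h0 i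
      · simpa using aux id rfl
      · rw [aux (· ^ 2) (by simp), aux (|·| ^ p) (by simp [Real.zero_rpow hp0.ne']),
          hratio _ _ (by norm_num) (by positivity)]
        congr 1
        rw [Real.rpow_sub two_pos]
        norm_num
    · rw [hc]
      set i : Fin d := ⟨0, by omega⟩
      have aux : ∀ g : ℝ → ℝ,
          ∑ k, g (if k = i then (d : ℝ) - 1 else -1) = g (d - 1) + (d - 1) * g (-1) := by
        intro g
        rw [← Finset.add_sum_erase _ _ (Finset.mem_univ i),
          Finset.sum_congr rfl (g := fun _ => g (-1))
            fun k hk => by rw [if_neg (Finset.ne_of_mem_erase hk)]]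
        simp [Nat.cast_sub (by omega : 1 ≤ d)]
      refine ⟨fun k => if k = i then (d : ℝ) - 1 else -1, ?_, ?_, ?_⟩
      · intro h0
        have := congrFun h0 i
        simp at this
        linarith
      · simpa using aux id
      · have e3 : ((d : ℝ) - 1) ^ 2 + (d - 1) * (-1) ^ 2 = (d - 1) * d := by ring
        have e4 : ((d : ℝ) - 1) ^ p = (d - 1) ^ (p / 2) * (d - 1) ^ (p / 2) := by
          rw [← Real.rpow_add hd1]; ring_nf
        rw [aux (· ^ 2), aux (|·| ^ p), abs_of_pos hd1, e3,
          hratio _ _ (by positivity) (by positivity), hB]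
        congr 1
        rw [Real.mul_rpow hd1.le (by positivity), e4, Real.rpow_sub hd1, Real.rpow_one]
        have := Real.rpow_pos_of_pos hd1 (p / 2)
        have : (0 : ℝ) < (d : ℝ) ^ (p / 2) := by positivity
        simp
        field_simp
  · rintro r ⟨x, hx0, hx, rfl⟩
    obtain ⟨C, y, hy⟩ := exists_isUnitMinimizer (ι := Fin d) hp0
    have hC := hy.minRatioPow_le hp1 hp2 (by simpa using hd)
    have hS : 0 < ∑ i, x i ^ 2 := by
      obtain ⟨i, hi⟩ := Function.ne_iff.1 hx0
      exact Finset.sum_pos' (fun k _ => sq_nonneg _) ⟨i, Finset.mem_univ i, by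
        have : x i ≠ 0 := hi
        positivity⟩
    rw [hratio _ _ hS (by positivity)]
    have hM : min ((2 : ℝ) ^ (1 - p / 2)) B ≤ (∑ i, |x i| ^ p) / (∑ i, x i ^ 2) ^ (p / 2) := by
      rw [le_div_iff₀ (by positivity)]
      refine (mul_le_mul_of_nonneg_right ?_ (by positivity)).trans (hy.le x hx)
      have e : (d : ℝ) - 2 + 1 = d - 1 := by ring
      rwa [minRatioPow, Fintype.card_fin, e, sub_add_cancel, ← hB] at hC
    refine le_trans ?_ (Real.rpow_le_rpow (le_min hA0 hB0) hM (by positivity))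
    rcases min_choice ((2 : ℝ) ^ (1 - p / 2)) B with h | h <;> rw [h]
    exacts [min_le_left _ _, min_le_right _ _]
end

section
/- Let d ≥ 3 and 2 < q < ∞. Then the maximum of ‖x‖_q / ‖x‖_2 over all nonzero vectors x ∈ ℝ^d with x_1 + ⋯ + x_d = 0 equals max{ 2^{1/q − 1/2}, ( ((d−1)^{q/2} + (d−1)^{1−q/2}) / d^{q/2} )^{1/q} }. -/
/-- Up to a positive factor, the derivative of the norm ratio along the vectors
`(1, -(1 - n e), -e, …, -e)`, where `q = a + 2`. -/
noncomputable def pathDeriv (a n e : ℝ) : ℝ :=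
  (1 - n * e - e) - (1 + e) * (1 - n * e) ^ (a + 1) + (2 - n * e) * e ^ (a + 1)

/-- The second derivative of `pathDeriv a n`, up to the factor `a + 1`. -/
noncomputable def pathCurv (a n e : ℝ) : ℝ :=
  (1 - n * e) ^ (a - 1) * (n * ((2 - n * a) - n * (a + 2) * e)) +
    e ^ (a - 1) * (2 * a - n * (a + 2) * e)

/-- The derivative of `pathDeriv a n`. -/
noncomputable def pathSlope (a n e : ℝ) : ℝ :=
  -(n + 1) - (1 - n * e) ^ (a + 1) + (1 + e) * ((a + 1) * n * (1 - n * e) ^ a)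
    - n * e ^ (a + 1) + (2 - n * e) * ((a + 1) * e ^ a)

lemma hasDerivAt_pathDeriv {a n e : ℝ} (ha : 0 < a) :
    HasDerivAt (pathDeriv a n) (pathSlope a n e) e := by
  have hlin : HasDerivAt (fun e : ℝ => 1 - n * e) (-n) e := by
    simpa using ((hasDerivAt_id e).const_mul n).const_sub 1
  have hc : HasDerivAt (fun e : ℝ => (1 - n * e) ^ (a + 1)) _ e :=
    hlin.rpow_const (Or.inr (by linarith))
  have he : HasDerivAt (fun e : ℝ => e ^ (a + 1)) _ e :=
    (hasDerivAt_id e).rpow_const (Or.inr (by linarith))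
  have h1 : HasDerivAt (fun e : ℝ => 1 + e) 1 e := (hasDerivAt_id e).const_add 1
  have h2 : HasDerivAt (fun e : ℝ => 2 - n * e) (-n) e := by
    simpa using ((hasDerivAt_id e).const_mul n).const_sub 2
  refine (((hlin.sub (hasDerivAt_id e)).sub (h1.mul hc)).add (h2.mul he)).congr_deriv ?_
  simp only [pathSlope, id, add_sub_cancel_right]
  ring

lemma hasDerivAt_pathSlope {a n e : ℝ} (he0 : 0 < e) (hc0 : 0 < 1 - n * e) :
    HasDerivAt (pathSlope a n) ((a + 1) * pathCurv a n e) e := by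
  have hlin : HasDerivAt (fun e : ℝ => 1 - n * e) (-n) e := by
    simpa using ((hasDerivAt_id e).const_mul n).const_sub 1
  have hc : ∀ s : ℝ, HasDerivAt (fun e : ℝ => (1 - n * e) ^ s) _ e := fun s =>
    hlin.rpow_const (Or.inl hc0.ne')
  have he : ∀ s : ℝ, HasDerivAt (fun e : ℝ => e ^ s) _ e := fun s =>
    (hasDerivAt_id e).rpow_const (Or.inl he0.ne')
  have h1 : HasDerivAt (fun e : ℝ => 1 + e) 1 e := (hasDerivAt_id e).const_add 1
  have h2 : HasDerivAt (fun e : ℝ => 2 - n * e) (-n) e := by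
    simpa using ((hasDerivAt_id e).const_mul n).const_sub 2
  have key := ((((hc (a + 1)).const_sub (-(n + 1))).add
    (h1.mul ((hc a).const_mul ((a + 1) * n)))).sub ((he (a + 1)).const_mul n)).add
    (h2.mul ((he a).const_mul (a + 1)))
  refine key.congr_deriv ?_
  have e1 : (1 - n * e) ^ a = (1 - n * e) ^ (a - 1) * (1 - n * e) := by
    rw [← Real.rpow_add_one hc0.ne']; ring_nf
  have e2 : e ^ a = e ^ (a - 1) * e := by
    rw [← Real.rpow_add_one he0.ne']; ring_nf
  simp only [pathCurv, id, add_sub_cancel_right, e1, e2]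
  ring

/-- Between the zeros of the two linear factors, the sign of `pathCurv` is governed by this
decreasing function. -/
lemma antitone_log_curv {a n : ℝ} (ha : 0 < a) (ha1 : a < 1) (hn : 1 ≤ n)
    (hs : 2 * a < 2 - n * a) :
    AntitoneOn (fun e : ℝ => Real.log (2 - n * a - n * (a + 2) * e)
        - Real.log (n * (a + 2) * e - 2 * a)
        - (1 - a) * (Real.log (1 - n * e) - Real.log e))
      {e | 2 * a < n * (a + 2) * e ∧ n * (a + 2) * e < 2 - n * a} := by
  set B := n * (a + 2) with hB
  have hBpos : 0 < B := by positivity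
  have hset : {e : ℝ | 2 * a < B * e ∧ B * e < 2 - n * a}
      = Set.Ioo (2 * a / B) ((2 - n * a) / B) := by
    ext e
    simp only [Set.mem_ofPred_eq, Set.mem_Ioo, div_lt_iff₀ hBpos, lt_div_iff₀ hBpos, mul_comm e B]
  have hder : ∀ e : ℝ, 2 * a < B * e → B * e < 2 - n * a →
      HasDerivAt (fun e : ℝ => Real.log (2 - n * a - B * e) - Real.log (B * e - 2 * a)
        - (1 - a) * (Real.log (1 - n * e) - Real.log e))
        ((-B) / (2 - n * a - B * e) - B / (B * e - 2 * a)
          - (1 - a) * ((-n) / (1 - n * e) - 1 / e)) e ∧ 0 < e ∧ 0 < 1 - n * e := by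
    intro e h1 h2
    have he : 0 < e := by
      by_contra h
      push Not at h
      nlinarith
    have hc : 0 < 1 - n * e := by nlinarith [mul_pos (show 0 < n by linarith) ha]
    refine ⟨?_, he, hc⟩
    have d0 : HasDerivAt (fun e : ℝ => 1 - n * e) (-n) e := by
      simpa using ((hasDerivAt_id e).const_mul n).const_sub 1
    have d1 : HasDerivAt (fun e : ℝ => 2 - n * a - B * e) (-B) e := by
      simpa using ((hasDerivAt_id e).const_mul B).const_sub (2 - n * a)
    have d2 : HasDerivAt (fun e : ℝ => B * e - 2 * a) B e := by
      simpa using ((hasDerivAt_id e).const_mul B).sub_const (2 * a)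
    exact ((d1.log (by linarith)).sub (d2.log (by linarith))).sub
      (((d0.log hc.ne').sub ((hasDerivAt_id e).log he.ne')).const_mul (1 - a))
  rw [hset]
  refine antitoneOn_of_deriv_nonpos (convex_Ioo _ _) ?_ ?_ ?_
  · intro e he
    rw [← hset] at he
    exact (hder e he.1 he.2).1.continuousAt.continuousWithinAt
  · intro e he
    rw [interior_Ioo, ← hset] at he
    exact (hder e he.1 he.2).1.differentiableAt.differentiableWithinAt
  · intro e he
    rw [interior_Ioo, ← hset] at he
    obtain ⟨h1, h2⟩ := he
    obtain ⟨hd, he, hc⟩ := hder e h1 h2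
    rw [hd.deriv]
    have p1 : 0 < 2 - n * a - B * e := by linarith
    have p2 : 0 < B * e - 2 * a := by linarith
    have key : (1 - a) * ((2 - n * a - B * e) * (B * e - 2 * a))
        ≤ B * (2 - n * a - 2 * a) * (e * (1 - n * e)) := by
      set L := 2 - n * a - 2 * a with hL
      have hLpos : 0 < L := by linarith
      set X := B * e - 2 * a with hX
      set Y := 2 - n * a - B * e with hY
      have hXY : X + Y = L := by rw [hX, hY, hL]; ring
      have hBe : B * e = X + 2 * a := by rw [hX]; ring
      have hne : (a + 2) * (1 - n * e) = Y + a * (n + 1) := by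
        rw [hY, hB]; ring
      have main : (1 - a) * (a + 2) * (X * Y) ≤ L * ((X + 2 * a) * (Y + a * (n + 1))) := by
        have hLe : L = 2 - (n + 2) * a := by rw [hL]; ring
        have e1 : (1 - a) * (a + 2) = L + (n + 1) * a - a ^ 2 := by rw [hLe]; ring
        rw [e1]
        have h3 : X * Y ≤ X * L := by
          apply mul_le_mul_of_nonneg_left _ p2.le
          linarith
        have h4 : 0 < X * Y := mul_pos p2 p1
        have h5 : (n + 1) * a * (X * Y) ≤ (n + 1) * a * (X * L) :=
          mul_le_mul_of_nonneg_left h3 (by positivity)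
        have h6 : 0 ≤ L * (2 * a * Y) := by positivity
        have h7 : 0 ≤ L * (2 * a * (a * (n + 1))) := by positivity
        have h8 : 0 ≤ a ^ 2 * (X * Y) := by positivity
        nlinarith
      have e3 : L * ((X + 2 * a) * (Y + a * (n + 1)))
          = (a + 2) * (B * L * (e * (1 - n * e))) := by
        rw [← hBe, ← hne]; ring
      rw [e3] at main
      have : (a + 2) * ((1 - a) * (Y * X)) ≤ (a + 2) * (B * L * (e * (1 - n * e))) := by
        linarith
      exact le_of_mul_le_mul_left this (by linarith)
    have e4 : (-B) / (2 - n * a - B * e) - B / (B * e - 2 * a)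
          - (1 - a) * ((-n) / (1 - n * e) - 1 / e)
        = ((1 - a) * ((2 - n * a - B * e) * (B * e - 2 * a))
          - B * (2 - n * a - 2 * a) * (e * (1 - n * e)))
          / ((2 - n * a - B * e) * (B * e - 2 * a) * (e * (1 - n * e))) := by
      field_simp
      ring
    rw [e4]
    exact div_nonpos_of_nonpos_of_nonneg (by linarith) (by positivity)

lemma pathCurv_nonneg_of_lt {a n e e' : ℝ} (ha : 0 < a) (ha1 : a < 1) (hn : 1 ≤ n)
    (he : 0 < e) (hee : e < e') (hc' : 0 < 1 - n * e') (h : 0 < pathCurv a n e') :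
    0 ≤ pathCurv a n e := by
  set B := n * (a + 2) with hB
  have hBpos : 0 < B := by positivity
  have he' : 0 < e' := he.trans hee
  have hc : 0 < 1 - n * e := by nlinarith
  have hBB : B * e < B * e' := mul_lt_mul_of_pos_left hee hBpos
  have factor : ∀ t : ℝ, 0 < t → 0 < 1 - n * t → pathCurv a n t =
      (1 - n * t) ^ (a - 1) * (n * (2 - n * a - B * t)
        + ((1 - n * t) / t) ^ (1 - a) * (2 * a - B * t)) := by
    intro t ht htc
    have : (1 - n * t) ^ (a - 1) * ((1 - n * t) / t) ^ (1 - a) = t ^ (a - 1) := by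
      rw [Real.div_rpow htc.le ht.le, ← neg_sub a 1, Real.rpow_neg htc.le, Real.rpow_neg ht.le]
      have := (Real.rpow_pos_of_pos htc (a - 1)).ne'
      have := (Real.rpow_pos_of_pos ht (a - 1)).ne'
      field_simp
    rw [mul_add, ← mul_assoc _ (((1 - n * t) / t) ^ (1 - a)), this, pathCurv]
  have hpc := Real.rpow_pos_of_pos hc (a - 1)
  have hpc' := Real.rpow_pos_of_pos hc' (a - 1)
  rw [factor e' he' hc', mul_pos_iff_of_pos_left hpc'] at h
  rw [factor e he hc, mul_nonneg_iff_of_pos_left hpc]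
  have hr : 0 < (1 - n * e) / e := div_pos hc he
  have hr' : 0 < (1 - n * e') / e' := div_pos hc' he'
  have hrr : ((1 - n * e') / e') ^ (1 - a) ≤ ((1 - n * e) / e) ^ (1 - a) := by
    apply Real.rpow_le_rpow hr'.le _ (by linarith)
    rw [div_le_div_iff₀ he' he]
    nlinarith
  have hρ := Real.rpow_pos_of_pos hr (1 - a)
  have hρ' := Real.rpow_pos_of_pos hr' (1 - a)
  have hn0 : 0 < n := by linarith
  rcases le_or_gt (2 - n * a) (2 * a) with hs | hs
  · have h1 : B * e' < 2 * a := by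
      by_contra hcon
      push Not at hcon
      have := mul_nonneg hρ'.le (sub_nonneg.2 hcon)
      have := mul_nonneg hn0.le (show 0 ≤ B * e' - (2 - n * a) by linarith)
      nlinarith
    have h2 : ((1 - n * e') / e') ^ (1 - a) * (2 * a - B * e')
        ≤ ((1 - n * e) / e) ^ (1 - a) * (2 * a - B * e) :=
      mul_le_mul hrr (by linarith) (by linarith) hρ.le
    have h3 : n * (2 - n * a - B * e') ≤ n * (2 - n * a - B * e) :=
      mul_le_mul_of_nonneg_left (by linarith) hn0.le
    linarith
  · have h1 : B * e' < 2 - n * a := by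
      by_contra hcon
      push Not at hcon
      have := mul_nonneg hρ'.le (show 0 ≤ B * e' - 2 * a by linarith)
      have := mul_nonneg hn0.le (sub_nonneg.2 hcon)
      nlinarith
    rcases le_or_gt (B * e) (2 * a) with h2 | h2
    · have := mul_nonneg hρ.le (sub_nonneg.2 h2)
      have := mul_nonneg hn0.le (show 0 ≤ 2 - n * a - B * e by linarith)
      linarith
    · have logform : ∀ t : ℝ, 0 < t → 0 < 1 - n * t → 2 * a < B * t → B * t < 2 - n * a →
          (((1 - n * t) / t) ^ (1 - a) * (B * t - 2 * a) ≤ n * (2 - n * a - B * t) ↔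
          -Real.log n ≤ Real.log (2 - n * a - B * t) - Real.log (B * t - 2 * a)
            - (1 - a) * (Real.log (1 - n * t) - Real.log t)) := by
        intro t ht htc k1 k2
        have q1 : 0 < B * t - 2 * a := by linarith
        have q2 : 0 < 2 - n * a - B * t := by linarith
        have q3 : 0 < (1 - n * t) / t := div_pos htc ht
        rw [← Real.log_le_log_iff (mul_pos (Real.rpow_pos_of_pos q3 _) q1) (mul_pos hn0 q2),
          Real.log_mul (Real.rpow_pos_of_pos q3 _).ne' q1.ne', Real.log_rpow q3,
          Real.log_div htc.ne' ht.ne', Real.log_mul hn0.ne' q2.ne']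
        constructor <;> intro h <;> linarith
      have anti := (antitone_log_curv ha ha1 hn hs)
        ⟨h2, hBB.trans h1⟩ ⟨h2.trans hBB, h1⟩ hee.le
      have l' := (logform e' he' hc' (h2.trans hBB) h1).1 (by linarith)
      have l := (logform e he hc h2 (hBB.trans h1)).2 (l'.trans anti)
      linarith

/-- A function vanishing at both ends of an interval that is first convex and then concave does not
pass from positive to negative values. -/
lemma nonneg_of_convexOn_concaveOn {h : ℝ → ℝ} {b s x y : ℝ} (hs0 : 0 ≤ s) (hsb : s ≤ b)
    (hconv : ConvexOn ℝ (Set.Icc 0 s) h) (hconc : ConcaveOn ℝ (Set.Icc s b) h)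
    (h0 : h 0 = 0) (hb : h b = 0) (hx : 0 ≤ x) (hxy : x ≤ y) (hy : y ≤ b)
    (hpos : 0 < h x) : 0 ≤ h y := by
  have conc : ∀ z w, s ≤ z → z ≤ w → w ≤ b → 0 < h z → 0 ≤ h w := by
    intro z w h1 h2 h3 h4
    have := hconc.min_le_of_mem_Icc (x := z) (y := b) (z := w) ⟨h1, h2.trans h3⟩ ⟨hsb, le_rfl⟩
      ⟨h2, h3⟩
    rw [hb, min_eq_right h4.le] at this
    exact this
  have conv : ∀ w, x ≤ w → w ≤ s → 0 < h w := by
    intro w h1 h2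
    have := hconv.le_max_of_mem_Icc (x := 0) (y := w) (z := x) ⟨le_rfl, hs0⟩ ⟨hx.trans h1, h2⟩
      ⟨hx, h1⟩
    rw [h0] at this
    by_contra hcon
    rw [max_eq_left (not_lt.1 hcon)] at this
    linarith
  rcases le_total s x with h1 | h1
  · exact conc x y h1 hxy hy hpos
  rcases le_total y s with h2 | h2
  · exact (conv y hxy h2).le
  · exact conc s y le_rfl h2 hy (conv s h1 le_rfl)

lemma pathDeriv_zero {a : ℝ} (ha : 0 < a) (n : ℝ) : pathDeriv a n 0 = 0 := by
  simp [pathDeriv, Real.zero_rpow (show a + 1 ≠ 0 by linarith)]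

lemma pathDeriv_right (a : ℝ) {n : ℝ} (hn : 0 < n) : pathDeriv a n (1 / (n + 1)) = 0 := by
  have : 1 - n * (1 / (n + 1)) = 1 / (n + 1) := by field_simp; ring
  have h2 : 2 - n * (1 / (n + 1)) = 1 + 1 / (n + 1) := by linarith
  rw [pathDeriv, this, h2]; ring

lemma pathDeriv_crossing_of_lt_one {a n x y : ℝ} (ha : 0 < a) (ha1 : a < 1) (hn : 1 ≤ n)
    (hx : 0 ≤ x) (hxy : x ≤ y) (hy : y ≤ 1 / (n + 1)) (hpos : 0 < pathDeriv a n x) :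
    0 ≤ pathDeriv a n y := by
  set b := 1 / (n + 1) with hb
  have hb0 : 0 < b := by positivity
  have hcb : ∀ e, e ≤ b → 0 < 1 - n * e := by
    intro e he
    have : n * e ≤ n * b := mul_le_mul_of_nonneg_left he (by linarith)
    have : 1 - n * b = b := by rw [hb]; field_simp; ring
    linarith
  set S := insert 0 {e : ℝ | 0 < e ∧ e < b ∧ 0 < pathCurv a n e} with hS
  have hSb : ∀ e ∈ S, e ≤ b := by
    rintro e (rfl | h)
    · exact hb0.le
    · exact h.2.1.le
  have hbdd : BddAbove S := ⟨b, hSb⟩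
  have h0S : (0 : ℝ) ∈ S := Set.mem_insert _ _
  have hs0 : 0 ≤ sSup S := le_csSup hbdd h0S
  have hsb : sSup S ≤ b := csSup_le ⟨0, h0S⟩ hSb
  have hcont : Continuous (pathDeriv a n) :=
    continuous_iff_continuousAt.2 fun e => (hasDerivAt_pathDeriv ha).continuousAt
  refine nonneg_of_convexOn_concaveOn hs0 hsb ?_ ?_ (pathDeriv_zero ha n)
    (pathDeriv_right a (by linarith)) hx hxy hy hpos
  · refine convexOn_of_hasDerivWithinAt2_nonneg (convex_Icc _ _) hcont.continuousOn
      (f' := pathSlope a n) (f'' := fun e => (a + 1) * pathCurv a n e) ?_ ?_ ?_ <;>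
      intro e he <;> rw [interior_Icc] at he
    · exact (hasDerivAt_pathDeriv ha).hasDerivWithinAt
    · exact (hasDerivAt_pathSlope he.1 (hcb e (he.2.le.trans hsb))).hasDerivWithinAt
    · obtain ⟨e', he', hlt⟩ := exists_lt_of_lt_csSup ⟨0, h0S⟩ he.2
      rcases he' with rfl | he'
      · exact absurd hlt (not_lt.2 he.1.le)
      · exact mul_nonneg (by linarith) (pathCurv_nonneg_of_lt ha ha1 hn he.1 hlt
          (hcb e' he'.2.1.le) he'.2.2)
  · refine concaveOn_of_hasDerivWithinAt2_nonpos (convex_Icc _ _) hcont.continuousOn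
      (f' := pathSlope a n) (f'' := fun e => (a + 1) * pathCurv a n e) ?_ ?_ ?_ <;>
      intro e he <;> rw [interior_Icc] at he
    · exact (hasDerivAt_pathDeriv ha).hasDerivWithinAt
    · exact (hasDerivAt_pathSlope (hs0.trans_lt he.1) (hcb e he.2.le)).hasDerivWithinAt
    · by_contra hcon
      push Not at hcon
      have : e ∈ S := Or.inr ⟨hs0.trans_lt he.1, he.2,
        pos_of_mul_pos_right hcon (by linarith)⟩
      exact absurd (le_csSup hbdd this) (not_le.2 he.1)

lemma pathDeriv_eq_mul {a n e : ℝ} (he : 0 < e) (hc : 0 < 1 - n * e) :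
    pathDeriv a n e = (1 - n * e) ^ (a + 1) *
      ((1 - n * e - e) * (1 / (1 - n * e)) ^ (a + 1)
        + (2 - n * e) * (e / (1 - n * e)) ^ (a + 1) + -(1 + e)) := by
  have := (Real.rpow_pos_of_pos hc (a + 1)).ne'
  rw [Real.div_rpow he.le hc.le, Real.div_rpow zero_le_one hc.le, Real.one_rpow, pathDeriv]
  field_simp
  ring

lemma convexOn_const_rpow {x : ℝ} (hx : 0 < x) : ConvexOn ℝ Set.univ (fun p : ℝ => x ^ p) := by
  have := (convexOn_exp.comp_linearMap (LinearMap.mul ℝ ℝ (Real.log x)))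
  refine this.congr ?_
  intro p _
  simp [Real.rpow_def_of_pos hx]

lemma convexOn_pathDeriv_exponent {n e : ℝ} (he : 0 < e) (hc : 0 < 1 - n * e)
    (hec : e ≤ 1 - n * e) :
    ConvexOn ℝ Set.univ (fun p : ℝ => (1 - n * e - e) * (1 / (1 - n * e)) ^ p
        + (2 - n * e) * (e / (1 - n * e)) ^ p + -(1 + e)) :=
  ((((convexOn_const_rpow (one_div_pos.2 hc)).smul (sub_nonneg.2 hec)).add
    ((convexOn_const_rpow (div_pos he hc)).smul (show 0 ≤ 2 - n * e by linarith))).add_const _)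

lemma one_sub_mul_facts {n e : ℝ} (hn : 0 < n) (he : e ≤ 1 / (n + 1)) :
    0 < 1 - n * e ∧ e ≤ 1 - n * e := by
  rw [le_div_iff₀ (by linarith)] at he
  refine ⟨?_, by linarith⟩
  by_contra hcon
  push Not at hcon
  nlinarith

lemma pathDeriv_nonneg_mono {a a' n e : ℝ} (ha : 0 < a) (haa : a ≤ a') (hn : 0 < n) (he : 0 < e)
    (heb : e ≤ 1 / (n + 1)) (h : 0 ≤ pathDeriv a n e) : 0 ≤ pathDeriv a' n e := by
  obtain ⟨hc, hec⟩ := one_sub_mul_facts hn heb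
  rw [pathDeriv_eq_mul he hc] at h ⊢
  have h := nonneg_of_mul_nonneg_right h (Real.rpow_pos_of_pos hc _)
  refine mul_nonneg (Real.rpow_pos_of_pos hc _).le ?_
  have conv := (convexOn_pathDeriv_exponent he hc hec).2 (Set.mem_univ 1)
    (Set.mem_univ (a' + 1))
    (show 0 ≤ 1 - a / a' from sub_nonneg.2 ((div_le_one (by linarith)).2 haa))
    (show 0 ≤ a / a' from div_nonneg ha.le (by linarith)) (by ring)
  have e1 : (1 - a / a') • (1 : ℝ) + (a / a') • (a' + 1) = a + 1 := by
    have : a' ≠ 0 := by linarith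
    simp only [smul_eq_mul]; field_simp; ring
  have e2 : (1 - n * e - e) * (1 / (1 - n * e)) ^ (1 : ℝ)
      + (2 - n * e) * (e / (1 - n * e)) ^ (1 : ℝ) + -(1 + e) = 0 := by
    rw [Real.rpow_one, Real.rpow_one]; field_simp; ring
  simp only [e1, e2, smul_zero, zero_add] at conv
  exact nonneg_of_mul_nonneg_right (h.trans conv) (div_pos ha (by linarith))

lemma pathDeriv_one_eq_zero_at_two {e : ℝ} : pathDeriv 2 1 e = 0 := by
  have : ((2 : ℝ) + 1) = ((3 : ℕ) : ℝ) := by norm_num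
  rw [pathDeriv, this, Real.rpow_natCast, Real.rpow_natCast]; ring

lemma pathDeriv_one_nonpos {a e : ℝ} (ha : 0 < a) (ha2 : a ≤ 2) (he : 0 < e)
    (heb : e ≤ 1 / (1 + 1)) : pathDeriv a 1 e ≤ 0 := by
  by_contra hcon
  push Not at hcon
  obtain ⟨hc, hec⟩ := one_sub_mul_facts one_pos heb
  have h2 := pathDeriv_one_eq_zero_at_two (e := e)
  rw [pathDeriv_eq_mul he hc] at h2 hcon
  have h2 := (mul_eq_zero.1 h2).resolve_left (Real.rpow_pos_of_pos hc _).ne'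
  have hcon := pos_of_mul_pos_right hcon (Real.rpow_pos_of_pos hc _).le
  have conv := (convexOn_pathDeriv_exponent he hc hec).le_max_of_mem_Icc (Set.mem_univ 1)
    (Set.mem_univ (2 + 1)) (z := a + 1) ⟨by linarith, by linarith⟩
  have e2 : (1 - 1 * e - e) * (1 / (1 - 1 * e)) ^ (1 : ℝ)
      + (2 - 1 * e) * (e / (1 - 1 * e)) ^ (1 : ℝ) + -(1 + e) = 0 := by
    have : 1 - e ≠ 0 := by linarith
    rw [Real.rpow_one, Real.rpow_one]; field_simp; ring
  rw [e2, h2, max_self] at conv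
  linarith

lemma pathDeriv_exponent_one_nonneg {n e : ℝ} (hn : 2 ≤ n) (he : 0 < e)
    (heb : e ≤ 1 / (n + 1)) : 0 ≤ pathDeriv 1 n e := by
  have : ((1 : ℝ) + 1) = ((2 : ℕ) : ℝ) := by norm_num
  rw [pathDeriv, this, Real.rpow_natCast, Real.rpow_natCast]
  rw [le_div_iff₀ (by linarith)] at heb
  have : (1 - n * e - e) - (1 + e) * (1 - n * e) ^ 2 + (2 - n * e) * e ^ 2
      = e * (1 - (n + 1) * e) * (n - 2 + n * e) := by ring
  rw [this]
  have : 0 ≤ n * e := by positivity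
  exact mul_nonneg (mul_nonneg he.le (by linarith)) (by linarith)

/-- `pathDeriv` does not pass from positive to negative values. -/
lemma pathDeriv_crossing {a n x y : ℝ} (ha : 0 < a) (hn : n = 1 ∨ 2 ≤ n)
    (hx : 0 ≤ x) (hxy : x ≤ y) (hy : y ≤ 1 / (n + 1)) (hpos : 0 < pathDeriv a n x) :
    0 ≤ pathDeriv a n y := by
  have hx0 : 0 < x := by
    rcases hx.lt_or_eq with h | rfl
    · exact h
    · rw [pathDeriv_zero ha] at hpos; exact absurd hpos (lt_irrefl _)
  have hy0 := hx0.trans_le hxy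
  rcases hn with rfl | hn
  · rcases le_total a 2 with h | h
    · exact absurd hpos (not_lt.2 (pathDeriv_one_nonpos ha h hx0 (hxy.trans hy)))
    · exact pathDeriv_nonneg_mono two_pos h one_pos hy0 hy pathDeriv_one_eq_zero_at_two.ge
  · rcases lt_or_ge a 1 with h | h
    · exact pathDeriv_crossing_of_lt_one ha h (by linarith) hx hxy hy hpos
    · exact pathDeriv_nonneg_mono one_pos h (by linarith) hy0 hy
        (pathDeriv_exponent_one_nonneg hn hy0 hy)

/-- The ratio of the `q`-th power of the `ℓ_q` norm to that of the `ℓ_2` norm along the vectors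
`(1, -(1 - n e), -e, …, -e)`. -/
noncomputable def pathRatio (q n e : ℝ) : ℝ :=
  (1 + (1 - n * e) ^ q + n * e ^ q) / (1 + (1 - n * e) ^ 2 + n * e ^ 2) ^ (q / 2)

lemma hasDerivAt_pathRatio {q n e : ℝ} (hq : 2 < q) (hn : 0 < n) (he : 0 < e)
    (hc : 0 < 1 - n * e) :
    ∃ k, 0 ≤ k ∧ HasDerivAt (pathRatio q n) (k * pathDeriv (q - 2) n e) e := by
  have hlin : HasDerivAt (fun e : ℝ => 1 - n * e) (-n) e := by
    simpa using ((hasDerivAt_id e).const_mul n).const_sub 1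
  have hN := ((hlin.rpow_const (p := q) (Or.inl hc.ne')).const_add 1).add
    (((hasDerivAt_id e).rpow_const (p := q) (Or.inl he.ne')).const_mul n)
  have hD := ((hlin.pow 2).const_add 1).add (((hasDerivAt_id e).pow 2).const_mul n)
  have hS : 0 < 1 + (1 - n * e) ^ 2 + n * e ^ 2 := by positivity
  have hDq := hD.rpow_const (p := q / 2) (Or.inl hS.ne')
  have hDpos := Real.rpow_pos_of_pos hS (q / 2)
  refine ⟨q * n * (1 + (1 - n * e) ^ 2 + n * e ^ 2) ^ (q / 2 - 1)
    / ((1 + (1 - n * e) ^ 2 + n * e ^ 2) ^ (q / 2)) ^ 2, by positivity, ?_⟩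
  refine (hN.div hDq hDpos.ne').congr_deriv ?_
  have r1 : (1 - n * e) ^ q = (1 - n * e) ^ (q - 1) * (1 - n * e) := by
    rw [← Real.rpow_add_one hc.ne']; ring_nf
  have r2 : e ^ q = e ^ (q - 1) * e := by
    rw [← Real.rpow_add_one he.ne']; ring_nf
  have r3 : (1 + (1 - n * e) ^ 2 + n * e ^ 2) ^ (q / 2)
      = (1 + (1 - n * e) ^ 2 + n * e ^ 2) ^ (q / 2 - 1) * (1 + (1 - n * e) ^ 2 + n * e ^ 2) := by
    rw [← Real.rpow_add_one hS.ne']; ring_nf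
  have r4 : q - 2 + 1 = q - 1 := by ring
  simp only [id, Pi.add_apply, Pi.pow_apply, pathDeriv, r4]
  rw [div_mul_eq_mul_div]
  congr 1
  rw [r3, r1, r2]
  push_cast
  ring

lemma continuous_pathRatio {q n : ℝ} (hq : 2 < q) (hn : 0 < n) :
    Continuous (pathRatio q n) := by
  unfold pathRatio
  have h1 : ∀ e : ℝ, 0 < 1 + (1 - n * e) ^ 2 + n * e ^ 2 := fun e => by positivity
  refine Continuous.div ?_ ?_ fun e => (Real.rpow_pos_of_pos (h1 e) _).ne'
  · exact (continuous_const.add ((by fun_prop : Continuous fun e : ℝ => 1 - n * e).rpow_const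
      fun _ => Or.inr (by linarith))).add
      (continuous_const.mul (continuous_id.rpow_const fun _ => Or.inr (by linarith)))
  · exact (by fun_prop : Continuous fun e : ℝ => 1 + (1 - n * e) ^ 2 + n * e ^ 2).rpow_const
      fun _ => Or.inr (by linarith)

lemma pathRatio_le {q n e : ℝ} (hq : 2 < q) (hn : n = 1 ∨ 2 ≤ n) (he : 0 ≤ e)
    (heb : e ≤ 1 / (n + 1)) :
    pathRatio q n e ≤ max (pathRatio q n 0) (pathRatio q n (1 / (n + 1))) := by
  have hn0 : 0 < n := by rcases hn with rfl | h <;> linarith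
  by_cases hcase : ∃ x, 0 ≤ x ∧ x ≤ e ∧ 0 < pathDeriv (q - 2) n x
  · obtain ⟨x, hx0, hxe, hpos⟩ := hcase
    refine le_max_of_le_right ?_
    refine monotoneOn_of_deriv_nonneg (convex_Icc e (1 / (n + 1)))
      (continuous_pathRatio hq hn0).continuousOn ?_ ?_ ⟨le_rfl, heb⟩ ⟨heb, le_rfl⟩ heb <;>
      intro y hy <;> rw [interior_Icc] at hy <;>
      obtain ⟨k, hk, hd⟩ := hasDerivAt_pathRatio hq hn0 (he.trans_lt hy.1)
        (one_sub_mul_facts hn0 hy.2.le).1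
    · exact hd.differentiableAt.differentiableWithinAt
    · rw [hd.deriv]
      exact mul_nonneg hk (pathDeriv_crossing (by linarith) hn hx0 (hxe.trans hy.1.le) hy.2.le hpos)
  · push Not at hcase
    refine le_max_of_le_left ?_
    refine antitoneOn_of_deriv_nonpos (convex_Icc 0 e)
      (continuous_pathRatio hq hn0).continuousOn ?_ ?_ ⟨le_rfl, he⟩ ⟨he, le_rfl⟩ he <;>
      intro y hy <;> rw [interior_Icc] at hy <;>
      obtain ⟨k, hk, hd⟩ := hasDerivAt_pathRatio hq hn0 hy.1
        (one_sub_mul_facts hn0 (hy.2.le.trans heb)).1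
    · exact hd.differentiableAt.differentiableWithinAt
    · rw [hd.deriv]
      exact mul_nonpos_of_nonneg_of_nonpos hk (hcase y hy.1.le hy.2.le)

lemma pathRatio_zero {q n : ℝ} (hq : 2 < q) : pathRatio q n 0 = 2 ^ (1 - q / 2) := by
  have : q ≠ 0 := by linarith
  rw [pathRatio, Real.rpow_sub two_pos, Real.rpow_one]
  norm_num [Real.zero_rpow this]

lemma pathRatio_right {q n : ℝ} (hn : 0 < n) :
    pathRatio q n (1 / (n + 1))
      = ((n + 1) ^ (q / 2) + (n + 1) ^ (1 - q / 2)) / (n + 2) ^ (q / 2) := by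
  have h1 : 1 - n * (1 / (n + 1)) = 1 / (n + 1) := by field_simp; ring
  have hm : 0 < n + 1 := by linarith
  have h2 : 1 + (1 / (n + 1)) ^ 2 + n * (1 / (n + 1)) ^ 2 = (n + 2) / (n + 1) := by
    field_simp; ring
  have h3 : (n + 1) ^ q = (n + 1) ^ (q / 2) * (n + 1) ^ (q / 2) := by
    rw [← Real.rpow_add hm]; ring_nf
  have hp := Real.rpow_pos_of_pos hm (q / 2)
  have hp2 := Real.rpow_pos_of_pos (show 0 < n + 2 by linarith) (q / 2)
  rw [pathRatio, h1, h2, Real.div_rpow zero_le_one hm.le, Real.div_rpow (by linarith) hm.le,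
    Real.one_rpow, h3, Real.rpow_sub hm, Real.rpow_one]
  field_simp
  ring

lemma three_value_bound {q n c e : ℝ} (hq : 2 < q) (hn : n = 1 ∨ 2 ≤ n) (he : 0 ≤ e)
    (hec : e ≤ c) (hc : 0 < c) :
    (c + n * e) ^ q + c ^ q + n * e ^ q ≤
      max (2 ^ (1 - q / 2)) (((n + 1) ^ (q / 2) + (n + 1) ^ (1 - q / 2)) / (n + 2) ^ (q / 2)) *
        ((c + n * e) ^ 2 + c ^ 2 + n * e ^ 2) ^ (q / 2) := by
  have hn0 : 0 < n := by rcases hn with rfl | h <;> linarith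
  set u := c + n * e with hu
  have hu0 : 0 < u := by positivity
  have h1 : e / u ≤ 1 / (n + 1) := by
    rw [div_le_div_iff₀ hu0 (by linarith)]; linarith
  have h := pathRatio_le hq hn (div_nonneg he hu0.le) h1
  have h2 : 1 - n * (e / u) = c / u := by
    field_simp; rw [hu]; ring
  have hS : 0 < u ^ 2 + c ^ 2 + n * e ^ 2 := by positivity
  have h3 : 1 + (c / u) ^ 2 + n * (e / u) ^ 2 = (u ^ 2 + c ^ 2 + n * e ^ 2) / u ^ 2 := by
    field_simp
  have h4 : (u ^ 2) ^ (q / 2) = u ^ q := by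
    rw [← Real.rpow_natCast, ← Real.rpow_mul hu0.le]; congr 1; push_cast; ring
  rw [pathRatio_zero hq, pathRatio_right hn0, pathRatio, h2, h3,
    Real.div_rpow hS.le (by positivity), h4, Real.div_rpow hc.le hu0.le,
    Real.div_rpow he hu0.le] at h
  rw [← div_le_iff₀ (Real.rpow_pos_of_pos hS _)]
  refine le_of_eq_of_le ?_ h
  have := (Real.rpow_pos_of_pos hu0 q).ne'
  have := (Real.rpow_pos_of_pos hS (q / 2)).ne'
  field_simp

lemma hasDerivAt_abs_rpow_mul_self {p b : ℝ} (hb : 0 < b) :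
    HasDerivAt (fun s : ℝ => |s| ^ p * s) ((p + 1) * b ^ p) b := by
  have h := Real.hasDerivAt_rpow_const (x := b) (p := p + 1) (Or.inl hb.ne')
  rw [add_sub_cancel_right] at h
  refine h.congr_of_eventuallyEq ?_
  filter_upwards [eventually_gt_nhds hb] with s hs
  rw [abs_of_pos hs, Real.rpow_add_one hs.ne']

lemma first_order_condition {q b b' M : ℝ} (hq : 2 < q)
    (h : ∀ t : ℝ, |b + t| ^ q + |b' - t| ^ q - M * (1 + 2 * (b - b') * t + 2 * t ^ 2) ^ (q / 2)
      ≤ |b| ^ q + |b'| ^ q - M) :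
    |b| ^ (q - 2) * b - M * b = |b'| ^ (q - 2) * b' - M * b' := by
  have d1 : HasDerivAt (fun t : ℝ => |b + t| ^ q) (q * |b| ^ (q - 2) * b * 1) 0 := by
    have h0 : HasDerivAt (fun t : ℝ => b + t) 1 0 := (hasDerivAt_id 0).const_add b
    have := hasDerivAt_abs_rpow (b + 0) (p := q) (by linarith)
    have := this.comp (0 : ℝ) h0
    simp only [add_zero] at this
    exact this
  have d2 : HasDerivAt (fun t : ℝ => |b' - t| ^ q) (q * |b'| ^ (q - 2) * b' * (-1)) 0 := by
    have h0 : HasDerivAt (fun t : ℝ => b' - t) (-1) 0 := (hasDerivAt_id 0).const_sub b'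
    have := hasDerivAt_abs_rpow (b' - 0) (p := q) (by linarith)
    have := this.comp (0 : ℝ) h0
    simp only [sub_zero] at this
    exact this
  have d3 : HasDerivAt (fun t : ℝ => 1 + 2 * (b - b') * t + 2 * t ^ 2) (2 * (b - b')) 0 := by
    have h1 := (((hasDerivAt_id (0 : ℝ)).const_mul (2 * (b - b'))).const_add 1).add
      (((hasDerivAt_id (0 : ℝ)).pow 2).const_mul 2)
    refine h1.congr_deriv ?_
    simp
  have d4 := ((d1.add d2).sub ((d3.rpow_const (p := q / 2) (Or.inl (by simp))).const_mul M))
  have hmax : IsLocalMax (fun t : ℝ => |b + t| ^ q + |b' - t| ^ q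
      - M * (1 + 2 * (b - b') * t + 2 * t ^ 2) ^ (q / 2)) 0 := by
    refine Filter.Eventually.of_forall fun t => ?_
    simpa using h t
  have := hmax.hasDerivAt_eq_zero d4
  simp only [mul_zero, ne_eq, OfNat.ofNat_ne_zero, not_false_eq_true, zero_pow, add_zero,
    Real.one_rpow] at this
  have hq0 : q ≠ 0 := by linarith
  refine mul_left_cancel₀ hq0 ?_
  linarith

lemma second_order_condition_of_pos {q b M : ℝ} (hq : 2 < q) (hb : 0 < b)
    (h : ∀ t : ℝ, |b + t| ^ q + |b - t| ^ q - M * (1 + 2 * t ^ 2) ^ (q / 2)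
      ≤ |b| ^ q + |b| ^ q - M) :
    (q - 1) * b ^ (q - 2) ≤ M := by
  by_contra hcon
  push Not at hcon
  set φ : ℝ → ℝ := fun t => |b + t| ^ q + |b - t| ^ q - M * (1 + 2 * t ^ 2) ^ (q / 2) with hφ
  set ψ : ℝ → ℝ := fun t => q * (|b + t| ^ (q - 2) * (b + t)) - q * (|b - t| ^ (q - 2) * (b - t))
    - M * (2 * q * ((1 + 2 * t ^ 2) ^ (q / 2 - 1) * t)) with hψ
  have p1 : ∀ t : ℝ, HasDerivAt (fun t : ℝ => b + t) 1 t := fun t => (hasDerivAt_id t).const_add b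
  have p2 : ∀ t : ℝ, HasDerivAt (fun t : ℝ => b - t) (-1) t :=
    fun t => (hasDerivAt_id t).const_sub b
  have p3 : ∀ t : ℝ, HasDerivAt (fun t : ℝ => 1 + 2 * t ^ 2) (4 * t) t := by
    intro t
    refine ((((hasDerivAt_id t).pow 2).const_mul 2).const_add 1).congr_deriv ?_
    simp only [id]; push_cast; ring
  have hpos : ∀ t : ℝ, 1 + 2 * t ^ 2 ≠ 0 := fun t => by positivity
  have d1 : ∀ t, HasDerivAt φ (ψ t) t := by
    intro t
    have h1 := (hasDerivAt_abs_rpow (b + t) (p := q) (by linarith)).comp t (p1 t)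
    have h2 := (hasDerivAt_abs_rpow (b - t) (p := q) (by linarith)).comp t (p2 t)
    have h3 := ((p3 t).rpow_const (p := q / 2) (Or.inl (hpos t))).const_mul M
    refine ((h1.add h2).sub h3).congr_deriv ?_
    simp only [hψ]; ring
  have d2 : HasDerivAt ψ (2 * q * ((q - 1) * b ^ (q - 2) - M)) 0 := by
    have h1 : HasDerivAt (fun t : ℝ => |b + t| ^ (q - 2) * (b + t))
        ((q - 2 + 1) * b ^ (q - 2) * 1) 0 :=
      HasDerivAt.comp (h₂ := fun s : ℝ => |s| ^ (q - 2) * s) (0 : ℝ) (by simpa using hasDerivAt_abs_rpow_mul_self (p := q - 2) hb) (p1 0)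
    have h2 : HasDerivAt (fun t : ℝ => |b - t| ^ (q - 2) * (b - t))
        ((q - 2 + 1) * b ^ (q - 2) * (-1)) 0 :=
      HasDerivAt.comp (h₂ := fun s : ℝ => |s| ^ (q - 2) * s) (0 : ℝ) (by simpa using hasDerivAt_abs_rpow_mul_self (p := q - 2) hb) (p2 0)
    have h3 := ((p3 0).rpow_const (p := q / 2 - 1) (Or.inl (hpos 0))).mul (hasDerivAt_id (0 : ℝ))
    refine (((h1.const_mul q).sub (h2.const_mul q)).sub
      ((h3.const_mul (2 * q)).const_mul M)).congr_deriv ?_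
    simp
    ring
  have hd : deriv φ = ψ := funext fun t => (d1 t).deriv
  have hmin : IsLocalMin φ 0 := by
    refine isLocalMin_of_deriv_deriv_pos ?_ ?_ (d1 0).continuousAt
    · rw [hd, d2.deriv]
      exact mul_pos (by linarith) (by linarith)
    · rw [hd]; simp [hψ]
  have hconst : φ =ᶠ[nhds 0] fun _ => φ 0 := by
    filter_upwards [hmin] with t ht
    refine le_antisymm ?_ ht
    have := h t
    simpa [hφ] using this
  have h0 : ψ =ᶠ[nhds 0] fun _ => 0 := by
    rw [← hd]
    refine hconst.deriv.trans ?_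
    simp
  have := h0.deriv_eq
  rw [d2.deriv, deriv_const] at this
  have : 0 < 2 * q * ((q - 1) * b ^ (q - 2) - M) := mul_pos (by linarith) (by linarith)
  linarith

lemma second_order_condition {q b M : ℝ} (hq : 2 < q) (hM : 0 ≤ M)
    (h : ∀ t : ℝ, |b + t| ^ q + |b - t| ^ q - M * (1 + 2 * t ^ 2) ^ (q / 2)
      ≤ |b| ^ q + |b| ^ q - M) :
    (q - 1) * |b| ^ (q - 2) ≤ M := by
  rcases lt_trichotomy b 0 with hb | rfl | hb
  · rw [abs_of_neg hb]
    refine second_order_condition_of_pos hq (neg_pos.2 hb) fun t => ?_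
    have e1 : |-b + t| = |b - t| := by rw [← abs_neg]; ring_nf
    have e2 : |-b - t| = |b + t| := by rw [← abs_neg]; ring_nf
    rw [e1, e2, abs_neg]
    linarith [h t]
  · rw [abs_zero, Real.zero_rpow (by linarith)]
    linarith
  · rw [abs_of_pos hb]
    exact second_order_condition_of_pos hq hb h

/-- Stationary values split into a middle interval and two outer rays, on each of which the
stationarity equation is injective. -/
lemma exists_injOn_threshold {q M : ℝ} (hq : 2 < q) (hM : 0 ≤ M) :
    ∃ r : ℝ, 0 ≤ r ∧ (∀ b : ℝ, (q - 1) * |b| ^ (q - 2) ≤ M → |b| ≤ r) ∧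
      Set.InjOn (fun s : ℝ => |s| ^ (q - 2) * s - M * s) (Set.Ici r) ∧
      Set.InjOn (fun s : ℝ => |s| ^ (q - 2) * s - M * s) (Set.Iic (-r)) ∧
      Set.InjOn (fun s : ℝ => |s| ^ (q - 2) * s - M * s) (Set.Icc (-r) r) := by
  set g : ℝ → ℝ := fun s => |s| ^ (q - 2) * s - M * s with hg
  have hq1 : 0 < q - 1 := by linarith
  have hq2 : 0 < q - 2 := by linarith
  set r : ℝ := (M / (q - 1)) ^ (1 / (q - 2)) with hr
  have hMq : 0 ≤ M / (q - 1) := div_nonneg hM hq1.le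
  have hr0 : 0 ≤ r := Real.rpow_nonneg hMq _
  have hrM : (q - 1) * r ^ (q - 2) = M := by
    rw [hr, ← Real.rpow_mul hMq, one_div_mul_cancel hq2.ne', Real.rpow_one]
    field_simp
  have hodd : ∀ s, g (-s) = -g s := by
    intro s; simp only [hg, abs_neg]; ring
  have hcont : Continuous g :=
    ((continuous_abs.rpow_const fun _ => Or.inr hq2.le).mul continuous_id).sub
      (continuous_const.mul continuous_id)
  have hder : ∀ s, 0 < s → HasDerivAt g ((q - 1) * s ^ (q - 2) - M) s := by
    intro s hs
    refine ((hasDerivAt_abs_rpow_mul_self (p := q - 2) hs).sub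
      ((hasDerivAt_id s).const_mul M)).congr_deriv ?_
    ring
  have hmono : StrictMonoOn g (Set.Ici r) := by
    refine strictMonoOn_of_deriv_pos (convex_Ici r) hcont.continuousOn fun s hs => ?_
    rw [interior_Ici, Set.mem_Ioi] at hs
    rw [(hder s (hr0.trans_lt hs)).deriv, ← hrM, sub_pos]
    exact mul_lt_mul_of_pos_left (Real.rpow_lt_rpow hr0 hs hq2) hq1
  have hanti : StrictAntiOn g (Set.Icc 0 r) := by
    refine strictAntiOn_of_deriv_neg (convex_Icc 0 r) hcont.continuousOn fun s hs => ?_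
    rw [interior_Icc] at hs
    rw [(hder s hs.1).deriv, ← hrM, sub_neg]
    exact mul_lt_mul_of_pos_left (Real.rpow_lt_rpow hs.1.le hs.2 hq2) hq1
  have hanti' : StrictAntiOn g (Set.Icc (-r) 0) := by
    intro s hs t ht hst
    have := hanti (a := -t) (b := -s) ⟨by linarith [ht.2], by linarith [ht.1]⟩
      ⟨by linarith [hs.2], by linarith [hs.1]⟩ (by linarith)
    rw [hodd, hodd] at this
    linarith
  refine ⟨r, hr0, ?_, hmono.injOn, ?_, ?_⟩
  · intro b hb
    rw [← hrM, mul_le_mul_iff_right₀ hq1] at hb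
    exact (Real.rpow_le_rpow_iff (abs_nonneg b) hr0 hq2).1 hb
  · intro s hs t ht hst
    rw [Set.mem_Iic] at hs ht
    have := hmono.injOn (show -s ∈ Set.Ici r from by rw [Set.mem_Ici]; linarith)
      (show -t ∈ Set.Ici r from by rw [Set.mem_Ici]; linarith)
      (by rw [hodd, hodd]; exact congrArg Neg.neg hst)
    linarith
  · have := hanti'.union hanti (c := 0) ⟨⟨by linarith, le_rfl⟩, fun _ h => h.2⟩
      ⟨⟨le_rfl, hr0⟩, fun _ h => h.1⟩
    rw [Set.Icc_union_Icc_eq_Icc (by linarith) hr0] at this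
    exact this.injOn

lemma sum_comp_of_eq_const {d : ℕ} {x : Fin d → ℝ} {i j : Fin d} {e : ℝ} (hij : i ≠ j)
    (he : ∀ k, k ≠ i → k ≠ j → x k = e) (g : ℝ → ℝ) :
    ∑ k, g (x k) = g (x i) + g (x j) + ((d : ℝ) - 2) * g e := by
  have h := Fintype.sum_eq_add (f := fun k => g (x k) - g e) i j hij
    fun k hk => by rw [he k hk.1 hk.2, sub_self]
  rw [Finset.sum_sub_distrib, Finset.sum_const, Finset.card_univ, Fintype.card_fin,
    nsmul_eq_mul] at h
  linarith

lemma sum_comp_variation {d : ℕ} (x : Fin d → ℝ) {i j : Fin d} (hij : i ≠ j) (t : ℝ)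
    (g : ℝ → ℝ) :
    ∑ k, g (x k + (if k = i then t else if k = j then -t else 0))
      = ∑ k, g (x k) + (g (x i + t) - g (x i)) + (g (x j - t) - g (x j)) := by
  have h := Fintype.sum_eq_add
    (f := fun k => g (x k + (if k = i then t else if k = j then -t else 0)) - g (x k)) i j hij
    fun k hk => by simp [hk.1, hk.2]
  rw [Finset.sum_sub_distrib] at h
  simp only [if_true, hij.symm, if_false, ← sub_eq_add_neg] at h
  linarith

lemma exists_maximizer {d : ℕ} (hd : 3 ≤ d) {q : ℝ} (hq : 2 < q) :
    ∃ x : Fin d → ℝ, ∑ k, x k = 0 ∧ ∑ k, x k ^ 2 = 1 ∧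
      ∀ y : Fin d → ℝ, ∑ k, y k = 0 →
        ∑ k, |y k| ^ q ≤ (∑ k, |x k| ^ q) * (∑ k, y k ^ 2) ^ (q / 2) := by
  set S : Set (Fin d → ℝ) := {x | ∑ k, x k = 0 ∧ ∑ k, x k ^ 2 = 1} with hS
  have hclosed : IsClosed S :=
    (isClosed_eq (by fun_prop) continuous_const).inter (isClosed_eq (by fun_prop) continuous_const)
  have hsub : S ⊆ Set.Icc (fun _ => -1) (fun _ => 1) := by
    intro x hx
    have h1 : ∀ k, |x k| ≤ 1 := by
      intro k
      rw [← sq_le_one_iff_abs_le_one, ← hx.2]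
      exact Finset.single_le_sum (f := fun k => x k ^ 2) (fun k _ => sq_nonneg _)
        (Finset.mem_univ k)
    exact ⟨fun k => (abs_le.1 (h1 k)).1, fun k => (abs_le.1 (h1 k)).2⟩
  have hcomp : IsCompact S := isCompact_Icc.of_isClosed_subset hclosed hsub
  have hscale : ∀ y : Fin d → ℝ, ∑ k, y k = 0 → 0 < ∑ k, y k ^ 2 →
      (fun k => y k / √(∑ k, y k ^ 2)) ∈ S := by
    intro y h0 hpos
    refine ⟨?_, ?_⟩
    · rw [← Finset.sum_div, h0, zero_div]
    · simp only [div_pow]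
      rw [← Finset.sum_div, Real.sq_sqrt hpos.le, div_self hpos.ne']
  have hne : S.Nonempty := by
    obtain ⟨i, j, hij⟩ : ∃ i j : Fin d, i ≠ j :=
      ⟨⟨0, by omega⟩, ⟨1, by omega⟩, by simp⟩
    have hv := sum_comp_variation (fun _ => 0) hij 1
    refine ⟨_, hscale (fun k => 0 + (if k = i then 1 else if k = j then -1 else 0)) ?_ ?_⟩
    · rw [hv fun s => s]; simp
    · rw [hv fun s => s ^ 2]; norm_num
  have hcont : Continuous fun x : Fin d → ℝ => ∑ k, |x k| ^ q :=
    continuous_finsetSum _ fun k _ =>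
      (continuous_abs.comp (continuous_apply k)).rpow_const fun _ => Or.inr (by linarith)
  obtain ⟨x, hx, hmax⟩ := hcomp.exists_isMaxOn hne hcont.continuousOn
  refine ⟨x, hx.1, hx.2, fun y hy => ?_⟩
  have hnn : 0 ≤ ∑ k, y k ^ 2 := Finset.sum_nonneg fun k _ => sq_nonneg _
  rcases hnn.eq_or_lt with h0 | hpos
  · have hy0 : ∀ k, y k = 0 := fun k => by
      have := (Finset.sum_eq_zero_iff_of_nonneg fun k _ => sq_nonneg (y k)).1 h0.symm k
        (Finset.mem_univ k)
      simpa using this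
    simp only [hy0, abs_zero, Real.zero_rpow (show q ≠ 0 by linarith), Finset.sum_const_zero]
    exact mul_nonneg (Finset.sum_nonneg fun k _ => Real.rpow_nonneg (abs_nonneg _) _)
      (Real.rpow_nonneg (by simp) _)
  · have h := hmax (hscale y hy hpos)
    have hs : (√(∑ k, y k ^ 2)) ^ q = (∑ k, y k ^ 2) ^ (q / 2) := by
      rw [Real.sqrt_eq_rpow, ← Real.rpow_mul hnn]; ring_nf
    simp only [Set.mem_ofPred_eq, abs_div, abs_of_nonneg (Real.sqrt_nonneg (∑ k, y k ^ 2)),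
      Real.div_rpow (abs_nonneg _) (Real.sqrt_nonneg _), hs] at h
    rwa [← Finset.sum_div, div_le_iff₀ (Real.rpow_pos_of_pos hpos _)] at h

/-- The maximum of `∑ |x k| ^ q` over zero-sum unit vectors. -/
noncomputable def zeroSumConst (d : ℕ) (q : ℝ) : ℝ :=
  max (2 ^ (1 - q / 2))
    (((d - 1 : ℝ) ^ (q / 2) + (d - 1 : ℝ) ^ (1 - q / 2)) / (d : ℝ) ^ (q / 2))

lemma cast_sub_two_cases {d : ℕ} (hd : 3 ≤ d) : (d : ℝ) - 2 = 1 ∨ 2 ≤ (d : ℝ) - 2 := by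
  rcases hd.eq_or_lt with rfl | h
  · left; norm_num
  · right
    have : (4 : ℝ) ≤ d := by exact_mod_cast h
    linarith

lemma zeroSumConst_eq (d : ℕ) (q : ℝ) :
    zeroSumConst d q = max (2 ^ (1 - q / 2))
      ((((d : ℝ) - 2 + 1) ^ (q / 2) + ((d : ℝ) - 2 + 1) ^ (1 - q / 2))
        / ((d : ℝ) - 2 + 2) ^ (q / 2)) := by
  have h1 : (d : ℝ) - 2 + 1 = d - 1 := by ring
  have h2 : (d : ℝ) - 2 + 2 = d := by ring
  rw [zeroSumConst, h1, h2]

lemma bound_of_eq_const {d : ℕ} (hd : 3 ≤ d) {q : ℝ} (hq : 2 < q) {x : Fin d → ℝ}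
    (hx : ∑ k, x k = 0) {i j : Fin d} {e : ℝ} (hij : i ≠ j)
    (hk : ∀ k, k ≠ i → k ≠ j → x k = -e) (he : 0 ≤ e) (hej : e ≤ -x j) (hj : 0 < -x j) :
    ∑ k, |x k| ^ q ≤ zeroSumConst d q * (∑ k, x k ^ 2) ^ (q / 2) := by
  have hsum := sum_comp_of_eq_const hij hk fun s => s
  rw [hx] at hsum
  have hxi : x i = -x j + ((d : ℝ) - 2) * e := by linarith
  have hn : 0 < (d : ℝ) - 2 := by rcases cast_sub_two_cases hd with h | h <;> linarith
  have hxi0 : 0 < x i := by rw [hxi]; positivity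
  rw [sum_comp_of_eq_const hij hk fun s => |s| ^ q, sum_comp_of_eq_const hij hk fun s => s ^ 2,
    zeroSumConst_eq, abs_of_pos hxi0, abs_of_neg (neg_pos.1 hj), abs_neg, abs_of_nonneg he]
  have := three_value_bound hq (cast_sub_two_cases hd) he hej hj
  rw [← hxi] at this
  simpa only [neg_sq] using this

lemma bound_of_exists_large {d : ℕ} (hd : 3 ≤ d) {q : ℝ} (hq : 2 < q) {x : Fin d → ℝ}
    (hx : ∑ k, x k = 0) {r : ℝ} (hr : 0 ≤ r) (hp : ∀ i j, r < x i → r < x j → i = j)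
    (hm : ∀ i j, x i < -r → x j < -r → i = j) (hmid : ∀ i j, |x i| ≤ r → |x j| ≤ r → x i = x j)
    (hex : ∃ i, r < x i) :
    ∑ k, |x k| ^ q ≤ zeroSumConst d q * (∑ k, x k ^ 2) ^ (q / 2) := by
  obtain ⟨i, hi⟩ := hex
  by_cases hneg : ∃ j, x j < -r
  · obtain ⟨j, hj⟩ := hneg
    have hij : i ≠ j := by rintro rfl; linarith
    have hle : ∀ k, k ≠ i → k ≠ j → |x k| ≤ r := fun k hki hkj => abs_le.2
      ⟨not_lt.1 fun h => hkj (hm _ _ h hj), not_lt.1 fun h => hki (hp _ _ h hi)⟩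
    obtain ⟨k₀, hk₀⟩ : ∃ k, k ∉ ({i, j} : Finset (Fin d)) := by
      by_contra! hall
      have h1 := Finset.card_le_card fun k (_ : k ∈ Finset.univ) => hall k
      have h2 := Finset.card_le_two (a := i) (b := j)
      rw [Finset.card_univ, Fintype.card_fin] at h1
      omega
    simp only [Finset.mem_insert, Finset.mem_singleton, not_or] at hk₀
    have h0 := hle k₀ hk₀.1 hk₀.2
    have hconst : ∀ k, k ≠ i → k ≠ j → x k = x k₀ := fun k hki hkj =>
      hmid _ _ (hle k hki hkj) h0
    rw [abs_le] at h0
    rcases le_total (x k₀) 0 with hs | hs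
    · exact bound_of_eq_const hd hq hx hij (e := -x k₀)
        (fun k hki hkj => by rw [neg_neg]; exact hconst k hki hkj)
        (by linarith) (by linarith) (by linarith)
    · have := bound_of_eq_const hd hq (x := fun k => -x k)
        (by rw [Finset.sum_neg_distrib, hx, neg_zero]) hij.symm (e := x k₀)
        (fun k hkj hki => by rw [hconst k hki hkj])
        hs (by linarith) (by linarith)
      simpa only [abs_neg, neg_sq] using this
  · push Not at hneg
    obtain ⟨j, hji⟩ : ∃ j, j ≠ i := by
      have : Nontrivial (Fin d) := Fin.nontrivial_iff_two_le.2 (by omega)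
      exact exists_ne i
    have hle : ∀ k, k ≠ i → |x k| ≤ r := fun k hki => abs_le.2
      ⟨hneg k, not_lt.1 fun h => hki (hp _ _ h hi)⟩
    have hconst : ∀ k, k ≠ i → k ≠ j → x k = x j := fun k hki _ =>
      hmid _ _ (hle k hki) (hle j hji)
    have hsum := sum_comp_of_eq_const hji.symm hconst fun s => s
    rw [hx] at hsum
    have hn : 0 < (d : ℝ) - 2 := by rcases cast_sub_two_cases hd with h | h <;> linarith
    have hj : x j < 0 := by
      by_contra! hcon
      have := mul_nonneg hn.le hcon
      linarith
    exact bound_of_eq_const hd hq hx hji.symm (e := -x j)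
      (fun k hki hkj => by rw [neg_neg]; exact hconst k hki hkj)
      (by linarith) le_rfl (by linarith)

lemma sum_abs_rpow_le {d : ℕ} (hd : 3 ≤ d) {q : ℝ} (hq : 2 < q) {y : Fin d → ℝ}
    (hy : ∑ k, y k = 0) :
    ∑ k, |y k| ^ q ≤ zeroSumConst d q * (∑ k, y k ^ 2) ^ (q / 2) := by
  obtain ⟨x, hx, hx2, hmax⟩ := exists_maximizer hd hq
  refine (hmax y hy).trans (mul_le_mul_of_nonneg_right ?_ (Real.rpow_nonneg
    (Finset.sum_nonneg fun k _ => sq_nonneg _) _))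
  suffices h : ∑ k, |x k| ^ q ≤ zeroSumConst d q * (∑ k, x k ^ 2) ^ (q / 2) by
    rwa [hx2, Real.one_rpow, mul_one] at h
  set M := ∑ k, |x k| ^ q with hMdef
  have hM : 0 ≤ M := Finset.sum_nonneg fun k _ => Real.rpow_nonneg (abs_nonneg _) _
  have hvar : ∀ i j, i ≠ j → ∀ t : ℝ, |x i + t| ^ q + |x j - t| ^ q
      - M * (1 + 2 * (x i - x j) * t + 2 * t ^ 2) ^ (q / 2) ≤ |x i| ^ q + |x j| ^ q - M := by
    intro i j hij t
    have h := hmax (fun k => x k + (if k = i then t else if k = j then -t else 0))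
      (by rw [sum_comp_variation x hij t fun s => s, hx]; ring)
    rw [sum_comp_variation x hij t fun s => |s| ^ q, sum_comp_variation x hij t fun s => s ^ 2,
      hx2, ← hMdef] at h
    have e1 : 1 + ((x i + t) ^ 2 - x i ^ 2) + ((x j - t) ^ 2 - x j ^ 2)
        = 1 + 2 * (x i - x j) * t + 2 * t ^ 2 := by ring
    rw [e1] at h
    linarith
  obtain ⟨r, hr, hsmall, hinj₁, hinj₂, hinj₃⟩ := exists_injOn_threshold hq hM
  have hfirst : ∀ i j, |x i| ^ (q - 2) * x i - M * x i = |x j| ^ (q - 2) * x j - M * x j := by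
    intro i j
    rcases eq_or_ne i j with rfl | hij
    · rfl
    · exact first_order_condition hq (hvar i j hij)
  have hsecond : ∀ i j, i ≠ j → x i = x j → |x i| ≤ r := by
    intro i j hij h
    refine hsmall _ (second_order_condition hq hM fun t => ?_)
    have := hvar i j hij t
    rw [← h, sub_self, mul_zero, zero_mul, add_zero] at this
    exact this
  have hp : ∀ i j, r < x i → r < x j → i = j := by
    intro i j hi hj
    by_contra hij
    have := hsecond i j hij (hinj₁ hi.le hj.le (hfirst i j))
    linarith [le_abs_self (x i)]
  have hm : ∀ i j, x i < -r → x j < -r → i = j := by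
    intro i j hi hj
    by_contra hij
    have := hsecond i j hij (hinj₂ hi.le hj.le (hfirst i j))
    linarith [neg_le_abs (x i)]
  have hmid : ∀ i j, |x i| ≤ r → |x j| ≤ r → x i = x j := fun i j hi hj =>
    hinj₃ (abs_le.1 hi) (abs_le.1 hj) (hfirst i j)
  by_cases hpos : ∃ i, r < x i
  · exact bound_of_exists_large hd hq hx hr hp hm hmid hpos
  by_cases hneg : ∃ i, x i < -r
  · have := bound_of_exists_large hd hq (x := fun k => -x k)
      (by rw [Finset.sum_neg_distrib, hx, neg_zero]) hr
      (fun i j hi hj => hm i j (by linarith) (by linarith))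
      (fun i j hi hj => hp i j (by linarith) (by linarith))
      (fun i j hi hj => by
        rw [abs_neg] at hi hj
        rw [hmid i j hi hj])
      (by obtain ⟨i, hi⟩ := hneg; exact ⟨i, by linarith⟩)
    simpa only [abs_neg, neg_sq] using this
  · push Not at hpos hneg
    have i₀ : Fin d := ⟨0, by omega⟩
    have hall : ∀ k, x k = x i₀ := fun k =>
      hmid _ _ (abs_le.2 ⟨hneg _, hpos _⟩) (abs_le.2 ⟨hneg _, hpos _⟩)
    have hd0 : (d : ℝ) ≠ 0 := by
      have : d ≠ 0 := by omega
      exact_mod_cast this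
    have h0 : x i₀ = 0 := by
      rw [Finset.sum_congr rfl fun k _ => hall k, Finset.sum_const, Finset.card_univ,
        Fintype.card_fin, nsmul_eq_mul] at hx
      exact (mul_eq_zero.1 hx).resolve_left hd0
    simp [hall, h0] at hx2

lemma exists_ratio_eq_pathRatio {d : ℕ} (hd : 3 ≤ d) {q : ℝ} (hq : 2 < q) {e : ℝ} (he : 0 ≤ e)
    (heb : e ≤ 1 / ((d : ℝ) - 2 + 1)) :
    ∃ x : Fin d → ℝ, x ≠ 0 ∧ (∑ i, x i) = 0 ∧ pathRatio q ((d : ℝ) - 2) e ^ (1 / q)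
      = (∑ i, |x i| ^ q) ^ (1 / q) / Real.sqrt (∑ i, (x i) ^ 2) := by
  have hn : 0 < (d : ℝ) - 2 := by rcases cast_sub_two_cases hd with h | h <;> linarith
  obtain ⟨hc, -⟩ := one_sub_mul_facts hn heb
  obtain ⟨i, j, hij⟩ : ∃ i j : Fin d, i ≠ j :=
    ⟨⟨0, by omega⟩, ⟨1, by omega⟩, by simp⟩
  set c := 1 - ((d : ℝ) - 2) * e with hcdef
  set x : Fin d → ℝ := fun k => if k = i then 1 else if k = j then -c else -e with hxdef
  have hxi : x i = 1 := by simp [hxdef]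
  have hxj : x j = -c := by simp [hxdef, hij.symm]
  have hxk : ∀ k, k ≠ i → k ≠ j → x k = -e := fun k h1 h2 => by simp [hxdef, h1, h2]
  refine ⟨x, fun h => ?_, ?_, ?_⟩
  · rw [h] at hxi; simp at hxi
  · rw [sum_comp_of_eq_const hij hxk fun s => s, hxi, hxj, hcdef]; ring
  · rw [sum_comp_of_eq_const hij hxk fun s => |s| ^ q, sum_comp_of_eq_const hij hxk fun s => s ^ 2,
      hxi, hxj, abs_one, abs_neg, abs_neg, abs_of_pos hc, abs_of_nonneg he, Real.one_rpow, neg_sq,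
      neg_sq, one_pow, pathRatio]
    have hS : 0 < 1 + c ^ 2 + ((d : ℝ) - 2) * e ^ 2 := by positivity
    have hN : 0 ≤ 1 + c ^ q + ((d : ℝ) - 2) * e ^ q := by positivity
    have hq0 : q ≠ 0 := by linarith
    rw [Real.div_rpow hN (Real.rpow_nonneg hS.le _), ← Real.rpow_mul hS.le, Real.sqrt_eq_rpow]
    congr 2
    field_simp

/-- For `d ≥ 3` and `2 < q < ∞`, the maximum of `‖x‖_q / ‖x‖_2` over nonzero
zero-sum vectors `x ∈ ℝ^d` equals
`max { 2^(1/q - 1/2), (((d-1)^(q/2) + (d-1)^(1-q/2)) / d^(q/2))^(1/q) }`. -/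
theorem holevo_utkin_q_gt_two (d : ℕ) (hd : 3 ≤ d) (q : ℝ) (hq : 2 < q) :
    IsGreatest { r : ℝ | ∃ x : Fin d → ℝ, x ≠ 0 ∧ (∑ i, x i) = 0 ∧
        r = (∑ i, |x i| ^ q) ^ (1 / q) / Real.sqrt (∑ i, (x i) ^ 2) }
      (max ((2 : ℝ) ^ (1 / q - 1 / 2 : ℝ))
        ((((d - 1 : ℝ) ^ (q / 2) + (d - 1 : ℝ) ^ (1 - q / 2)) / (d : ℝ) ^ (q / 2)) ^ (1 / q))) := by
  have hq0 : 0 < q := by linarith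
  have hn : 0 < (d : ℝ) - 2 := by rcases cast_sub_two_cases hd with h | h <;> linarith
  have hA : (2 : ℝ) ^ (1 / q - 1 / 2 : ℝ) = pathRatio q ((d : ℝ) - 2) 0 ^ (1 / q) := by
    rw [pathRatio_zero hq, ← Real.rpow_mul two_pos.le]
    congr 1
    field_simp
  have hB : ((d - 1 : ℝ) ^ (q / 2) + (d - 1 : ℝ) ^ (1 - q / 2)) / (d : ℝ) ^ (q / 2)
      = pathRatio q ((d : ℝ) - 2) (1 / ((d : ℝ) - 2 + 1)) := by
    rw [pathRatio_right hn]
    ring_nf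
  constructor
  · rw [hA, hB]
    rcases max_choice (pathRatio q ((d : ℝ) - 2) 0 ^ (1 / q))
      (pathRatio q ((d : ℝ) - 2) (1 / ((d : ℝ) - 2 + 1)) ^ (1 / q)) with h | h <;> rw [h]
    · exact exists_ratio_eq_pathRatio hd hq le_rfl (by positivity)
    · exact exists_ratio_eq_pathRatio hd hq (by positivity) le_rfl
  · rintro _ ⟨x, hx0, hx, rfl⟩
    have hmax : (max ((2 : ℝ) ^ (1 / q - 1 / 2 : ℝ))
        ((((d - 1 : ℝ) ^ (q / 2) + (d - 1 : ℝ) ^ (1 - q / 2)) / (d : ℝ) ^ (q / 2)) ^ (1 / q)))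
        = zeroSumConst d q ^ (1 / q) := by
      have hmono : MonotoneOn (fun s : ℝ => s ^ (1 / q)) (Set.Ici 0) := fun s hs t _ hst =>
        Real.rpow_le_rpow hs hst (by positivity)
      have hd1 : (0 : ℝ) ≤ d - 1 := by linarith
      have h2 : (2 : ℝ) ^ (1 - q / 2) ∈ Set.Ici (0 : ℝ) := Real.rpow_nonneg two_pos.le _
      have h3 : ((d - 1 : ℝ) ^ (q / 2) + (d - 1 : ℝ) ^ (1 - q / 2)) / (d : ℝ) ^ (q / 2)
          ∈ Set.Ici (0 : ℝ) := Set.mem_Ici.2 (by positivity)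
      rw [hA, pathRatio_zero hq, zeroSumConst]
      exact (hmono.map_max h2 h3).symm
    obtain ⟨i, hi⟩ := Function.ne_iff.1 hx0
    have hS : 0 < ∑ k, x k ^ 2 := Finset.sum_pos' (fun k _ => sq_nonneg _)
      ⟨i, Finset.mem_univ i, sq_pos_of_ne_zero hi⟩
    have hC : 0 ≤ zeroSumConst d q := le_max_of_le_left (Real.rpow_nonneg two_pos.le _)
    rw [hmax, div_le_iff₀ (Real.sqrt_pos.2 hS)]
    calc (∑ k, |x k| ^ q) ^ (1 / q)
        ≤ (zeroSumConst d q * (∑ k, x k ^ 2) ^ (q / 2)) ^ (1 / q) :=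
          Real.rpow_le_rpow (Finset.sum_nonneg fun k _ => Real.rpow_nonneg (abs_nonneg _) _)
            (sum_abs_rpow_le hd hq hx) (by positivity)
      _ = zeroSumConst d q ^ (1 / q) * √(∑ k, x k ^ 2) := by
          rw [Real.mul_rpow hC (Real.rpow_nonneg hS.le _), ← Real.rpow_mul hS.le,
            Real.sqrt_eq_rpow]
          congr 2
          field_simp
end

section
/- Let d ≥ 3 and α ∈ (0,1) ∪ (1,∞). Then the minimum of H_α(P_x) over all x ∈ ℝ^d with ‖x‖_2 = 1 and x_1 + ⋯ + x_d = 0 equals min{ log 2, (1/(1−α)) · log( ((d−1)^α + (d−1)^{1−α}) / d^α ) }. -/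
open Set

namespace RenyiZeroSum

/-- A function on `[0,1]` whose derivative changes sign at most once, from negative to positive,
is bounded by its values at the endpoints. -/
lemma le_max_endpoints {f f' : ℝ → ℝ} (hc : ContinuousOn f (Icc 0 1))
    (hd : ∀ x ∈ Ioo (0 : ℝ) 1, HasDerivAt f (f' x) x)
    (hp : ∀ x y, 0 < x → x < y → y < 1 → 0 < f' x → 0 ≤ f' y) {x : ℝ} (hx : x ∈ Icc (0 : ℝ) 1) :
    f x ≤ max (f 0) (f 1) := by
  by_contra! h
  obtain ⟨h0, h1⟩ := max_lt_iff.1 h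
  have hx0 : 0 < x := lt_of_le_of_ne hx.1 (by rintro rfl; exact lt_irrefl _ h0)
  have hx1 : x < 1 := lt_of_le_of_ne hx.2 (by rintro rfl; exact lt_irrefl _ h1)
  obtain ⟨a, ha, hfa⟩ := exists_hasDerivAt_eq_slope f f' hx0
    (hc.mono (Icc_subset_Icc le_rfl hx1.le)) fun z hz => hd z ⟨hz.1, hz.2.trans hx1⟩
  obtain ⟨b, hb, hfb⟩ := exists_hasDerivAt_eq_slope f f' hx1
    (hc.mono (Icc_subset_Icc hx0.le le_rfl)) fun z hz => hd z ⟨hx0.trans hz.1, hz.2⟩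
  have hpos : 0 < f' a := by rw [hfa]; exact div_pos (by linarith) (by linarith)
  have hneg : f' b < 0 := by rw [hfb]; exact div_neg_of_neg_of_pos (by linarith) (by linarith)
  exact absurd (hp a b ha.1 (ha.2.trans hb.1) hb.2 hpos) (not_le.2 hneg)

/-- If `g` vanishes at `0` and `1` and `g''` changes sign at most once, from positive to negative,
then `g` changes sign at most once, from negative to positive. -/
lemma sign_change_of_second_deriv {g g' g'' : ℝ → ℝ} (hc : ContinuousOn g (Icc 0 1))
    (hd : ∀ x ∈ Ioo (0 : ℝ) 1, HasDerivAt g (g' x) x)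
    (hd' : ∀ x ∈ Ioo (0 : ℝ) 1, HasDerivAt g' (g'' x) x) (h0 : g 0 = 0) (h1 : g 1 = 0)
    (hp : ∀ x y, 0 < x → x < y → y < 1 → g'' x < 0 → g'' y ≤ 0) {x y : ℝ} (hx : 0 < x)
    (hxy : x < y) (hy : y < 1) (hgx : 0 < g x) : 0 ≤ g y := by
  by_contra! hgy
  obtain ⟨a, ha, hga⟩ := exists_hasDerivAt_eq_slope g g' hx
    (hc.mono (Icc_subset_Icc le_rfl (by linarith)))
    fun z hz => hd z ⟨hz.1, by linarith [hz.2]⟩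
  obtain ⟨b, hb, hgb⟩ := exists_hasDerivAt_eq_slope g g' hxy
    (hc.mono (Icc_subset_Icc hx.le hy.le)) fun z hz => hd z ⟨hx.trans hz.1, hz.2.trans hy⟩
  obtain ⟨c, hcc, hgc⟩ := exists_hasDerivAt_eq_slope g g' hy
    (hc.mono (Icc_subset_Icc (by linarith) le_rfl))
    fun z hz => hd z ⟨by linarith [hz.1], hz.2⟩
  have ha' : 0 < g' a := by rw [hga]; exact div_pos (by linarith) (by linarith)
  have hb' : g' b < 0 := by rw [hgb]; exact div_neg_of_neg_of_pos (by linarith) (by linarith)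
  have hc' : 0 < g' c := by rw [hgc]; exact div_pos (by linarith) (by linarith)
  have hab : a < b := ha.2.trans hb.1
  have hbc : b < c := hb.2.trans hcc.1
  have hd'' : ∀ z, a ≤ z → z ≤ c → HasDerivAt g' (g'' z) z := fun z hz hz' =>
    hd' z ⟨ha.1.trans_le hz, hz'.trans_lt hcc.2⟩
  obtain ⟨s, hs, hgs⟩ := exists_hasDerivAt_eq_slope g' g'' hab
    (fun z hz => (hd'' z hz.1 (hz.2.trans hbc.le)).continuousAt.continuousWithinAt)
    fun z hz => hd'' z hz.1.le (hz.2.trans hbc).le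
  obtain ⟨t, ht, hgt⟩ := exists_hasDerivAt_eq_slope g' g'' hbc
    (fun z hz => (hd'' z (hab.le.trans hz.1) hz.2).continuousAt.continuousWithinAt)
    fun z hz => hd'' z (hab.trans hz.1).le hz.2.le
  have hs' : g'' s < 0 := by rw [hgs]; exact div_neg_of_neg_of_pos (by linarith) (by linarith)
  have ht' : 0 < g'' t := by rw [hgt]; exact div_pos (by linarith) (by linarith)
  exact absurd (hp s t (ha.1.trans hs.1) (hs.2.trans ht.1) (ht.2.trans hcc.2) hs') (not_le.2 ht')

/-- The sign of the derivative of `profile m r` is that of this function. -/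
noncomputable def slope (m r x : ℝ) : ℝ :=
  (1 - x) * (1 + m * x) ^ r + x ^ r * (2 + m * x) - (1 + (m + 1) * x)

/-- The derivative of `slope m r`. -/
noncomputable def slopeDeriv (m r x : ℝ) : ℝ :=
  -(1 + m * x) ^ r + (1 - x) * (m * r * (1 + m * x) ^ (r - 1)) +
    (r * x ^ (r - 1) * (2 + m * x) + x ^ r * m) - (m + 1)

/-- The second derivative of `slope m r`, divided by `r`. -/
noncomputable def slopeCurv (m r x : ℝ) : ℝ :=
  x ^ (r - 2) * (2 * (r - 1) + m * (r + 1) * x) -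
    m * (1 + m * x) ^ (r - 2) * (m * (r + 1) * x + 2 - (r - 1) * m)

lemma hasDerivAt_slope {m r x : ℝ} (hm : 1 ≤ m) (hx : 0 < x) :
    HasDerivAt (slope m r) (slopeDeriv m r x) x := by
  have hu : HasDerivAt (fun x : ℝ => 1 + m * x) m x := by
    simpa using ((hasDerivAt_id x).const_mul m).const_add 1
  have hu0 : (1 + m * x) ≠ 0 := by positivity
  have h1 := hu.rpow_const (p := r) (Or.inl hu0)
  have h2 := Real.hasDerivAt_rpow_const (x := x) (p := r) (Or.inl hx.ne')
  have h3 : HasDerivAt (fun x : ℝ => 2 + m * x) m x := by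
    simpa using ((hasDerivAt_id x).const_mul m).const_add 2
  have h4 : HasDerivAt (fun x : ℝ => 1 - x) (-1) x := by
    simpa using (hasDerivAt_id x).const_sub 1
  have h5 : HasDerivAt (fun x : ℝ => 1 + (m + 1) * x) (m + 1) x := by
    simpa using ((hasDerivAt_id x).const_mul (m + 1)).const_add 1
  refine HasDerivAt.congr_deriv (((h4.mul h1).add (h2.mul h3)).sub h5) ?_
  unfold slopeDeriv
  ring

lemma hasDerivAt_slopeDeriv {m r x : ℝ} (hm : 1 ≤ m) (hx : 0 < x) :
    HasDerivAt (slopeDeriv m r) (r * slopeCurv m r x) x := by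
  have hu : HasDerivAt (fun x : ℝ => 1 + m * x) m x := by
    simpa using ((hasDerivAt_id x).const_mul m).const_add 1
  have hu0 : 0 < 1 + m * x := by positivity
  have h1 := hu.rpow_const (p := r) (Or.inl hu0.ne')
  have h1' := hu.rpow_const (p := r - 1) (Or.inl hu0.ne')
  have h2 := Real.hasDerivAt_rpow_const (x := x) (p := r) (Or.inl hx.ne')
  have h2' := Real.hasDerivAt_rpow_const (x := x) (p := r - 1) (Or.inl hx.ne')
  have h3 : HasDerivAt (fun x : ℝ => 2 + m * x) m x := by
    simpa using ((hasDerivAt_id x).const_mul m).const_add 2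
  have h4 : HasDerivAt (fun x : ℝ => 1 - x) (-1) x := by
    simpa using (hasDerivAt_id x).const_sub 1
  have e1 : (1 + m * x) ^ (r - 1) = (1 + m * x) ^ (r - 2) * (1 + m * x) := by
    rw [← Real.rpow_add_one hu0.ne']; ring_nf
  have e2 : x ^ (r - 1) = x ^ (r - 2) * x := by
    rw [← Real.rpow_add_one hx.ne']; ring_nf
  refine HasDerivAt.congr_deriv (((h1.neg.add (h4.mul (h1'.const_mul (m * r)))).add
    (((h2'.const_mul r).mul h3).add (h2.mul_const m))).sub_const (m + 1)) ?_
  unfold slopeCurv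
  rw [show r - 1 - 1 = r - 2 by ring, e1, e2]
  ring

lemma continuousOn_slope {m r : ℝ} (hr : 0 < r) : ContinuousOn (slope m r) (Icc 0 1) := by
  have h1 : Continuous fun x : ℝ => (1 + m * x) ^ r :=
    (by fun_prop : Continuous fun x : ℝ => 1 + m * x).rpow_const fun _ => Or.inr hr.le
  have h2 : Continuous fun x : ℝ => x ^ r := continuous_id.rpow_const fun _ => Or.inr hr.le
  unfold slope
  exact Continuous.continuousOn (by fun_prop)

lemma slope_zero {m r : ℝ} (hr : 0 < r) : slope m r 0 = 0 := by
  simp [slope, Real.zero_rpow hr.ne']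

lemma slope_one {m r : ℝ} : slope m r 1 = 0 := by
  simp [slope]; ring

/-- Logarithm of the quotient of the two terms of `slopeCurv m r`, up to the constant `log m`. -/
noncomputable def curvRatio (m r x : ℝ) : ℝ :=
  (r - 2) * (Real.log x - Real.log (1 + m * x)) + Real.log (2 * (r - 1) + m * (r + 1) * x) -
    Real.log (m * (r + 1) * x + 2 - (r - 1) * m)

lemma slopeCurv_eq {m r x : ℝ} (hm : 1 ≤ m) (hx : 0 < x)
    (h1 : 0 < 2 * (r - 1) + m * (r + 1) * x) (h2 : 0 < m * (r + 1) * x + 2 - (r - 1) * m) :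
    slopeCurv m r x = (1 + m * x) ^ (r - 2) * (m * (r + 1) * x + 2 - (r - 1) * m) *
      (Real.exp (curvRatio m r x) - m) := by
  have hu : 0 < 1 + m * x := by positivity
  have : Real.exp (curvRatio m r x) = x ^ (r - 2) / (1 + m * x) ^ (r - 2) *
      (2 * (r - 1) + m * (r + 1) * x) / (m * (r + 1) * x + 2 - (r - 1) * m) := by
    unfold curvRatio
    rw [Real.exp_sub, Real.exp_add, Real.exp_log h1, Real.exp_log h2, mul_sub, Real.exp_sub,
      Real.rpow_def_of_pos hx, Real.rpow_def_of_pos hu, mul_comm (r - 2), mul_comm (r - 2)]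
  have hp : (1 + m * x) ^ (r - 2) ≠ 0 := (Real.rpow_pos_of_pos hu _).ne'
  rw [this, slopeCurv]
  field_simp

lemma hasDerivAt_curvRatio {m r x : ℝ} (hm : 1 ≤ m) (hx : 0 < x)
    (h1 : 0 < 2 * (r - 1) + m * (r + 1) * x) (h2 : 0 < m * (r + 1) * x + 2 - (r - 1) * m) :
    HasDerivAt (curvRatio m r)
      ((r - 1) * (2 * (r - 2) * (2 - (r - 1) * m) + m * (r + 1) * ((r - 1) * (2 - m) - 2) * x +
        m ^ 2 * (r + 1) * (r - m - 2) * x ^ 2) / (x * (1 + m * x) *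
        (2 * (r - 1) + m * (r + 1) * x) * (m * (r + 1) * x + 2 - (r - 1) * m))) x := by
  have hu0 : 0 < 1 + m * x := by positivity
  have hu : HasDerivAt (fun x : ℝ => 1 + m * x) m x := by
    simpa using ((hasDerivAt_id x).const_mul m).const_add 1
  have hn1 : HasDerivAt (fun x : ℝ => 2 * (r - 1) + m * (r + 1) * x) (m * (r + 1)) x := by
    simpa using ((hasDerivAt_id x).const_mul (m * (r + 1))).const_add (2 * (r - 1))
  have hn2 : HasDerivAt (fun x : ℝ => m * (r + 1) * x + 2 - (r - 1) * m) (m * (r + 1)) x := by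
    simpa using (((hasDerivAt_id x).const_mul (m * (r + 1))).add_const 2).sub_const ((r - 1) * m)
  refine HasDerivAt.congr_deriv ((((Real.hasDerivAt_log hx.ne').sub
    (hu.log hu0.ne')).const_mul (r - 2)).add (hn1.log h1.ne') |>.sub (hn2.log h2.ne')) ?_
  have key : ∀ a b k : ℝ, a ≠ 0 → b ≠ 0 → (r - 2) * (x⁻¹ - m / (1 + m * x)) + k / a - k / b =
      ((r - 2) * a * b + k * (b - a) * x * (1 + m * x)) / (x * (1 + m * x) * a * b) := by
    intro a b k ha hb
    field_simp
    ring
  rw [key _ _ _ h1.ne' h2.ne']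
  congr 1
  ring

/-- For `1 < r < 2` the function `slopeCurv m r` changes sign at most once, from positive to
negative. -/
lemma slopeCurv_nonpos {m r x y : ℝ} (hm : 1 ≤ m) (hr1 : 1 < r) (hr2 : r < 2) (hx : 0 < x)
    (hxy : x < y) (h : slopeCurv m r x < 0) : slopeCurv m r y ≤ 0 := by
  have hmr : 0 < m * (r + 1) := by positivity
  have hr0 : 0 < r - 1 := by linarith
  have hn1 : ∀ z, x ≤ z → 0 < 2 * (r - 1) + m * (r + 1) * z := fun z hz => by
    have : 0 < z := by linarith
    positivity
  have hx2 : 0 < m * (r + 1) * x + 2 - (r - 1) * m := by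
    by_contra! hle
    have h1 : 0 < x ^ (r - 2) * (2 * (r - 1) + m * (r + 1) * x) :=
      mul_pos (Real.rpow_pos_of_pos hx _) (hn1 x le_rfl)
    have h2 : m * (1 + m * x) ^ (r - 2) * (m * (r + 1) * x + 2 - (r - 1) * m) ≤ 0 :=
      mul_nonpos_of_nonneg_of_nonpos (by positivity) hle
    unfold slopeCurv at h
    linarith
  have hn2 : ∀ z, x ≤ z → 0 < m * (r + 1) * z + 2 - (r - 1) * m := fun z hz => by
    have := mul_le_mul_of_nonneg_left hz hmr.le
    linarith
  have hanti : curvRatio m r y ≤ curvRatio m r x := by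
    refine antitoneOn_of_hasDerivWithinAt_nonpos (convex_Icc x y)
      (fun z hz => (hasDerivAt_curvRatio hm (hx.trans_le hz.1) (hn1 z hz.1)
        (hn2 z hz.1)).continuousAt.continuousWithinAt)
      (fun z hz => (hasDerivAt_curvRatio hm (hx.trans_le (interior_subset hz).1)
        (hn1 z (interior_subset hz).1) (hn2 z (interior_subset hz).1)).hasDerivWithinAt)
      (fun z hz => ?_) (left_mem_Icc.2 hxy.le) (right_mem_Icc.2 hxy.le) hxy.le
    replace hz := (interior_subset hz).1
    have hz0 : 0 < z := hx.trans_le hz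
    have k1 := hn1 z hz
    have k2 := hn2 z hz
    refine div_nonpos_of_nonpos_of_nonneg ?_ (by positivity)
    rcases le_total 0 (2 - (r - 1) * m) with hc | hc
    · refine mul_nonpos_of_nonneg_of_nonpos hr0.le ?_
      have a1 : 2 * (r - 2) * (2 - (r - 1) * m) ≤ 0 :=
        mul_nonpos_of_nonpos_of_nonneg (by linarith) hc
      have a2 : m * (r + 1) * ((r - 1) * (2 - m) - 2) * z ≤ 0 :=
        mul_nonpos_of_nonpos_of_nonneg
          (mul_nonpos_of_nonneg_of_nonpos hmr.le (by nlinarith)) hz0.le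
      have a3 : m ^ 2 * (r + 1) * (r - m - 2) * z ^ 2 ≤ 0 :=
        mul_nonpos_of_nonpos_of_nonneg
          (mul_nonpos_of_nonneg_of_nonpos (by positivity) (by linarith)) (by positivity)
      linarith
    · have b1 : (r - 2) * ((2 * (r - 1) + m * (r + 1) * z) *
          (m * (r + 1) * z + 2 - (r - 1) * m)) ≤ 0 :=
        mul_nonpos_of_nonpos_of_nonneg (by linarith) (by positivity)
      have b2 : (2 - (r - 1) * (m + 2)) * (m * (r + 1) * z * (1 + m * z)) ≤ 0 :=
        mul_nonpos_of_nonpos_of_nonneg (by nlinarith) (by positivity)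
      linarith
  rw [slopeCurv_eq hm hx (hn1 x le_rfl) hx2] at h
  rw [slopeCurv_eq hm (hx.trans hxy) (hn1 y hxy.le) (hn2 y hxy.le)]
  have hux : 0 < (1 + m * x) ^ (r - 2) := Real.rpow_pos_of_pos (by positivity) _
  have huy : 0 < (1 + m * y) ^ (r - 2) :=
    Real.rpow_pos_of_pos (by have := hx.trans hxy; positivity) _
  have hneg := (pos_iff_neg_of_mul_neg h).1 (mul_pos hux hx2)
  exact mul_nonpos_of_nonneg_of_nonpos (mul_pos huy (hn2 y hxy.le)).le
    (by linarith [Real.exp_le_exp.2 hanti])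

/-- For `0 < r < 1` the function `slopeCurv m r` changes sign at most once, from negative to
positive. -/
lemma slopeCurv_nonneg {m r x y : ℝ} (hm : 1 ≤ m) (hr0 : 0 < r) (hr1 : r < 1) (hx : 0 < x)
    (hxy : x < y) (h : 0 < slopeCurv m r x) : 0 ≤ slopeCurv m r y := by
  have hmr : 0 < m * (r + 1) := by positivity
  have hn2 : ∀ z, x ≤ z → 0 < m * (r + 1) * z + 2 - (r - 1) * m := fun z hz => by
    have : 0 < m * (r + 1) * z := mul_pos hmr (hx.trans_le hz)
    nlinarith
  have hx1 : 0 < 2 * (r - 1) + m * (r + 1) * x := by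
    by_contra! hle
    have h1 : x ^ (r - 2) * (2 * (r - 1) + m * (r + 1) * x) ≤ 0 :=
      mul_nonpos_of_nonneg_of_nonpos (by positivity) hle
    have h2 : 0 < m * (1 + m * x) ^ (r - 2) * (m * (r + 1) * x + 2 - (r - 1) * m) :=
      mul_pos (by positivity) (hn2 x le_rfl)
    unfold slopeCurv at h
    linarith
  have hn1 : ∀ z, x ≤ z → 0 < 2 * (r - 1) + m * (r + 1) * z := fun z hz => by
    have := mul_le_mul_of_nonneg_left hz hmr.le
    linarith
  have hmono : curvRatio m r x ≤ curvRatio m r y := by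
    refine monotoneOn_of_hasDerivWithinAt_nonneg (convex_Icc x y)
      (fun z hz => (hasDerivAt_curvRatio hm (hx.trans_le hz.1) (hn1 z hz.1)
        (hn2 z hz.1)).continuousAt.continuousWithinAt)
      (fun z hz => (hasDerivAt_curvRatio hm (hx.trans_le (interior_subset hz).1)
        (hn1 z (interior_subset hz).1) (hn2 z (interior_subset hz).1)).hasDerivWithinAt)
      (fun z hz => ?_) (left_mem_Icc.2 hxy.le) (right_mem_Icc.2 hxy.le) hxy.le
    replace hz := (interior_subset hz).1
    have hz0 : 0 < z := hx.trans_le hz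
    have k1 := hn1 z hz
    have k2 := hn2 z hz
    refine div_nonneg (mul_nonneg_of_nonpos_of_nonpos (by linarith) ?_) (by positivity)
    obtain ⟨a, rfl⟩ : ∃ a, r = 1 - a := ⟨1 - r, by ring⟩
    obtain ⟨w, hw⟩ : ∃ w, w = m * z := ⟨_, rfl⟩
    have hw0 : 0 < w := by rw [hw]; positivity
    have ha0 : 0 < a := by linarith
    have ha1 : a < 1 := by linarith
    have key : 0 ≤ 2 * (1 + a) * (2 + a * m) + (2 - a) * (2 - a * (m - 2)) * w +
        (2 - a) * (m + 1 + a) * w ^ 2 := by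
      have c1 : 0 ≤ (2 - a) * m * (w - a / 2) ^ 2 := mul_nonneg (by nlinarith) (sq_nonneg _)
      have c2 : 0 ≤ (2 - a) * (2 + 2 * a) * w + (2 - a) * (1 + a) * w ^ 2 := by
        have : 0 < 2 - a := by linarith
        positivity
      have c3 : 0 ≤ a * m * (2 - (2 - a) * a / 4) := mul_nonneg (by positivity) (by nlinarith)
      have c4 : 0 ≤ 4 + 4 * a + 2 * a * a * m := by positivity
      linarith
    have : 2 * (1 - a - 2) * (2 - (1 - a - 1) * m) +
        m * (1 - a + 1) * ((1 - a - 1) * (2 - m) - 2) * z +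
        m ^ 2 * (1 - a + 1) * (1 - a - m - 2) * z ^ 2 =
        -(2 * (1 + a) * (2 + a * m) + (2 - a) * (2 - a * (m - 2)) * w +
        (2 - a) * (m + 1 + a) * w ^ 2) := by
      rw [hw]; ring
    linarith
  rw [slopeCurv_eq hm hx hx1 (hn2 x le_rfl)] at h
  rw [slopeCurv_eq hm (hx.trans hxy) (hn1 y hxy.le) (hn2 y hxy.le)]
  have hux : 0 < (1 + m * x) ^ (r - 2) := Real.rpow_pos_of_pos (by positivity) _
  have huy : 0 < (1 + m * y) ^ (r - 2) :=
    Real.rpow_pos_of_pos (by have := hx.trans hxy; positivity) _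
  have hpos := (pos_iff_pos_of_mul_pos h).1 (mul_pos hux (hn2 x le_rfl))
  exact mul_nonneg (mul_pos huy (hn2 y hxy.le)).le (by linarith [Real.exp_le_exp.2 hmono])

lemma convexOn_slope_exponent {m x : ℝ} (hm : 1 ≤ m) (hx : 0 < x) (hx1 : x < 1) :
    ConvexOn ℝ univ fun r => slope m r x := by
  have h1 := (convexOn_rpow_left (b := 1 + m * x) (by positivity)).smul
    (show (0 : ℝ) ≤ 1 - x by linarith)
  have h2 := (convexOn_rpow_left hx).smul (show (0 : ℝ) ≤ 2 + m * x by positivity)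
  refine ((h1.add h2).add_const (-(1 + (m + 1) * x))).congr fun r _ => ?_
  simp only [slope, Pi.add_apply, smul_eq_mul]
  ring

lemma slope_exponent_one (m x : ℝ) : slope m 1 x = 0 := by
  simp only [slope, Real.rpow_one]; ring

/-- By convexity in the exponent, nonnegativity of the slope propagates to larger exponents. -/
lemma slope_nonneg_of_exponent_le {m r s x : ℝ} (hm : 1 ≤ m) (hx : 0 < x) (hx1 : x < 1)
    (hs : 1 < s) (hsr : s ≤ r) (h : 0 ≤ slope m s x) : 0 ≤ slope m r x := by
  have hr : 0 < r - 1 := by linarith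
  have hc := (convexOn_slope_exponent hm hx hx1).2 (mem_univ 1) (mem_univ r)
    (show 0 ≤ (r - s) / (r - 1) from div_nonneg (by linarith) hr.le)
    (show 0 ≤ (s - 1) / (r - 1) from div_nonneg (by linarith) hr.le) (by field_simp; ring)
  have e : (r - s) / (r - 1) * 1 + (s - 1) / (r - 1) * r = s := by field_simp; ring
  simp only [smul_eq_mul, e, slope_exponent_one, mul_zero, zero_add] at hc
  exact nonneg_of_mul_nonneg_right (h.trans hc) (div_pos (by linarith) hr)

lemma slope_exponent_two_nonneg {m x : ℝ} (hm : 2 ≤ m) (hx : 0 < x) (hx1 : x < 1) :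
    0 ≤ slope m 2 x := by
  have : slope m 2 x = x * (1 - x) * ((m - 2) + m * (m - 1) * x) := by
    simp only [slope, Real.rpow_two]; ring
  rw [this]
  have h1 : 0 ≤ m * (m - 1) * x := mul_nonneg (by nlinarith) hx.le
  exact mul_nonneg (mul_nonneg hx.le (by linarith)) (by linarith)

lemma slope_one_exponent_three (x : ℝ) : slope 1 3 x = 0 := by
  have h : ∀ y : ℝ, y ^ (3 : ℝ) = y ^ 3 := fun y => by exact_mod_cast Real.rpow_natCast y 3
  simp only [slope, h]; ring

lemma slope_one_nonpos {r x : ℝ} (hr1 : 1 ≤ r) (hr3 : r ≤ 3) (hx : 0 < x) (hx1 : x < 1) :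
    slope 1 r x ≤ 0 := by
  have hc := (convexOn_slope_exponent le_rfl hx hx1).2 (mem_univ 1) (mem_univ 3)
    (show 0 ≤ (3 - r) / 2 by linarith) (show 0 ≤ (r - 1) / 2 by linarith) (by ring)
  have e : (3 - r) / 2 * 1 + (r - 1) / 2 * 3 = r := by ring
  simpa only [smul_eq_mul, e, slope_exponent_one, slope_one_exponent_three, mul_zero,
    add_zero] using hc

lemma slope_nonneg_of_pos {m r x y : ℝ} (hm : m = 1 ∨ 2 ≤ m) (hr : 1 < r) (hx : 0 < x)
    (hxy : x < y) (hy : y < 1) (h : 0 < slope m r x) : 0 ≤ slope m r y := by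
  have hm1 : 1 ≤ m := by rcases hm with h | h <;> linarith
  rcases lt_or_ge r 2 with hr2 | hr2
  · refine sign_change_of_second_deriv (continuousOn_slope (by linarith))
      (fun z hz => hasDerivAt_slope hm1 hz.1) (fun z hz => hasDerivAt_slopeDeriv hm1 hz.1)
      (slope_zero (by linarith)) slope_one (fun a b ha hab _ hc => ?_) hx hxy hy h
    have hc' : slopeCurv m r a < 0 := (pos_iff_neg_of_mul_neg hc).1 (by linarith)
    exact mul_nonpos_of_nonneg_of_nonpos (by linarith) (slopeCurv_nonpos hm1 hr hr2 ha hab hc')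
  have hy0 := hx.trans hxy
  rcases hm with rfl | hm
  · rcases le_total r 3 with hr3 | hr3
    · exact absurd (slope_one_nonpos hr.le hr3 hx (hxy.trans hy)) (not_le.2 h)
    · exact slope_nonneg_of_exponent_le le_rfl hy0 hy (by norm_num) hr3
        (slope_one_exponent_three y).ge
  · exact slope_nonneg_of_exponent_le hm1 hy0 hy (by norm_num) hr2
      (slope_exponent_two_nonneg hm hy0 hy)

lemma slope_nonpos_of_neg {m r x y : ℝ} (hm : 1 ≤ m) (hr0 : 0 < r) (hr : r < 1) (hx : 0 < x)
    (hxy : x < y) (hy : y < 1) (h : slope m r x < 0) : slope m r y ≤ 0 := by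
  refine neg_nonneg.1 (sign_change_of_second_deriv (g := fun z => -slope m r z)
    (continuousOn_slope hr0).neg (fun z hz => (hasDerivAt_slope hm hz.1).neg)
    (fun z hz => (hasDerivAt_slopeDeriv hm hz.1).neg) (by simp [slope_zero hr0])
    (by simp [slope_one]) (fun a b ha hab _ hc => ?_) hx hxy hy (neg_pos.2 h))
  have hc' : 0 < slopeCurv m r a := (pos_iff_pos_of_mul_pos (neg_neg_iff_pos.1 hc)).1 hr0
  exact neg_nonpos.2 (mul_nonneg hr0.le (slopeCurv_nonneg hm hr0 hr ha hab hc'))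

/-- Logarithm of the `(r+1)`-power sum of the normalisation of the vector
`(1 + m * x, -1, -x, …, -x)` with `m` trailing entries. -/
noncomputable def profile (m r x : ℝ) : ℝ :=
  Real.log ((1 + m * x) ^ (r + 1) + 1 + m * x ^ (r + 1)) -
    (r + 1) / 2 * Real.log ((1 + m * x) ^ 2 + 1 + m * x ^ 2)

lemma hasDerivAt_profile {m r x : ℝ} (hm : 1 ≤ m) (hx : 0 < x) :
    HasDerivAt (profile m r) ((r + 1) * m * slope m r x /
      (((1 + m * x) ^ (r + 1) + 1 + m * x ^ (r + 1)) * ((1 + m * x) ^ 2 + 1 + m * x ^ 2))) x := by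
  have hu : HasDerivAt (fun x : ℝ => 1 + m * x) m x := by
    simpa using ((hasDerivAt_id x).const_mul m).const_add 1
  have hu0 : 0 < 1 + m * x := by positivity
  have h1 := hu.rpow_const (p := r + 1) (Or.inl hu0.ne')
  have h2 := Real.hasDerivAt_rpow_const (x := x) (p := r + 1) (Or.inl hx.ne')
  have hT : 0 < (1 + m * x) ^ (r + 1) + 1 + m * x ^ (r + 1) := by positivity
  have hN : 0 < (1 + m * x) ^ 2 + 1 + m * x ^ 2 := by positivity
  have hT' : HasDerivAt (fun x : ℝ => (1 + m * x) ^ (r + 1) + 1 + m * x ^ (r + 1)) _ x :=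
    (h1.add_const 1).add (h2.const_mul m)
  have hN' : HasDerivAt (fun x : ℝ => (1 + m * x) ^ 2 + 1 + m * x ^ 2) _ x :=
    ((hu.pow 2).add_const 1).add ((hasDerivAt_pow 2 x).const_mul m)
  refine HasDerivAt.congr_deriv ((hT'.log hT.ne').sub ((hN'.log hN.ne').const_mul ((r + 1) / 2))) ?_
  have e1 : (1 + m * x) ^ (r + 1) = (1 + m * x) ^ r * (1 + m * x) := Real.rpow_add_one hu0.ne' _
  have e2 : x ^ (r + 1) = x ^ r * x := Real.rpow_add_one hx.ne' _
  simp only [add_sub_cancel_right, slope]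
  rw [← mul_div_assoc, div_sub_div _ _ hT.ne' hN.ne', e1, e2]
  congr 1
  norm_num
  ring

lemma continuousOn_profile {m r : ℝ} (hm : 1 ≤ m) (hr : 0 < r) :
    ContinuousOn (profile m r) (Icc 0 1) := by
  have h1 : Continuous fun x : ℝ => (1 + m * x) ^ (r + 1) :=
    (by fun_prop : Continuous fun x : ℝ => 1 + m * x).rpow_const fun _ => Or.inr (by linarith)
  have h2 : Continuous fun x : ℝ => x ^ (r + 1) :=
    continuous_id.rpow_const fun _ => Or.inr (by linarith)
  refine ContinuousOn.sub (ContinuousOn.log (Continuous.continuousOn (by fun_prop)) ?_)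
    (continuousOn_const.mul (ContinuousOn.log (Continuous.continuousOn (by fun_prop)) ?_)) <;>
  · intro x hx
    have := hx.1
    positivity

lemma profile_le_max {m r x : ℝ} (hm : m = 1 ∨ 2 ≤ m) (hr : 1 < r) (hx : x ∈ Icc (0 : ℝ) 1) :
    profile m r x ≤ max (profile m r 0) (profile m r 1) := by
  have hm1 : 1 ≤ m := by rcases hm with h | h <;> linarith
  refine le_max_endpoints (continuousOn_profile hm1 (by linarith))
    (fun z hz => hasDerivAt_profile hm1 hz.1) (fun a b ha hab hb h => ?_) hx
  have hb0 : 0 < b := ha.trans hab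
  have hs : 0 < slope m r a :=
    (pos_iff_pos_of_mul_pos ((div_pos_iff_of_pos_right (by positivity)).1 h)).1 (by positivity)
  have := slope_nonneg_of_pos hm hr ha hab hb hs
  positivity

lemma min_le_profile {m r x : ℝ} (hm : 1 ≤ m) (hr0 : 0 < r) (hr : r < 1)
    (hx : x ∈ Icc (0 : ℝ) 1) : min (profile m r 0) (profile m r 1) ≤ profile m r x := by
  have h := le_max_endpoints (f := fun z => -profile m r z) (continuousOn_profile hm hr0).neg
    (fun z hz => (hasDerivAt_profile hm hz.1).neg) (fun a b ha hab hb h => ?_) hx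
  · rw [max_neg_neg] at h
    exact neg_le_neg_iff.1 h
  have hb0 : 0 < b := ha.trans hab
  have hs : slope m r a < 0 := by
    by_contra! hs
    have : 0 ≤ (r + 1) * m * slope m r a / (((1 + m * a) ^ (r + 1) + 1 + m * a ^ (r + 1)) *
      ((1 + m * a) ^ 2 + 1 + m * a ^ 2)) := by positivity
    linarith
  have := slope_nonpos_of_neg hm hr0 hr ha hab hb hs
  exact neg_nonneg.2 (div_nonpos_of_nonpos_of_nonneg
    (mul_nonpos_of_nonneg_of_nonpos (by positivity) this) (by positivity))

/-- A function with convex derivative `ψ`, `ψ 0 = 0`, lies below the quadratic polynomial that is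
tangent to it at `e` and meets it at `c`, on the whole of `[-c, c]` after even extension. -/
lemma exists_quadratic_majorant {φ ψ : ℝ → ℝ} (hψ : ConvexOn ℝ (Ici 0) ψ) (hψ0 : ψ 0 = 0)
    (hφ : ∀ x, 0 ≤ x → HasDerivAt φ (ψ x) x) {e c : ℝ} (he : 0 ≤ e) (hec : e < c) :
    ∃ A B C : ℝ, (∀ w, |w| ≤ c → φ |w| ≤ A + B * w + C * w ^ 2) ∧
      φ c = A + B * c + C * c ^ 2 ∧ φ e = A + B * e + C * e ^ 2 := by
  obtain ⟨C, hC⟩ : ∃ C, C * (c - e) ^ 2 = φ c - φ e - ψ e * (c - e) :=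
    ⟨(φ c - φ e - ψ e * (c - e)) / (c - e) ^ 2,
      div_mul_cancel₀ _ (pow_pos (sub_pos.2 hec) 2).ne'⟩
  obtain ⟨B, hB⟩ : ∃ B, B = ψ e - 2 * C * e := ⟨_, rfl⟩
  obtain ⟨A, hA⟩ : ∃ A, A = φ e - B * e - C * e ^ 2 := ⟨_, rfl⟩
  set h : ℝ → ℝ := fun w => φ w - (A + B * w + C * w ^ 2) with hh
  set h' : ℝ → ℝ := fun w => ψ w + (-B + -(2 * C) * w) with hh'
  have hd : ∀ w, 0 ≤ w → HasDerivAt h (h' w) w := fun w hw => by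
    refine HasDerivAt.congr_deriv ((hφ w hw).sub ((((hasDerivAt_id w).const_mul B).const_add A).add
      ((hasDerivAt_pow 2 w).const_mul C))) ?_
    simp only [hh']
    norm_num
    ring
  have hconv : ConvexOn ℝ (Ici 0) h' := by
    refine hψ.add ⟨convex_Ici 0, fun x _ y _ a b _ _ hab => le_of_eq ?_⟩
    simp only [smul_eq_mul]
    linear_combination B * hab
  have h_e : h e = 0 := by simp only [hh, hA]; ring
  have h_c : h c = 0 := by simp only [hh, hA, hB]; linear_combination -hC
  have h'_e : h' e = 0 := by simp only [hh', hB]; ring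
  have hmvt : ∀ a b, 0 ≤ a → a < b → ∃ z ∈ Ioo a b, h' z * (b - a) = h b - h a := by
    intro a b ha hab
    obtain ⟨z, hz, hzz⟩ := exists_hasDerivAt_eq_slope h h' hab
      (fun z hz => (hd z (ha.trans hz.1)).continuousAt.continuousWithinAt)
      fun z hz => hd z (ha.trans hz.1.le)
    exact ⟨z, hz, by rw [hzz, div_mul_cancel₀ _ (sub_pos.2 hab).ne']⟩
  have hseg : ∀ a z b, 0 ≤ a → a < z → z < b → (b - a) * h' z ≤ (b - z) * h' a + (z - a) * h' b := by
    intro a z b ha haz hzb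
    have hab : 0 < b - a := by linarith
    have := hconv.2 (mem_Ici.2 ha) (mem_Ici.2 (by linarith : (0 : ℝ) ≤ b))
      (show 0 ≤ (b - z) / (b - a) from div_nonneg (by linarith) hab.le)
      (show 0 ≤ (z - a) / (b - a) from div_nonneg (by linarith) hab.le) (by field_simp; ring)
    have e1 : (b - z) / (b - a) * a + (z - a) / (b - a) * b = z := by field_simp; ring
    simp only [smul_eq_mul, e1] at this
    calc (b - a) * h' z ≤ (b - a) * ((b - z) / (b - a) * h' a + (z - a) / (b - a) * h' b) :=
          mul_le_mul_of_nonneg_left this hab.le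
      _ = _ := by field_simp
  have hB0 : B ≤ 0 := by
    have h0 : h' 0 = -B := by simp [hh', hψ0]
    rcases he.eq_or_lt with rfl | he
    · linarith
    obtain ⟨z, hz, hz0⟩ := hmvt e c he.le hec
    have hz0' : h' z = 0 := by
      rw [h_c, h_e, sub_zero] at hz0
      exact (mul_eq_zero.1 hz0).resolve_right (sub_pos.2 hec).ne'
    have := hseg 0 e z le_rfl he hz.1
    rw [h'_e, hz0', h0] at this
    have : 0 < z - e := sub_pos.2 hz.1
    nlinarith
  have hle : ∀ w, 0 ≤ w → w ≤ c → h w ≤ 0 := by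
    intro w hw hwc
    by_contra! hpos
    have hwc' : w < c := lt_of_le_of_ne hwc (by rintro rfl; linarith)
    rcases lt_trichotomy w e with hwe | rfl | hwe
    · obtain ⟨z, hz, hz0⟩ := hmvt w e hw hwe
      obtain ⟨y, hy, hy0⟩ := hmvt e c he hec
      have := hseg z e y (hw.trans hz.1.le) hz.2 hy.1
      rw [h_c, h_e, sub_zero] at hy0
      have hy0' : h' y = 0 := (mul_eq_zero.1 hy0).resolve_right (sub_pos.2 hec).ne'
      have hz0' : h' z < 0 := by
        by_contra! hc
        have := mul_nonneg hc (sub_pos.2 hwe).le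
        linarith
      rw [h'_e, hy0'] at this
      have := mul_neg_of_pos_of_neg (sub_pos.2 hy.1) hz0'
      linarith
    · linarith
    · obtain ⟨z, hz, hz0⟩ := hmvt e w he hwe
      obtain ⟨y, hy, hy0⟩ := hmvt w c hw hwc'
      have hy1 : h' y < 0 := by
        by_contra! hc
        have := mul_nonneg hc (sub_pos.2 hwc').le
        linarith
      have hz1 : 0 < h' z := by
        by_contra! hc
        have := mul_nonpos_of_nonpos_of_nonneg hc (sub_pos.2 hwe).le
        linarith
      have := hseg e z y he hz.1 (hz.2.trans hy.1)
      rw [h'_e] at this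
      have k1 := mul_pos (sub_pos.2 (hz.1.trans (hz.2.trans hy.1))) hz1
      have k2 := mul_neg_of_pos_of_neg (sub_pos.2 hz.1) hy1
      linarith
  refine ⟨A, B, C, fun w hw => ?_, by linarith [h_c], by linarith [h_e]⟩
  have h1 := hle |w| (abs_nonneg w) hw
  simp only [hh, sq_abs] at h1
  have h2 : B * |w| ≤ B * w := mul_le_mul_of_nonpos_left (le_abs_self w) hB0
  linarith

/-- Among families of `m + 1` reals with given sum `t` and sum of squares at most `t ^ 2`, the sum
of `φ |w i|` is largest for a family of the form `(c, e, …, e)` with `0 ≤ e ≤ c`. -/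
lemma exists_sum_le {ι : Type*} [DecidableEq ι] {s : Finset ι} {m : ℕ} (hm : 1 ≤ m)
    (hs : s.card = m + 1) {w : ι → ℝ} (ht : 0 < ∑ i ∈ s, w i)
    (hv : ∑ i ∈ s, w i ^ 2 ≤ (∑ i ∈ s, w i) ^ 2) {φ ψ : ℝ → ℝ} (hψ : ConvexOn ℝ (Ici 0) ψ)
    (hψ0 : ψ 0 = 0) (hφ : ∀ x, 0 ≤ x → HasDerivAt φ (ψ x) x) :
    ∃ c e : ℝ, 0 ≤ e ∧ e ≤ c ∧ 0 < c ∧ c + m * e = ∑ i ∈ s, w i ∧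
      c ^ 2 + m * e ^ 2 = ∑ i ∈ s, w i ^ 2 ∧ ∑ i ∈ s, φ |w i| ≤ φ c + m * φ e := by
  have hm0 : (0 : ℝ) < m := by exact_mod_cast hm
  obtain ⟨t, htt⟩ : ∃ t, t = ∑ i ∈ s, w i := ⟨_, rfl⟩
  obtain ⟨v, hvv⟩ : ∃ v, v = ∑ i ∈ s, w i ^ 2 := ⟨_, rfl⟩
  have hcs : t ^ 2 ≤ (m + 1) * v := by
    have := sq_sum_le_card_mul_sum_sq (s := s) (f := w)
    rw [hs] at this
    push_cast at this
    rwa [htt, hvv]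
  rw [← htt, ← hvv] at hv ⊢
  rw [← htt] at ht
  obtain ⟨D, hD⟩ : ∃ D, D = Real.sqrt (((m + 1) * v - t ^ 2) / m) := ⟨_, rfl⟩
  have hD0 : 0 ≤ D := hD ▸ Real.sqrt_nonneg _
  have hD2 : m * D ^ 2 = (m + 1) * v - t ^ 2 := by
    rw [hD, Real.sq_sqrt (div_nonneg (by linarith) hm0.le)]
    field_simp
  have hDt : D ≤ t := by
    refine abs_le_of_sq_le_sq' (le_of_mul_le_mul_left ?_ hm0) ht.le |>.2
    nlinarith
  obtain ⟨e, he⟩ : ∃ e, e = (t - D) / (m + 1) := ⟨_, rfl⟩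
  have he' : (m + 1) * e = t - D := by rw [he]; field_simp
  have he0 : 0 ≤ e := he ▸ div_nonneg (by linarith) (by linarith)
  have hct : (e + D) + m * e = t := by linarith
  have hcv : (e + D) ^ 2 + m * e ^ 2 = v := by
    have h1 : (m + 1 : ℝ) * ((e + D) ^ 2 + m * e ^ 2) = (m + 1) * v := by
      have : t = (m + 1) * e + D := by linarith
      rw [this] at hD2
      linear_combination hD2
    exact mul_left_cancel₀ (by positivity) h1
  obtain ⟨c, hc⟩ : ∃ c, c = e + D := ⟨_, rfl⟩
  rw [← hc] at hct hcv
  have hec : e ≤ c := by linarith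
  have hc0 : 0 < c := by
    by_contra! h
    have : (m : ℝ) * e ≤ 0 := mul_nonpos_of_nonneg_of_nonpos hm0.le (by linarith)
    linarith
  have hw : ∀ i ∈ s, 0 ≤ (c - w i) * ((m + 1) * w i + (m - 1) * c - 2 * m * e) := by
    intro i hi
    have h1 := sq_sum_le_card_mul_sum_sq (s := s.erase i) (f := w)
    rw [Finset.card_erase_of_mem hi, hs, Nat.add_sub_cancel] at h1
    have h2 := Finset.add_sum_erase s w hi
    have h3 := Finset.add_sum_erase s (fun j => w j ^ 2) hi
    rw [← htt, ← hct] at h2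
    rw [← hvv, ← hcv] at h3
    rw [show ∑ j ∈ s.erase i, w j = c + m * e - w i by linarith,
      show ∑ j ∈ s.erase i, w j ^ 2 = c ^ 2 + m * e ^ 2 - w i ^ 2 by linarith] at h1
    linarith
  refine ⟨c, e, he0, hec, hc0, hct, hcv, ?_⟩
  rcases hec.eq_or_lt with rfl | hec
  · have : ∀ i ∈ s, w i = e := fun i hi => by
      have h1 := hw i hi
      have h2 : 0 ≤ (m + 1 : ℝ) * -(e - w i) ^ 2 := by linarith
      have h3 := nonneg_of_mul_nonneg_right h2 (by linarith)
      nlinarith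
    rw [Finset.sum_congr rfl fun i hi => by rw [this i hi, abs_of_nonneg he0], Finset.sum_const,
      hs, nsmul_eq_mul]
    push_cast
    linarith
  · obtain ⟨A, B, C, hABC, h_c, h_e⟩ := exists_quadratic_majorant hψ hψ0 hφ he0 hec
    have hwc : ∀ i ∈ s, |w i| ≤ c := by
      intro i hi
      have h1 := hw i hi
      have hmc : (m : ℝ) * e < m * c := mul_lt_mul_of_pos_left hec hm0
      have hme : 0 ≤ (m : ℝ) * e := by positivity
      rw [abs_le]
      constructor
      · by_contra! h
        have h2 : (m + 1) * w i < (m + 1) * -c := mul_lt_mul_of_pos_left h (by linarith)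
        have := mul_neg_of_pos_of_neg (show 0 < c - w i by linarith)
          (show (m + 1) * w i + (m - 1) * c - 2 * m * e < 0 by linarith)
        linarith
      · by_contra! h
        have h2 : (m + 1) * c < (m + 1) * w i := mul_lt_mul_of_pos_left h (by linarith)
        have := mul_neg_of_neg_of_pos (show c - w i < 0 by linarith)
          (show 0 < (m + 1) * w i + (m - 1) * c - 2 * m * e by linarith)
        linarith
    calc ∑ i ∈ s, φ |w i| ≤ ∑ i ∈ s, (A + B * w i + C * w i ^ 2) :=
          Finset.sum_le_sum fun i hi => hABC _ (hwc i hi)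
      _ = (m + 1) * A + B * t + C * v := by
          rw [Finset.sum_add_distrib, Finset.sum_add_distrib, ← Finset.mul_sum, ← Finset.mul_sum,
            Finset.sum_const, hs, nsmul_eq_mul, htt, hvv]
          push_cast
          ring
      _ = φ c + m * φ e := by rw [h_c, h_e, ← hct, ← hcv]; ring

/-- If a zero-sum unit vector has a coordinate of square at least `1 / 2`, then its signed
`(r+1)`-power sum is at most that of a normalised vector `(1 + m * y, -1, -y, …, -y)`. -/
lemma exists_signed_sum_le_profile {m : ℕ} (hm : 1 ≤ m) {x : Fin (m + 2) → ℝ}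
    (hx2 : ∑ i, x i ^ 2 = 1) (hx : ∑ i, x i = 0) {i₀ : Fin (m + 2)} (hpos : 0 < x i₀)
    (hi₀ : 1 / 2 ≤ x i₀ ^ 2) {r k : ℝ} (hr : 0 < r)
    (hconv : ConvexOn ℝ (Ici 0) fun y : ℝ => k * ((r + 1) * y ^ r)) :
    ∃ y ∈ Icc (0 : ℝ) 1,
      k * ∑ i, |x i| ^ (r + 1) ≤ k * Real.exp (profile m r y) := by
  have hsum := Finset.add_sum_erase Finset.univ x (Finset.mem_univ i₀)
  have hsum2 := Finset.add_sum_erase Finset.univ (fun i => x i ^ 2) (Finset.mem_univ i₀)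
  rw [hx] at hsum
  rw [hx2] at hsum2
  have ht : ∑ i ∈ Finset.univ.erase i₀, -x i = x i₀ := by
    rw [Finset.sum_neg_distrib]; linarith
  have hv : ∑ i ∈ Finset.univ.erase i₀, (-x i) ^ 2 = 1 - x i₀ ^ 2 := by
    simp only [neg_sq]; linarith
  obtain ⟨c, e, he0, hec, hc0, hct, hcv, hle⟩ := exists_sum_le (s := Finset.univ.erase i₀)
    (m := m) (w := fun i => -x i) hm (by simp) (by rw [ht]; exact hpos) (by rw [ht, hv]; linarith)
    (φ := fun y => k * y ^ (r + 1)) hconv (by simp [Real.zero_rpow hr.ne']) fun y _ => by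
      simpa using (Real.hasDerivAt_rpow_const (x := y) (p := r + 1)
        (Or.inr (by linarith))).const_mul k
  rw [ht] at hct
  rw [hv] at hcv
  refine ⟨e / c, ⟨by positivity, (div_le_one hc0).2 hec⟩, ?_⟩
  have hy : e / c * c = e := div_mul_cancel₀ _ hc0.ne'
  obtain ⟨y, hyy⟩ : ∃ y, y = e / c := ⟨_, rfl⟩
  have hy0 : 0 ≤ y := by rw [hyy]; positivity
  rw [← hyy] at hy ⊢
  have hxu : x i₀ = c * (1 + m * y) := by rw [← hct, ← hy]; ring
  have hN : c ^ 2 * ((1 + m * y) ^ 2 + 1 + m * y ^ 2) = 1 := by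
    rw [hxu, ← hy] at hcv
    linear_combination hcv
  have hNpos : 0 < (1 + m * y) ^ 2 + 1 + m * y ^ 2 := by positivity
  have hT : 0 < (1 + m * y) ^ (r + 1) + 1 + m * y ^ (r + 1) := by positivity
  have hexp : Real.exp (profile m r y) =
      c ^ (r + 1) * ((1 + m * y) ^ (r + 1) + 1 + m * y ^ (r + 1)) := by
    have hlog : Real.log ((1 + m * y) ^ 2 + 1 + m * y ^ 2) = -(2 * Real.log c) := by
      have := congrArg Real.log hN
      rw [Real.log_mul (by positivity) hNpos.ne', Real.log_pow, Real.log_one] at this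
      push_cast at this
      linarith
    rw [profile, hlog, Real.exp_sub, Real.exp_log hT, Real.rpow_def_of_pos hc0, div_eq_mul_inv,
      ← Real.exp_neg, mul_comm]
    ring_nf
  rw [hexp, ← Finset.add_sum_erase Finset.univ (fun i => |x i| ^ (r + 1)) (Finset.mem_univ i₀),
    mul_add, Finset.mul_sum, abs_of_pos hpos]
  simp only [abs_neg] at hle
  have e1 : x i₀ ^ (r + 1) = c ^ (r + 1) * (1 + m * y) ^ (r + 1) := by
    rw [hxu, Real.mul_rpow hc0.le (by positivity)]
  have e2 : e ^ (r + 1) = c ^ (r + 1) * y ^ (r + 1) := by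
    rw [← hy, mul_comm, Real.mul_rpow hc0.le hy0]
  rw [e2] at hle
  rw [e1]
  linarith

lemma profile_zero (m : ℝ) {α : ℝ} (hα : 0 < α) :
    profile m (2 * α - 1) 0 = (1 - α) * Real.log 2 := by
  have h : 2 * α - 1 + 1 = 2 * α := by ring
  simp only [profile, h, mul_zero, add_zero, Real.one_rpow,
    Real.zero_rpow (by positivity : 2 * α ≠ 0)]
  norm_num
  ring

lemma profile_one {m : ℝ} (hm : 0 ≤ m) (α : ℝ) :
    profile m (2 * α - 1) 1 =
      Real.log (((m + 1) ^ α + (m + 1) ^ (1 - α)) / (m + 2) ^ α) := by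
  have h1 : 0 < m + 1 := by linarith
  have h2 : 0 < m + 2 := by linarith
  have e1 : 2 * α - 1 + 1 = 2 * α := by ring
  have e2 : (1 + m * 1) ^ 2 + 1 + m * 1 ^ 2 = (m + 1) * (m + 2) := by ring
  have e3 : (1 + m * 1) ^ (2 * α) + 1 + m * 1 ^ (2 * α) =
      (m + 1) ^ α * ((m + 1) ^ α + (m + 1) ^ (1 - α)) := by
    rw [mul_add, ← Real.rpow_add h1, ← Real.rpow_add h1, Real.one_rpow]
    ring_nf
    rw [Real.rpow_one]
    ring
  rw [profile, e1, e2, e3, Real.log_mul (by positivity) (by positivity),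
    Real.log_div (by positivity) (by positivity), Real.log_mul h1.ne' h2.ne', Real.log_rpow h1,
    Real.log_rpow h2]
  ring

lemma sq_abs_rpow (a α : ℝ) : (|a| ^ 2) ^ α = |a| ^ (2 * α) := by
  rw [Real.rpow_mul (abs_nonneg a), Real.rpow_two]

lemma exp_profile_zero (m : ℝ) {α : ℝ} (hα : 0 < α) :
    Real.exp (profile m (2 * α - 1) 0) = 2 * (1 / 2) ^ α := by
  rw [profile_zero m hα, Real.rpow_def_of_pos (by norm_num), one_div, Real.log_inv,
    show (1 - α) * Real.log 2 = Real.log 2 + -Real.log 2 * α by ring, Real.exp_add,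
    Real.exp_log two_pos]

lemma sq_abs_rpow_eq_sq_mul {a α : ℝ} (hα : 0 < α) : (|a| ^ 2) ^ α = a ^ 2 * (a ^ 2) ^ (α - 1) := by
  rcases eq_or_ne a 0 with rfl | ha
  · simp [Real.zero_rpow hα.ne']
  · rw [sq_abs, mul_comm, Real.rpow_sub_one (by positivity), div_mul_cancel₀ _ (by positivity)]

/-- Power sums with exponent above `1` of a probability vector with entries at most `1 / 2`. -/
lemma sum_le_of_forall_sq_le {ι : Type*} [Fintype ι] {x : ι → ℝ} (hx2 : ∑ i, x i ^ 2 = 1)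
    (h : ∀ i, x i ^ 2 ≤ 1 / 2) {α : ℝ} (hα : 1 < α) :
    ∑ i, (|x i| ^ 2) ^ α ≤ 2 * (1 / 2) ^ α := by
  have e : 2 * (1 / 2 : ℝ) ^ α = ∑ i, x i ^ 2 * (1 / 2) ^ (α - 1) := by
    rw [← Finset.sum_mul, hx2, one_mul, Real.rpow_sub_one (by norm_num)]
    ring
  rw [e]
  refine Finset.sum_le_sum fun i _ => ?_
  rw [sq_abs_rpow_eq_sq_mul (by linarith)]
  exact mul_le_mul_of_nonneg_left (Real.rpow_le_rpow (sq_nonneg _) (h i) (by linarith))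
    (sq_nonneg _)

lemma le_sum_of_forall_sq_le {ι : Type*} [Fintype ι] {x : ι → ℝ} (hx2 : ∑ i, x i ^ 2 = 1)
    (h : ∀ i, x i ^ 2 ≤ 1 / 2) {α : ℝ} (hα0 : 0 < α) (hα : α < 1) :
    2 * (1 / 2) ^ α ≤ ∑ i, (|x i| ^ 2) ^ α := by
  have e : 2 * (1 / 2 : ℝ) ^ α = ∑ i, x i ^ 2 * (1 / 2) ^ (α - 1) := by
    rw [← Finset.sum_mul, hx2, one_mul, Real.rpow_sub_one (by norm_num)]
    ring
  rw [e]
  refine Finset.sum_le_sum fun i _ => ?_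
  rw [sq_abs_rpow_eq_sq_mul hα0]
  rcases (sq_nonneg (x i)).eq_or_lt with h0 | h0
  · simp [← h0]
  · exact mul_le_mul_of_nonneg_left (Real.rpow_le_rpow_of_nonpos h0 (h i) (by linarith))
      (sq_nonneg _)

/-- For `α ≤ 1 / 2`, subadditivity of the `2α`-th power gives the bound `2 * (1 / 2) ^ α`. -/
lemma le_sum_of_le_half {ι : Type*} [Fintype ι] [DecidableEq ι] {x : ι → ℝ}
    (hx2 : ∑ i, x i ^ 2 = 1) (hx : ∑ i, x i = 0) {i₀ : ι} (hpos : 0 < x i₀)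
    (hi₀ : 1 / 2 ≤ x i₀ ^ 2) {α : ℝ} (hα0 : 0 < α) (hα : α ≤ 1 / 2) :
    2 * (1 / 2) ^ α ≤ ∑ i, (|x i| ^ 2) ^ α := by
  have hsum := Finset.add_sum_erase Finset.univ x (Finset.mem_univ i₀)
  have hsum2 := Finset.add_sum_erase Finset.univ (fun i => x i ^ 2) (Finset.mem_univ i₀)
  rw [hx] at hsum
  rw [hx2] at hsum2
  obtain ⟨t, ht⟩ : ∃ t, t = x i₀ := ⟨_, rfl⟩
  rw [← ht] at hsum hpos hi₀
  have hle : ∀ i ∈ Finset.univ.erase i₀, |x i| ≤ t := fun i hi => by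
    have := Finset.single_le_sum (f := fun i => x i ^ 2) (fun j _ => sq_nonneg (x j)) hi
    refine abs_le_of_sq_le_sq ?_ hpos.le
    simp only [← ht] at hsum2
    linarith
  have hterm : ∀ i ∈ Finset.univ.erase i₀, -x i * (t ^ (2 * α) / t) ≤ (|x i| ^ 2) ^ α := by
    intro i hi
    have h1 : |x i| / t ≤ (|x i| / t) ^ (2 * α) :=
      Real.self_le_rpow_of_le_one (by positivity) ((div_le_one hpos).2 (hle i hi)) (by linarith)
    rw [Real.div_rpow (abs_nonneg _) hpos.le, ← sq_abs_rpow, le_div_iff₀ (by positivity)] at h1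
    calc -x i * (t ^ (2 * α) / t) ≤ |x i| * (t ^ (2 * α) / t) :=
          mul_le_mul_of_nonneg_right (neg_le_abs _) (by positivity)
      _ = |x i| / t * t ^ (2 * α) := by ring
      _ ≤ _ := h1
  have hrest := Finset.sum_le_sum hterm
  rw [← Finset.sum_mul, Finset.sum_neg_distrib,
    show -∑ i ∈ Finset.univ.erase i₀, x i = t by linarith, mul_div_cancel₀ _ hpos.ne'] at hrest
  have hmain : (1 / 2 : ℝ) ^ α ≤ t ^ (2 * α) := by
    rw [Real.rpow_mul hpos.le, Real.rpow_two]
    exact Real.rpow_le_rpow (by norm_num) hi₀ hα0.le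
  rw [← Finset.add_sum_erase Finset.univ (fun i => (|x i| ^ 2) ^ α) (Finset.mem_univ i₀), ← ht,
    sq_abs_rpow, abs_of_pos hpos]
  linarith

lemma natCast_eq_one_or_two_le_natCast {m : ℕ} (hm : 1 ≤ m) : (m : ℝ) = 1 ∨ 2 ≤ (m : ℝ) := by
  rcases hm.eq_or_lt with h | h
  · exact Or.inl (by exact_mod_cast h.symm)
  · exact Or.inr (by exact_mod_cast h)

lemma sum_sq_abs_rpow_pos {ι : Type*} [Fintype ι] {x : ι → ℝ} (hx2 : ∑ i, x i ^ 2 = 1) (α : ℝ) :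
    0 < ∑ i, (|x i| ^ 2) ^ α := by
  obtain ⟨i, hi, hne⟩ := Finset.exists_ne_zero_of_sum_ne_zero (by rw [hx2]; exact one_ne_zero)
  have : 0 < |x i| := abs_pos.2 fun h => hne (by rw [h]; norm_num)
  exact Finset.sum_pos' (fun j _ => by positivity) ⟨i, hi, by positivity⟩

lemma log_sum_bound_of_pos {m : ℕ} (hm : 1 ≤ m) {x : Fin (m + 2) → ℝ} (hx2 : ∑ i, x i ^ 2 = 1)
    (hx : ∑ i, x i = 0) {i₀ : Fin (m + 2)} (hpos : 0 < x i₀) (hi₀ : 1 / 2 ≤ x i₀ ^ 2) {α : ℝ}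
    (hα0 : 0 < α) :
    (1 < α → Real.log (∑ i, (|x i| ^ 2) ^ α) ≤
      max (profile m (2 * α - 1) 0) (profile m (2 * α - 1) 1)) ∧
    (α < 1 → min (profile m (2 * α - 1) 0) (profile m (2 * α - 1) 1) ≤
      Real.log (∑ i, (|x i| ^ 2) ^ α)) := by
  have hS := sum_sq_abs_rpow_pos hx2 α
  have hm1 : (1 : ℝ) ≤ m := by exact_mod_cast hm
  have e : ∑ i, (|x i| ^ 2) ^ α = ∑ i, |x i| ^ (2 * α - 1 + 1) := by
    simp only [sq_abs_rpow, sub_add_cancel]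
  constructor
  · intro hα
    obtain ⟨y, hy, hle⟩ := exists_signed_sum_le_profile hm hx2 hx hpos hi₀ (r := 2 * α - 1)
      (k := 1) (by linarith)
      (((convexOn_rpow (p := 2 * α - 1) (by linarith)).smul (by linarith : (0 : ℝ) ≤ 2 * α - 1 + 1)).congr
        fun z _ => by simp)
    rw [one_mul, one_mul, ← e, ← Real.log_le_iff_le_exp hS] at hle
    exact hle.trans (profile_le_max (natCast_eq_one_or_two_le_natCast hm) (by linarith) hy)
  · intro hα
    rcases le_or_gt α (1 / 2) with hα2 | hα2
    · refine (min_le_left _ _).trans ?_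
      rw [Real.le_log_iff_exp_le hS, exp_profile_zero _ hα0]
      exact le_sum_of_le_half hx2 hx hpos hi₀ hα0 hα2
    · obtain ⟨y, hy, hle⟩ := exists_signed_sum_le_profile hm hx2 hx hpos hi₀ (r := 2 * α - 1)
        (k := -1) (by linarith)
        (((Real.concaveOn_rpow (p := 2 * α - 1) (by linarith) (by linarith)).smul
          (by linarith : (0 : ℝ) ≤ 2 * α - 1 + 1)).neg.congr fun z _ => by simp)
      rw [neg_one_mul, neg_one_mul, neg_le_neg_iff, ← e, ← Real.le_log_iff_exp_le hS] at hle
      exact (min_le_profile hm1 (by linarith) (by linarith) hy).trans hle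

/-- The extremal values of `log ∑ i, |x i| ^ (2 * α)` over zero-sum unit vectors. -/
lemma log_sum_bound {m : ℕ} (hm : 1 ≤ m) {x : Fin (m + 2) → ℝ} (hx2 : ∑ i, x i ^ 2 = 1)
    (hx : ∑ i, x i = 0) {α : ℝ} (hα0 : 0 < α) :
    (1 < α → Real.log (∑ i, (|x i| ^ 2) ^ α) ≤
      max (profile m (2 * α - 1) 0) (profile m (2 * α - 1) 1)) ∧
    (α < 1 → min (profile m (2 * α - 1) 0) (profile m (2 * α - 1) 1) ≤
      Real.log (∑ i, (|x i| ^ 2) ^ α)) := by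
  by_cases h : ∀ i, x i ^ 2 ≤ 1 / 2
  · have hS := sum_sq_abs_rpow_pos hx2 α
    refine ⟨fun hα => le_max_of_le_left ?_, fun hα => min_le_of_left_le ?_⟩
    · rw [Real.log_le_iff_le_exp hS, exp_profile_zero _ hα0]
      exact sum_le_of_forall_sq_le hx2 h hα
    · rw [Real.le_log_iff_exp_le hS, exp_profile_zero _ hα0]
      exact le_sum_of_forall_sq_le hx2 h hα0 hα
  · push Not at h
    obtain ⟨i₀, hi₀⟩ := h
    rcases lt_trichotomy (x i₀) 0 with h0 | h0 | h0
    · simpa using log_sum_bound_of_pos hm (x := fun i => -x i) (by simpa using hx2) (by simpa using hx)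
        (neg_pos.2 h0) (by simpa using hi₀.le) hα0
    · norm_num [h0] at hi₀
    · exact log_sum_bound_of_pos hm hx2 hx h0 hi₀.le hα0

lemma exists_log_sum_eq_profile_zero (m : ℕ) {α : ℝ} (hα : 0 < α) :
    ∃ x : Fin (m + 2) → ℝ, ∑ i, x i ^ 2 = 1 ∧ ∑ i, x i = 0 ∧
      Real.log (∑ i, (|x i| ^ 2) ^ α) = profile m (2 * α - 1) 0 := by
  have h : √(1 / 2 : ℝ) ^ 2 = 1 / 2 := Real.sq_sqrt (by norm_num)
  refine ⟨Fin.cons √(1 / 2) (Fin.cons (-√(1 / 2)) fun _ => 0), ?_, ?_, ?_⟩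
  · simp only [Fin.sum_univ_succ, Fin.cons_zero, Fin.cons_succ, neg_sq, h]
    norm_num
  · simp [Fin.sum_univ_succ]
  · rw [← Real.log_exp (profile m (2 * α - 1) 0), exp_profile_zero _ hα]
    simp only [Fin.sum_univ_succ, Fin.cons_zero, Fin.cons_succ, sq_abs, neg_sq, h]
    congr 1
    simp [Real.zero_rpow hα.ne']
    ring

lemma exists_log_sum_eq_profile_one (m : ℕ) (α : ℝ) :
    ∃ x : Fin (m + 2) → ℝ, ∑ i, x i ^ 2 = 1 ∧ ∑ i, x i = 0 ∧
      Real.log (∑ i, (|x i| ^ 2) ^ α) = profile m (2 * α - 1) 1 := by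
  have h1 : (0 : ℝ) < m + 1 := by positivity
  have h2 : (0 : ℝ) < m + 2 := by positivity
  obtain ⟨b, hb⟩ : ∃ b : ℝ, b = √(1 / ((m + 1) * (m + 2))) := ⟨_, rfl⟩
  have hb2 : b ^ 2 = 1 / ((m + 1) * (m + 2)) := by rw [hb]; exact Real.sq_sqrt (by positivity)
  have ha2 : ((m + 1) * b) ^ 2 = (m + 1) / (m + 2) := by rw [mul_pow, hb2]; field_simp
  refine ⟨Fin.cons ((m + 1) * b) fun _ => -b, ?_, ?_, ?_⟩
  · simp only [Fin.sum_univ_succ (n := m + 1), Fin.cons_zero, Fin.cons_succ, neg_sq, ha2, hb2,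
      Finset.sum_const, Finset.card_univ, Fintype.card_fin, nsmul_eq_mul]
    push_cast
    field_simp
    ring
  · simp only [Fin.sum_univ_succ (n := m + 1), Fin.cons_zero, Fin.cons_succ,
      Finset.sum_const, Finset.card_univ, Fintype.card_fin, nsmul_eq_mul]
    push_cast
    ring
  · rw [profile_one (by positivity)]
    simp only [Fin.sum_univ_succ (n := m + 1), Fin.cons_zero, Fin.cons_succ, sq_abs, neg_sq, ha2,
      hb2, Finset.sum_const, Finset.card_univ, Fintype.card_fin, nsmul_eq_mul]
    congr 1
    rw [Real.div_rpow h1.le h2.le, Real.div_rpow zero_le_one (by positivity), Real.one_rpow,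
      Real.mul_rpow h1.le h2.le, Real.rpow_sub h1, Real.rpow_one]
    push_cast
    field_simp

end RenyiZeroSum


/-- For `d ≥ 3` and `α ∈ (0,1) ∪ (1,∞)`, the minimum of the `α`-Rényi entropy
`H_α(P_x) = (1/(1-α)) log ∑_i (|x_i|²)^α` over unit vectors `x ∈ ℝ^d` with zero sum
equals `min { log 2, (1/(1-α)) log(((d-1)^α + (d-1)^(1-α)) / d^α) }`. -/
theorem min_renyi_entropy (d : ℕ) (hd : 3 ≤ d) (α : ℝ) (hα0 : 0 < α) (hα1 : α ≠ 1) :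
    IsLeast { h : ℝ | ∃ x : Fin d → ℝ, (∑ i, (x i) ^ 2) = 1 ∧ (∑ i, x i) = 0 ∧
        h = (1 / (1 - α)) * Real.log (∑ i, (|x i| ^ 2) ^ α) }
      (min (Real.log 2)
        ((1 / (1 - α)) *
          Real.log (((d - 1 : ℝ) ^ α + (d - 1 : ℝ) ^ (1 - α)) / (d : ℝ) ^ α))) := by
  obtain ⟨m, rfl⟩ : ∃ m, d = m + 2 := ⟨d - 2, by omega⟩
  have hα : 1 - α ≠ 0 := sub_ne_zero.2 hα1.symm
  have e0 : Real.log 2 = 1 / (1 - α) * RenyiZeroSum.profile m (2 * α - 1) 0 := by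
    rw [RenyiZeroSum.profile_zero _ hα0]
    field_simp
  have e1 : Real.log ((((m + 2 : ℕ) - 1 : ℝ) ^ α + ((m + 2 : ℕ) - 1 : ℝ) ^ (1 - α)) /
      ((m + 2 : ℕ) : ℝ) ^ α) = RenyiZeroSum.profile m (2 * α - 1) 1 := by
    rw [RenyiZeroSum.profile_one (by positivity)]
    push_cast
    rw [show (m + 2 - 1 : ℝ) = m + 1 by ring]
  rw [e0, e1]
  constructor
  · rcases min_choice (1 / (1 - α) * RenyiZeroSum.profile m (2 * α - 1) 0)
      (1 / (1 - α) * RenyiZeroSum.profile m (2 * α - 1) 1) with h | h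
    · obtain ⟨x, hx2, hx, hS⟩ := RenyiZeroSum.exists_log_sum_eq_profile_zero m hα0
      exact ⟨x, hx2, hx, by rw [h, hS]⟩
    · obtain ⟨x, hx2, hx, hS⟩ := RenyiZeroSum.exists_log_sum_eq_profile_one m α
      exact ⟨x, hx2, hx, by rw [h, hS]⟩
  · rintro _ ⟨x, hx2, hx, rfl⟩
    obtain ⟨hgt, hlt⟩ := RenyiZeroSum.log_sum_bound (by omega) hx2 hx hα0
    rcases lt_or_gt_of_ne hα1 with h | h
    · have hk : 0 ≤ 1 / (1 - α) := one_div_nonneg.2 (by linarith)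
      rw [← mul_min_of_nonneg _ _ hk]
      exact mul_le_mul_of_nonneg_left (hlt h) hk
    · have hk : 1 / (1 - α) ≤ 0 := one_div_nonpos.2 (by linarith)
      rcases le_max_iff.1 (hgt h) with h | h
      · exact (min_le_left _ _).trans (mul_le_mul_of_nonpos_left h hk)
      · exact (min_le_right _ _).trans (mul_le_mul_of_nonpos_left h hk)
end
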